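/- Let f ∈ L log L(𝕋²) and for n ≥ 1 define I_n(x,y,f) = (1/2π²) p.v. ∬_{𝕋²} [cos(nu) / (4 tan((u+v)/2) tan(v/2))] f(x+u+v, y+v) du dv. Then there is an absolute constant c > 0 such that for every λ > 0, |{(x,y) ∈ 𝕋² : bmo[I_n(x,y,f)] > λ}| ≤ (c/λ)·(1 + ∬_{𝕋²} |f| log⁺|f|). -/

import Mathlib

open MeasureTheory Filter Set

noncomputable section

/-- `[-π, π)`, a fundamental domain for the circle `𝕋 = ℝ/2πℤ`. -/
def T1 : Set ℝ := Set.Ico (-Real.pi) Real.pi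

/-- `[-π, π)²`, a fundamental domain for the torus `𝕋²`. -/
def T2 : Set (ℝ × ℝ) := T1 ×ˢ T1

/-- `log⁺ u = log u` for `u > 1`, and `0` otherwise. -/
def logPlus (u : ℝ) : ℝ := if 1 < u then Real.log u else 0

/-- `f` is `2π`-periodic in each variable. -/
def Biperiodic (f : ℝ × ℝ → ℝ) : Prop :=
  ∀ x y : ℝ, f (x + 2 * Real.pi, y) = f (x, y) ∧ f (x, y + 2 * Real.pi) = f (x, y)

/-- Fourier coefficients `f̂(m,n)` of a function on `𝕋²`. -/
def fourierCoef2 (f : ℝ × ℝ → ℝ) (m n : ℤ) : ℂ :=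
  (1 / (4 * (Real.pi : ℂ) ^ 2)) *
    ∫ p in T2, (f p : ℂ) * Complex.exp (-Complex.I * ((m : ℂ) * (p.1 : ℂ) + (n : ℂ) * (p.2 : ℂ)))

/-- Quadratic partial sums `S_{nn}(x, y, f)` of the double Fourier series.
(For real `f` the symmetric sum is real, so we take the real part.) -/
def Snn (f : ℝ × ℝ → ℝ) (n : ℕ) (x y : ℝ) : ℝ :=
  (∑ m ∈ Finset.Icc (-(n : ℤ)) (n : ℤ), ∑ k ∈ Finset.Icc (-(n : ℤ)) (n : ℤ),
    fourierCoef2 f m k * Complex.exp (Complex.I * ((m : ℂ) * (x : ℂ) + (k : ℂ) * (y : ℂ)))).re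

/-- The `BMO[0,1]` norm:
`‖g‖_BMO = sup_{I ⊂ [0,1]} (1/|I|) ∫_I |g - g_I| + |∫_0^1 g|`. -/
def bmoNorm (g : ℝ → ℝ) : ℝ :=
  (⨆ I : {p : ℝ × ℝ // 0 ≤ p.1 ∧ p.1 < p.2 ∧ p.2 ≤ 1},
      (I.1.2 - I.1.1)⁻¹ *
        ∫ t in Set.Icc I.1.1 I.1.2,
          |g t - (I.1.2 - I.1.1)⁻¹ * ∫ s in Set.Icc I.1.1 I.1.2, g s|) +
    |∫ t in Set.Icc (0 : ℝ) 1, g t|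

/-- The step function `Σ_{k=0}^n ξ_k 𝟙_{δ_k^n}` with `δ_k^n = [k/(n+1), (k+1)/(n+1)]`. -/
def stepFun (ξ : ℕ → ℝ) (n : ℕ) (t : ℝ) : ℝ :=
  ∑ k ∈ Finset.range (n + 1),
    Set.indicator (Set.Icc ((k : ℝ) / ((n : ℝ) + 1)) (((k : ℝ) + 1) / ((n : ℝ) + 1)))
      (fun _ => ξ k) t

/-- `bmo[ξ_n] = sup_{n ≥ 0} ‖Σ_{k=0}^n ξ_k 𝟙_{δ_k^n}‖_BMO`. -/
def bmoSeq (ξ : ℕ → ℝ) : ℝ := ⨆ n : ℕ, bmoNorm (stepFun ξ n)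

/-- `L` is the principal value `p.v. ∫_𝕋 g`, i.e. the limit as `ε → 0⁺` of the
integrals over `{ε < |t| < π}`. -/
def pvT1 (g : ℝ → ℝ) (L : ℝ) : Prop :=
  Filter.Tendsto (fun ε : ℝ => ∫ t in {t : ℝ | ε < |t| ∧ |t| < Real.pi}, g t)
    (nhdsWithin 0 (Set.Ioi 0)) (nhds L)

/-- `L` is the two-dimensional principal value `p.v. ∬_{𝕋²} g`, the limit as `ε → 0⁺`
of the integrals over `{ε < |t| < π, ε < |s| < π}`. -/
def pvT2 (g : ℝ × ℝ → ℝ) (L : ℝ) : Prop :=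
  Filter.Tendsto
    (fun ε : ℝ =>
      ∫ q in {q : ℝ × ℝ | (ε < |q.1| ∧ |q.1| < Real.pi) ∧ ε < |q.2| ∧ |q.2| < Real.pi}, g q)
    (nhdsWithin 0 (Set.Ioi 0)) (nhds L)

/-- Luxemburg norm with respect to a Young function `M`. -/
def luxNorm {α : Type*} [MeasurableSpace α] (μ : Measure α) (M : ℝ → ℝ) (g : α → ℝ) : ℝ :=
  sInf {lam : ℝ | 0 < lam ∧ ∫⁻ x, ENNReal.ofReal (M (|g x| / lam)) ∂μ ≤ 1}

/-- The Young function `Φ(t) = t log⁺ t`. -/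
def PhiY (t : ℝ) : ℝ := t * logPlus t

/-- The Young function `Ψ(t) = eᵗ - 1`. -/
def PsiY (t : ℝ) : ℝ := Real.exp t - 1

/-- Principal value `p.v. ∬_{𝕋²} g du dv` for kernels singular on
`{sin((u+v)/2) = 0} ∪ {sin(v/2) = 0}`: the limit as `ε → 0⁺` of the integrals over the
truncated domains `{(u,v) ∈ 𝕋² : ε < |sin((u+v)/2)|, ε < |sin(v/2)|}`. -/
def pvI (g : ℝ × ℝ → ℝ) (L : ℝ) : Prop :=
  Filter.Tendsto
    (fun ε : ℝ =>
      ∫ q in {q : ℝ × ℝ | q ∈ T2 ∧ ε < |Real.sin ((q.1 + q.2) / 2)| ∧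
        ε < |Real.sin (q.2 / 2)|}, g q)
    (nhdsWithin 0 (Set.Ioi 0)) (nhds L)

noncomputable section

/-! ### Kernels -/

/-- Poisson type kernel. -/
def pk (e u : ℝ) : ℝ := e / (e ^ 2 + Real.sin (u / 2) ^ 2)
/-- Conjugate Poisson type kernel. -/
def ck (e u : ℝ) : ℝ := Real.sin (u / 2) * Real.cos (u / 2) / (e ^ 2 + Real.sin (u / 2) ^ 2)
/-- Sharply truncated cotangent kernel. -/
def hk (e u : ℝ) : ℝ := if e < |Real.sin (u / 2)| then Real.cos (u / 2) / Real.sin (u / 2) else 0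

lemma sin_half_add_two_pi (u : ℝ) : Real.sin ((u + 2 * Real.pi) / 2) = - Real.sin (u / 2) := by
  rw [show (u + 2 * Real.pi) / 2 = u / 2 + Real.pi by ring, Real.sin_add_pi]

lemma cos_half_add_two_pi (u : ℝ) : Real.cos ((u + 2 * Real.pi) / 2) = - Real.cos (u / 2) := by
  rw [show (u + 2 * Real.pi) / 2 = u / 2 + Real.pi by ring, Real.cos_add_pi]

lemma pk_periodic (e : ℝ) : Function.Periodic (pk e) (2 * Real.pi) := by
  intro u; simp [pk, sin_half_add_two_pi]

lemma ck_periodic (e : ℝ) : Function.Periodic (ck e) (2 * Real.pi) := by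
  intro u; simp [ck, sin_half_add_two_pi, cos_half_add_two_pi]

lemma hk_periodic (e : ℝ) : Function.Periodic (hk e) (2 * Real.pi) := by
  intro u; simp [hk, sin_half_add_two_pi, cos_half_add_two_pi]

lemma pk_neg (e u : ℝ) : pk e (-u) = pk e u := by
  simp [pk, neg_div]

lemma ck_neg (e u : ℝ) : ck e (-u) = - ck e u := by
  simp [ck, neg_div]

lemma den_pos {e : ℝ} (he : 0 < e) (u : ℝ) : 0 < e ^ 2 + Real.sin (u / 2) ^ 2 := by positivity

lemma pk_nonneg {e : ℝ} (he : 0 < e) (u : ℝ) : 0 ≤ pk e u := by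
  unfold pk; positivity

lemma pk_continuous {e : ℝ} (he : 0 < e) : Continuous (pk e) := by
  unfold pk
  exact Continuous.div (by fun_prop) (by fun_prop) (fun u => (den_pos he u).ne')

lemma ck_continuous {e : ℝ} (he : 0 < e) : Continuous (ck e) := by
  unfold ck
  exact Continuous.div (by fun_prop) (by fun_prop) (fun u => (den_pos he u).ne')

lemma hk_measurable (e : ℝ) : Measurable (hk e) := by
  unfold hk
  refine Measurable.ite ?_ (by fun_prop) measurable_const
  exact measurableSet_lt measurable_const (by fun_prop)

lemma pk_le {e : ℝ} (he : 0 < e) (u : ℝ) : pk e u ≤ 1 / e := by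
  unfold pk
  rw [div_le_div_iff₀ (den_pos he u) he]
  nlinarith [sq_nonneg (Real.sin (u / 2))]

lemma ck_sq_le {e : ℝ} (he : 0 < e) (u : ℝ) :
    ck e u ^ 2 ≤ 1 / (e ^ 2 + Real.sin (u / 2) ^ 2) := by
  unfold ck
  have h := den_pos he u
  rw [div_pow, div_le_div_iff₀ (by positivity) h]
  have h1 : Real.cos (u / 2) ^ 2 ≤ 1 := Real.cos_sq_le_one _
  have h2 : (Real.sin (u / 2) * Real.cos (u / 2)) ^ 2 ≤ e ^ 2 + Real.sin (u / 2) ^ 2 := by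
    rw [mul_pow]; nlinarith [sq_nonneg (Real.sin (u / 2)), sq_nonneg e]
  nlinarith

lemma abs_ck_le {e : ℝ} (he : 0 < e) (u : ℝ) : |ck e u| ≤ 1 / e := by
  apply abs_le_of_sq_le_sq _ (by positivity)
  refine (ck_sq_le he u).trans ?_
  rw [div_pow, one_pow]
  apply one_div_le_one_div_of_le (by positivity)
  nlinarith [sq_nonneg (Real.sin (u / 2))]

lemma abs_hk_le {e : ℝ} (he : 0 < e) (u : ℝ) : |hk e u| ≤ 1 / e := by
  unfold hk
  split_ifs with h
  · rw [abs_div, div_le_div_iff₀ (he.trans h) he]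
    have := Real.abs_cos_le_one (u / 2)
    nlinarith
  · simp; positivity

lemma hk_sub_ck {e : ℝ} (he : 0 < e) (u : ℝ) : |hk e u - ck e u| ≤ pk e u := by
  have hd := den_pos he u
  have hc := Real.abs_cos_le_one (u / 2)
  unfold hk ck pk
  split_ifs with h
  · have hs : 0 < |Real.sin (u / 2)| := he.trans h
    have hs' : Real.sin (u / 2) ≠ 0 := abs_pos.1 hs
    have : Real.cos (u / 2) / Real.sin (u / 2) -
        Real.sin (u / 2) * Real.cos (u / 2) / (e ^ 2 + Real.sin (u / 2) ^ 2) =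
        Real.cos (u / 2) * e ^ 2 / (Real.sin (u / 2) * (e ^ 2 + Real.sin (u / 2) ^ 2)) := by
      field_simp; ring
    rw [this, abs_div, abs_mul, abs_mul, abs_of_pos hd, abs_of_nonneg (sq_nonneg e),
      div_le_div_iff₀ (by positivity) hd]
    have : |Real.cos (u / 2)| * e ^ 2 ≤ e * |Real.sin (u / 2)| := by nlinarith [sq_nonneg e]
    nlinarith
  · rw [zero_sub, abs_neg, abs_div, abs_of_pos hd, abs_mul]
    gcongr
    push Not at h
    nlinarith [abs_nonneg (Real.sin (u / 2)), abs_nonneg (Real.cos (u / 2))]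

lemma ck_sub_ck {e d : ℝ} (he : 0 < e) (hed : e ≤ d) (u : ℝ) :
    |Real.sin (u / 2)| * |ck e u - ck d u| ≤ d * pk d u := by
  have h1 := den_pos he u
  have h2 := den_pos (he.trans_le hed) u
  have hc := Real.abs_cos_le_one (u / 2)
  unfold ck pk
  have : Real.sin (u / 2) * Real.cos (u / 2) / (e ^ 2 + Real.sin (u / 2) ^ 2) -
      Real.sin (u / 2) * Real.cos (u / 2) / (d ^ 2 + Real.sin (u / 2) ^ 2) =
      Real.sin (u / 2) * Real.cos (u / 2) * (d ^ 2 - e ^ 2) /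
      ((e ^ 2 + Real.sin (u / 2) ^ 2) * (d ^ 2 + Real.sin (u / 2) ^ 2)) := by
    field_simp; ring
  have hde : 0 ≤ d ^ 2 - e ^ 2 := by nlinarith
  rw [this, abs_div, abs_mul, abs_mul, abs_of_nonneg hde, abs_of_pos (mul_pos h1 h2),
    ← mul_div_assoc, ← mul_div_assoc, div_le_div_iff₀ (mul_pos h1 h2) h2]
  set s := |Real.sin (u / 2)|
  have hss : Real.sin (u / 2) ^ 2 = s ^ 2 := (sq_abs _).symm
  rw [hss] at *
  have hs0 : 0 ≤ s := abs_nonneg _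
  have : s * (s * |Real.cos (u / 2)| * (d ^ 2 - e ^ 2)) ≤ d * d * (e ^ 2 + s ^ 2) := by
    have h3 : s * (s * |Real.cos (u / 2)| * (d ^ 2 - e ^ 2)) =
      s ^ 2 * (d ^ 2 - e ^ 2) * |Real.cos (u / 2)| := by ring
    rw [h3]
    have h4 : s ^ 2 * (d ^ 2 - e ^ 2) * |Real.cos (u / 2)| ≤ s ^ 2 * (d ^ 2 - e ^ 2) :=
      mul_le_of_le_one_right (by positivity) hc
    nlinarith [sq_nonneg (d * e), sq_nonneg (s * e)]
  calc _ ≤ d * d * (e ^ 2 + s ^ 2) * (d ^ 2 + s ^ 2) := by gcongr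
    _ = _ := by ring

lemma abs_sin_nat_mul_le (n : ℕ) (x : ℝ) : |Real.sin (n * x)| ≤ n * |Real.sin x| := by
  induction n with
  | zero => simp
  | succ n ih =>
    push_cast
    rw [add_mul, one_mul, Real.sin_add]
    calc |Real.sin (n * x) * Real.cos x + Real.cos (n * x) * Real.sin x|
        ≤ |Real.sin (n * x) * Real.cos x| + |Real.cos (n * x) * Real.sin x| := abs_add_le _ _
      _ ≤ |Real.sin (n * x)| * 1 + 1 * |Real.sin x| := by
          rw [abs_mul, abs_mul]
          gcongr
          · exact Real.abs_cos_le_one _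
          · exact Real.abs_cos_le_one _
      _ ≤ _ := by linarith

lemma cos_sub_cos_le (a l : ℕ) (u : ℝ) :
    |Real.cos ((a + l : ℕ) * u) - Real.cos (a * u)| ≤ 2 * l * |Real.sin (u / 2)| := by
  rw [Real.cos_sub_cos, abs_mul, abs_mul]
  have h1 := Real.abs_sin_le_one ((((a + l : ℕ) : ℝ) * u + a * u) / 2)
  have h2 := abs_sin_nat_mul_le l (u / 2)
  have h3 : (((a + l : ℕ) : ℝ) * u - a * u) / 2 = l * (u / 2) := by push_cast; ring
  rw [h3]
  have : |(-2 : ℝ)| = 2 := by norm_num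
  rw [this]
  nlinarith [abs_nonneg (Real.sin (l * (u / 2))), abs_nonneg (Real.sin ((((a + l : ℕ) : ℝ) * u + a * u) / 2))]

lemma harnack {d t t' x : ℝ} (h : |t - t'| ≤ 2 * Real.pi * d) :
    d ^ 2 + Real.sin ((t - x) / 2) ^ 2 ≤ 21 * (d ^ 2 + Real.sin ((t' - x) / 2) ^ 2) := by
  have h1 : |Real.sin ((t - x) / 2) - Real.sin ((t' - x) / 2)| ≤ Real.pi * d := by
    have := Real.abs_sin_sub_sin_le ((t - x) / 2) ((t' - x) / 2)
    refine this.trans ?_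
    rw [show (t - x) / 2 - (t' - x) / 2 = (t - t') / 2 by ring, abs_div]
    norm_num; linarith
  have h2 := sq_le_sq' (abs_le.1 h1).1 (abs_le.1 h1).2
  have hp : Real.pi ^ 2 ≤ 10 := by nlinarith [Real.pi_lt_d2, Real.pi_pos]
  rw [mul_pow] at h2
  nlinarith [sq_nonneg (Real.sin ((t - x) / 2) - 2 * Real.sin ((t' - x) / 2)), sq_nonneg d,
    mul_le_mul_of_nonneg_right hp (sq_nonneg d)]

/-! ### Integrals over a period -/

lemma T1_meas : MeasurableSet T1 := measurableSet_Ico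

lemma two_pi_pos : 0 < 2 * Real.pi := Real.two_pi_pos

lemma restrict_T1 : volume.restrict T1 = volume.restrict (Ioc (-Real.pi) (-Real.pi + 2 * Real.pi)) := by
  rw [T1, restrict_Ico_eq_restrict_Ioc]; congr 2; ring

lemma vol_T1 : volume T1 = ENNReal.ofReal (2 * Real.pi) := by
  rw [T1, Real.volume_Ico]; congr 1; ring

instance : IsFiniteMeasure (volume.restrict T1) := ⟨by rw [Measure.restrict_apply_univ, vol_T1]; exact ENNReal.ofReal_lt_top⟩

lemma int_T1_eq {E : Type*} [NormedAddCommGroup E] [NormedSpace ℝ E] (F : ℝ → E) :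
    ∫ x in T1, F x = ∫ x in (-Real.pi)..(-Real.pi + 2 * Real.pi), F x := by
  rw [restrict_T1, intervalIntegral.integral_of_le (by linarith [Real.pi_pos])]

lemma int_shift {E : Type*} [NormedAddCommGroup E] [NormedSpace ℝ E] {F : ℝ → E}
    (hF : Function.Periodic F (2 * Real.pi)) (a : ℝ) :
    ∫ x in T1, F (x + a) = ∫ x in T1, F x := by
  rw [int_T1_eq, int_T1_eq, intervalIntegral.integral_comp_add_right,
    hF.intervalIntegral_add_eq (-Real.pi) (-Real.pi + a)]
  congr 1; ring

lemma int_neg {E : Type*} [NormedAddCommGroup E] [NormedSpace ℝ E] (F : ℝ → E) :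
    ∫ x in T1, F (-x) = ∫ x in T1, F x := by
  rw [int_T1_eq, int_T1_eq, intervalIntegral.integral_comp_neg]
  congr 1 <;> ring

lemma lint_shift {F : ℝ → ENNReal}
    (hF : Function.Periodic F (2 * Real.pi)) (a : ℝ) :
    ∫⁻ x in T1, F (x + a) = ∫⁻ x in T1, F x := by
  have h1 : ∫⁻ x in T1, F (x + a) =
      ∫⁻ x in Ioc (-Real.pi + a) (-Real.pi + a + 2 * Real.pi), F x := by
    rw [restrict_T1]
    have := (measurePreserving_add_right volume a).setLIntegral_comp_preimage_emb
      (MeasurableEquiv.addRight a).measurableEmbedding F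
      (Ioc (-Real.pi + a) (-Real.pi + a + 2 * Real.pi))
    rw [← this]
    congr 2
    ext x; simp only [mem_Ioc, mem_preimage]; constructor <;> intro h <;> constructor <;> linarith [h.1, h.2]
  rw [h1, restrict_T1]
  refine (isAddFundamentalDomain_Ioc two_pi_pos (-Real.pi + a) volume).setLIntegral_eq
    (isAddFundamentalDomain_Ioc two_pi_pos (-Real.pi) volume) F ?_
  rintro ⟨g, hg⟩ x
  obtain ⟨n, rfl⟩ := AddSubgroup.mem_zmultiples_iff.1 hg
  have := hF.zsmul n x
  change F (n • (2 * Real.pi) + x) = F x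
  rw [add_comm]; exact this

lemma lint_neg (F : ℝ → ENNReal) :
    ∫⁻ x in T1, F (-x) = ∫⁻ x in T1, F x := by
  have := (Measure.measurePreserving_neg (volume : Measure ℝ)).setLIntegral_comp_preimage_emb
      (MeasurableEquiv.neg ℝ).measurableEmbedding F (Ioc (-Real.pi) Real.pi)
  rw [T1]
  conv_rhs => rw [restrict_Ico_eq_restrict_Ioc, ← this]
  congr 2
  ext x; simp only [mem_Ioc, mem_Ico, mem_preimage]
  constructor <;> intro h <;> constructor <;> linarith [h.1, h.2]

lemma intOn_shift {F : ℝ → ℝ} (hm : Measurable F)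
    (hF : Function.Periodic F (2 * Real.pi)) (hi : IntegrableOn F T1) (a : ℝ) :
    IntegrableOn (fun x => F (x + a)) T1 := by
  refine ⟨(hm.comp (measurable_add_const a)).aestronglyMeasurable, ?_⟩
  have := hi.2
  rw [hasFiniteIntegral_iff_enorm] at this ⊢
  rwa [lint_shift (F := fun x => ‖F x‖ₑ) (fun x => by simp [hF x]) a]

lemma abs_div_pi_le_abs_sin {u : ℝ} (hu : |u| ≤ Real.pi) : |u| / Real.pi ≤ |Real.sin (u / 2)| := by
  have h := Real.mul_abs_le_abs_sin (x := u / 2) (by rw [abs_div]; norm_num; linarith)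
  rw [abs_div] at h
  calc |u| / Real.pi = 2 / Real.pi * (|u| / |2|) := by norm_num
    _ ≤ _ := h

lemma pk_integral {e : ℝ} (he : 0 < e) : ∫⁻ u in T1, ENNReal.ofReal (pk e u) ≤ ENNReal.ofReal 10 := by
  have hpi := Real.pi_pos
  have key : ∀ u ∈ T1, pk e u ≤ (1 / e) * (1 + ((e * Real.pi)⁻¹ * u) ^ 2)⁻¹ := by
    intro u hu
    have h := abs_div_pi_le_abs_sin (u := u) (abs_le.2 ⟨hu.1, hu.2.le⟩)
    have h2 : (u / Real.pi) ^ 2 ≤ Real.sin (u / 2) ^ 2 := by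
      rw [← sq_abs (Real.sin (u / 2)), ← sq_abs (u / Real.pi), abs_div, abs_of_pos hpi]
      gcongr
    unfold pk
    calc e / (e ^ 2 + Real.sin (u / 2) ^ 2) ≤ e / (e ^ 2 + (u / Real.pi) ^ 2) := by gcongr
      _ = _ := by field_simp
  have hIntg : Integrable (fun u : ℝ => (1 / e) * (1 + ((e * Real.pi)⁻¹ * u) ^ 2)⁻¹) :=
    (integrable_inv_one_add_sq.comp_mul_left' (R := (e * Real.pi)⁻¹) (by positivity)).const_mul _
  calc ∫⁻ u in T1, ENNReal.ofReal (pk e u)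
      ≤ ∫⁻ u in T1, ENNReal.ofReal ((1 / e) * (1 + ((e * Real.pi)⁻¹ * u) ^ 2)⁻¹) :=
        setLIntegral_mono' T1_meas (fun u hu => ENNReal.ofReal_le_ofReal (key u hu))
    _ ≤ ∫⁻ u : ℝ, ENNReal.ofReal ((1 / e) * (1 + ((e * Real.pi)⁻¹ * u) ^ 2)⁻¹) :=
        setLIntegral_le_lintegral _ _
    _ = ENNReal.ofReal (∫ u : ℝ, (1 / e) * (1 + ((e * Real.pi)⁻¹ * u) ^ 2)⁻¹) :=
        (ofReal_integral_eq_lintegral_ofReal hIntg (Eventually.of_forall fun u => by positivity)).symm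
    _ ≤ ENNReal.ofReal 10 := by
        apply ENNReal.ofReal_le_ofReal
        rw [integral_const_mul, Measure.integral_comp_mul_left (fun u : ℝ => (1 + u ^ 2)⁻¹),
          integral_univ_inv_one_add_sq, abs_of_pos (by positivity)]
        simp only [inv_inv, smul_eq_mul]
        have : 1 / e * (e * Real.pi * Real.pi) = Real.pi ^ 2 := by field_simp
        rw [this]
        nlinarith [Real.pi_lt_d2]

lemma pk_integral_shift {e : ℝ} (he : 0 < e) (x : ℝ) :
    ∫⁻ u in T1, ENNReal.ofReal (pk e (u - x)) ≤ ENNReal.ofReal 10 := by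
  have := lint_shift (F := fun u => ENNReal.ofReal (pk e u)) (fun u => by simp [pk_periodic e u]) (-x)
  simp only [← sub_eq_add_neg] at this
  rw [this]; exact pk_integral he

lemma pk_intOn {e : ℝ} (he : 0 < e) (x : ℝ) : IntegrableOn (fun u => pk e (u - x)) T1 := by
  refine Integrable.of_bound ((pk_continuous he).comp (continuous_sub_right x)).aestronglyMeasurable (1 / e)
    (Eventually.of_forall fun u => ?_)
  rw [Real.norm_eq_abs, abs_of_nonneg (pk_nonneg he _)]; exact pk_le he _

lemma pk_integral_real {e : ℝ} (he : 0 < e) (x : ℝ) : ∫ u in T1, pk e (u - x) ≤ 10 := by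
  have h := pk_integral_shift he x
  rw [← ofReal_integral_eq_lintegral_ofReal (pk_intOn he x)
    (Eventually.of_forall fun u => pk_nonneg he _)] at h
  exact (ENNReal.ofReal_le_ofReal_iff (by norm_num)).1 h

end

noncomputable section

/-- Discrete control of mean oscillation and means. -/
def Good (ξ : ℕ → ℝ) (B : ℝ) : Prop :=
  (∀ a L : ℕ, 0 < L → ∑ k ∈ Finset.range L,
      |ξ (a + k) - (∑ i ∈ Finset.range L, ξ (a + i)) / L| ≤ B * L) ∧
  ∀ N : ℕ, |∑ k ∈ Finset.range (N + 1), ξ k| ≤ B * (N + 1)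

lemma Good.nonneg {ξ : ℕ → ℝ} {B : ℝ} (h : Good ξ B) : 0 ≤ B := by
  have := h.1 0 1 one_pos
  simp at this; exact this

lemma Good.add {ξ η : ℕ → ℝ} {B C : ℝ} (h : Good ξ B) (h' : Good η C) :
    Good (fun k => ξ k + η k) (B + C) := by
  refine ⟨fun a L hL => ?_, fun N => ?_⟩
  · have h1 := h.1 a L hL
    have h2 := h'.1 a L hL
    calc _ ≤ ∑ k ∈ Finset.range L, (|ξ (a + k) - (∑ i ∈ Finset.range L, ξ (a + i)) / L| +
          |η (a + k) - (∑ i ∈ Finset.range L, η (a + i)) / L|) := by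
          refine Finset.sum_le_sum fun k _ => ?_
          rw [Finset.sum_add_distrib, add_div]
          refine le_trans (le_of_eq ?_) (abs_add_le _ _)
          congr 1; ring
      _ ≤ _ := by rw [Finset.sum_add_distrib]; linarith
  · have h1 := h.2 N
    have h2 := h'.2 N
    rw [Finset.sum_add_distrib]
    refine (abs_add_le _ _).trans ?_
    linarith

lemma Good.mono {ξ : ℕ → ℝ} {B C : ℝ} (h : Good ξ B) (hBC : B ≤ C) : Good ξ C := by
  refine ⟨fun a L hL => (h.1 a L hL).trans (by gcongr), fun N => (h.2 N).trans (by gcongr)⟩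

lemma Good.smul {ξ : ℕ → ℝ} {B : ℝ} (h : Good ξ B) (c : ℝ) :
    Good (fun k => c * ξ k) (|c| * B) := by
  refine ⟨fun a L hL => ?_, fun N => ?_⟩
  · have h1 := h.1 a L hL
    calc _ = |c| * ∑ k ∈ Finset.range L, |ξ (a + k) - (∑ i ∈ Finset.range L, ξ (a + i)) / L| := by
          rw [Finset.mul_sum]
          refine Finset.sum_congr rfl fun k _ => ?_
          rw [← Finset.mul_sum, ← abs_mul]; congr 1; ring
      _ ≤ _ := by rw [mul_assoc]; gcongr
  · rw [← Finset.mul_sum, abs_mul, mul_assoc]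
    exact mul_le_mul_of_nonneg_left (h.2 N) (abs_nonneg c)

/-- to bound oscillation it suffices to compare with any constant -/
lemma osc_le_of_const {ι : Type*} (s : Finset ι) (f : ι → ℝ) (c : ℝ) (hs : 0 < s.card) :
    ∑ k ∈ s, |f k - (∑ i ∈ s, f i) / s.card| ≤ 2 * ∑ k ∈ s, |f k - c| := by
  have hc : (0 : ℝ) < s.card := by exact_mod_cast hs
  have h1 : |c - (∑ i ∈ s, f i) / s.card| * s.card ≤ ∑ k ∈ s, |f k - c| := by
    have h0 : |c - (∑ i ∈ s, f i) / s.card| * s.card =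
        |(c - (∑ i ∈ s, f i) / s.card) * s.card| := by rw [abs_mul, abs_of_pos hc]
    rw [h0]
    have : (c - (∑ i ∈ s, f i) / s.card) * s.card = - ∑ k ∈ s, (f k - c) := by
      rw [Finset.sum_sub_distrib, Finset.sum_const, nsmul_eq_mul]
      field_simp; ring
    rw [this, abs_neg]
    exact Finset.abs_sum_le_sum_abs _ _
  calc _ ≤ ∑ k ∈ s, (|f k - c| + |c - (∑ i ∈ s, f i) / s.card|) :=
        Finset.sum_le_sum fun k _ => abs_sub_le _ _ _
    _ = ∑ k ∈ s, |f k - c| + |c - (∑ i ∈ s, f i) / s.card| * s.card := by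
        rw [Finset.sum_add_distrib, Finset.sum_const, nsmul_eq_mul]; ring
    _ ≤ _ := by linarith

lemma good_of_bdd {ξ : ℕ → ℝ} {B : ℝ} (h : ∀ n, |ξ n| ≤ B) : Good ξ (2 * B) := by
  have hB : 0 ≤ B := (abs_nonneg _).trans (h 0)
  refine ⟨fun a L hL => ?_, fun N => ?_⟩
  · have := osc_le_of_const (Finset.range L) (fun k => ξ (a + k)) 0 (by simpa using hL)
    simp only [Finset.card_range] at this
    refine this.trans ?_
    have h2 : ∑ k ∈ Finset.range L, |ξ (a + k) - 0| ≤ ∑ k ∈ Finset.range L, B :=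
      Finset.sum_le_sum fun k _ => by simpa using h _
    simp at h2
    simp only [sub_zero]
    linarith
  · refine (Finset.abs_sum_le_sum_abs _ _).trans ?_
    have h2 : ∑ k ∈ Finset.range (N + 1), |ξ k| ≤ ∑ k ∈ Finset.range (N + 1), B :=
      Finset.sum_le_sum fun k _ => by simpa using h _
    simp at h2
    nlinarith

lemma good_of_tendsto {ξ : ℕ → ℕ → ℝ} {η : ℕ → ℝ} {B : ℝ}
    (hlim : ∀ k, Tendsto (fun i => ξ i k) atTop (nhds (η k)))
    (h : ∃ᶠ i in atTop, Good (ξ i) B) : Good η B := by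
  refine ⟨fun a L hL => ?_, fun N => ?_⟩
  · have ht : Tendsto (fun i => ∑ k ∈ Finset.range L,
      |ξ i (a + k) - (∑ j ∈ Finset.range L, ξ i (a + j)) / L|) atTop
      (nhds (∑ k ∈ Finset.range L, |η (a + k) - (∑ j ∈ Finset.range L, η (a + j)) / L|)) :=
      tendsto_finset_sum _ fun k _ => (((hlim _).sub
        ((tendsto_finset_sum _ fun j _ => hlim _).div_const _)).abs)
    exact le_of_tendsto_of_frequently ht (h.mono fun i hi => hi.1 a L hL)
  · have ht : Tendsto (fun i => |∑ k ∈ Finset.range (N + 1), ξ i k|) atTop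
      (nhds |∑ k ∈ Finset.range (N + 1), η k|) :=
      (tendsto_finset_sum _ fun j _ => hlim _).abs
    exact le_of_tendsto_of_frequently ht (h.mono fun i hi => hi.2 N)

lemma stepFun_ae (ξ : ℕ → ℝ) (n : ℕ) :
    ∀ᵐ t : ℝ, ∀ k ∈ Finset.range (n + 1), (k : ℝ) / ((n : ℝ) + 1) ≤ t →
      t ≤ ((k : ℝ) + 1) / ((n : ℝ) + 1) →
      stepFun ξ n t = ξ k := by
  have hc : (range fun k : ℕ => (k : ℝ) / ((n : ℝ) + 1)).Countable := countable_range _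
  filter_upwards [hc.ae_notMem volume] with t ht k hk h1 h2
  have hn : (0 : ℝ) < (n : ℝ) + 1 := by positivity
  unfold stepFun
  rw [Finset.sum_eq_single_of_mem k hk]
  · exact indicator_of_mem (show t ∈ Icc _ _ from ⟨h1, h2⟩) _
  · intro j hj hjk
    rw [indicator_of_notMem]
    rintro ⟨h3, h4⟩
    rw [div_le_iff₀ hn] at h1 h3
    rw [le_div_iff₀ hn] at h2 h4
    rcases lt_or_gt_of_ne hjk with h | h
    · apply ht
      refine ⟨k, ?_⟩
      have : (j : ℝ) + 1 ≤ k := by exact_mod_cast h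
      change (k : ℝ) / ((n : ℝ) + 1) = t
      rw [div_eq_iff hn.ne']; linarith
    · apply ht
      refine ⟨j, ?_⟩
      have : (k : ℝ) + 1 ≤ j := by exact_mod_cast h
      change (j : ℝ) / ((n : ℝ) + 1) = t
      rw [div_eq_iff hn.ne']; linarith

lemma stepFun_intOn (ξ : ℕ → ℝ) (n : ℕ) (a b : ℝ) : IntegrableOn (stepFun ξ n) (Icc a b) := by
  unfold stepFun
  refine integrable_finset_sum _ fun k _ => ?_
  exact (integrable_const _).indicator measurableSet_Icc

lemma stepFun_mean (ξ : ℕ → ℝ) (n : ℕ) :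
    ∫ t in Icc (0 : ℝ) 1, stepFun ξ n t = (∑ k ∈ Finset.range (n + 1), ξ k) / (n + 1) := by
  have hn : (0 : ℝ) < (n : ℝ) + 1 := by positivity
  unfold stepFun
  rw [integral_finset_sum _ fun k _ => (integrable_const _).indicator measurableSet_Icc,
    Finset.sum_div]
  refine Finset.sum_congr rfl fun k hk => ?_
  have hk' : (k : ℝ) + 1 ≤ n + 1 := by
    have := Finset.mem_range.1 hk
    exact_mod_cast this
  rw [integral_indicator measurableSet_Icc, Measure.restrict_restrict measurableSet_Icc,
    inter_eq_left.2, integral_const]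
  · simp only [MeasurableSet.univ, measureReal_restrict_apply, univ_inter, smul_eq_mul]
    rw [Measure.real, Real.volume_Icc, ENNReal.toReal_ofReal]
    · field_simp; ring
    · rw [sub_nonneg]; gcongr; linarith
  · apply Icc_subset_Icc (by positivity)
    rw [div_le_one hn]; exact hk'

lemma stepFun_osc {ξ : ℕ → ℝ} {B : ℝ} (h : Good ξ B) (n : ℕ) {a b : ℝ} (ha : 0 ≤ a) (hab : a < b)
    (hb : b ≤ 1) : ∃ c : ℝ, ∫ t in Icc a b, |stepFun ξ n t - c| ≤ 3 * B * (b - a) := by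
  have hn : (0 : ℝ) < (n : ℝ) + 1 := by positivity
  set N : ℝ := (n : ℝ) + 1 with hN
  set K0 := ⌊a * N⌋₊ with hK0
  set K1 := ⌈b * N⌉₊ with hK1
  have e0 : (K0 : ℝ) ≤ a * N := Nat.floor_le (by positivity)
  have e0' : a * N < K0 + 1 := Nat.lt_floor_add_one _
  have e1 : b * N ≤ K1 := Nat.le_ceil _
  have e1' : (K1 : ℝ) < b * N + 1 := Nat.ceil_lt_add_one (by nlinarith)
  have hK : K0 < K1 := by
    have : (K0 : ℝ) < K1 := by nlinarith
    exact_mod_cast this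
  have hK1n : K1 ≤ n + 1 := by
    apply Nat.ceil_le.2; push_cast; nlinarith
  obtain ⟨L, hL⟩ : ∃ L, K1 = K0 + L := ⟨K1 - K0, by omega⟩
  have hL0 : 0 < L := by omega
  have hLr : (0 : ℝ) < L := by exact_mod_cast hL0
  have hLK : (L : ℝ) = K1 - K0 := by rw [hL]; push_cast; ring
  set c := (∑ i ∈ Finset.range L, ξ (K0 + i)) / L with hc
  refine ⟨c, ?_⟩
  set cell : ℕ → Set ℝ := fun k => Icc (((K0 + k : ℕ) : ℝ) / N) ((((K0 + k : ℕ) : ℝ) + 1) / N) with hcell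
  have hvol : ∀ k, volume.real (cell k ∩ Icc a b) ≤ 3 * (b - a) / L := by
    intro k
    have v1 : volume.real (cell k ∩ Icc a b) ≤ 1 / N := by
      calc _ ≤ volume.real (cell k) := measureReal_mono inter_subset_left (by simp [hcell])
        _ = 1 / N := by
          simp only [hcell, Measure.real, Real.volume_Icc]
          rw [ENNReal.toReal_ofReal] <;> rw [← sub_div, add_sub_cancel_left]
          positivity
    have v2 : volume.real (cell k ∩ Icc a b) ≤ b - a := by
      calc _ ≤ volume.real (Icc a b) := measureReal_mono inter_subset_right (by simp)
        _ = b - a := by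
          simp only [Measure.real, Real.volume_Icc]
          rw [ENNReal.toReal_ofReal]; linarith
    by_cases hL3 : L ≤ 3
    · have : (L : ℝ) ≤ 3 := by exact_mod_cast hL3
      refine v2.trans ?_
      rw [le_div_iff₀ hLr]; nlinarith
    · have : (4 : ℝ) ≤ L := by
        have : 4 ≤ L := by omega
        exact_mod_cast this
      refine v1.trans ?_
      rw [div_le_div_iff₀ hn hLr]
      nlinarith
  calc ∫ t in Icc a b, |stepFun ξ n t - c|
      ≤ ∫ t in Icc a b, ∑ k ∈ Finset.range L, (cell k).indicator (fun _ => |ξ (K0 + k) - c|) t := by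
        apply integral_mono_ae
        · exact ((stepFun_intOn ξ n a b).sub (integrable_const _)).abs
        · exact integrable_finset_sum _ fun k _ => (integrable_const _).indicator measurableSet_Icc
        · filter_upwards [ae_restrict_of_ae (stepFun_ae ξ n), ae_restrict_mem measurableSet_Icc,
            ae_restrict_of_ae ((countable_range fun k : ℕ => (k : ℝ) / N).ae_notMem volume)] with t h1 h2 h3
          have ht0 : 0 ≤ t := ha.trans h2.1
          set k := ⌊t * N⌋₊ with hk
          have f1 : (k : ℝ) ≤ t * N := Nat.floor_le (by positivity)
          have f2 : t * N < k + 1 := Nat.lt_floor_add_one _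
          have f3 : K0 ≤ k := Nat.floor_mono (by nlinarith [h2.1])
          have f4 : k < K1 := by
            have : k ≤ K1 := by
              have : (k : ℝ) ≤ K1 := by nlinarith [h2.2]
              exact_mod_cast this
            refine lt_of_le_of_ne this fun h => h3 ⟨k, ?_⟩
            have : (k : ℝ) = K1 := by exact_mod_cast h
            change (k : ℝ) / N = t
            rw [div_eq_iff hn.ne']
            nlinarith [h2.2]
          have m1 : (k : ℝ) / N ≤ t := by rwa [div_le_iff₀ hn]
          have m2 : t ≤ ((k : ℝ) + 1) / N := by rw [le_div_iff₀ hn]; exact f2.le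
          have f5 := h1 k (Finset.mem_range.2 (by omega)) m1 m2
          rw [f5]
          obtain ⟨j, hj⟩ : ∃ j, k = K0 + j := ⟨k - K0, by omega⟩
          have hjL : j ∈ Finset.range L := Finset.mem_range.2 (by omega)
          have hmem : t ∈ cell j := by
            simp only [hcell, ← hj]; exact ⟨m1, m2⟩
          calc |ξ k - c| = (cell j).indicator (fun _ => |ξ (K0 + j) - c|) t := by
                rw [indicator_of_mem hmem, hj]
            _ ≤ _ := Finset.single_le_sum (f := fun j => (cell j).indicator (fun _ => |ξ (K0 + j) - c|) t)
                (fun i _ => indicator_nonneg (fun _ _ => abs_nonneg _) _) hjL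
    _ = ∑ k ∈ Finset.range L, volume.real (cell k ∩ Icc a b) * |ξ (K0 + k) - c| := by
        rw [integral_finset_sum _ fun k _ => (integrable_const _).indicator measurableSet_Icc]
        refine Finset.sum_congr rfl fun k _ => ?_
        rw [integral_indicator measurableSet_Icc, Measure.restrict_restrict measurableSet_Icc,
          integral_const]
        simp only [MeasurableSet.univ, measureReal_restrict_apply, univ_inter, smul_eq_mul, hcell]
    _ ≤ ∑ k ∈ Finset.range L, 3 * (b - a) / L * |ξ (K0 + k) - c| :=
        Finset.sum_le_sum fun k _ => mul_le_mul_of_nonneg_right (hvol k) (abs_nonneg _)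
    _ = 3 * (b - a) / L * ∑ k ∈ Finset.range L, |ξ (K0 + k) - c| := by rw [Finset.mul_sum]
    _ ≤ 3 * (b - a) / L * (B * L) := by
        have := h.1 K0 L hL0
        have : 0 ≤ 3 * (b - a) / L := div_nonneg (by linarith) hLr.le
        gcongr
    _ = _ := by field_simp

lemma bmoSeq_le {ξ : ℕ → ℝ} {B : ℝ} (h : Good ξ B) : bmoSeq ξ ≤ 7 * B := by
  unfold bmoSeq
  refine ciSup_le fun n => ?_
  have hn : (0 : ℝ) < (n : ℝ) + 1 := by positivity
  unfold bmoNorm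
  have h2 : |∫ t in Icc (0 : ℝ) 1, stepFun ξ n t| ≤ B := by
    rw [stepFun_mean, abs_div, abs_of_pos hn, div_le_iff₀ hn]
    exact h.2 n
  have : Nonempty {p : ℝ × ℝ // 0 ≤ p.1 ∧ p.1 < p.2 ∧ p.2 ≤ 1} := ⟨⟨(0, 1), by norm_num⟩⟩
  have h1 : (⨆ I : {p : ℝ × ℝ // 0 ≤ p.1 ∧ p.1 < p.2 ∧ p.2 ≤ 1},
      (I.1.2 - I.1.1)⁻¹ *
        ∫ t in Set.Icc I.1.1 I.1.2,
          |stepFun ξ n t - (I.1.2 - I.1.1)⁻¹ * ∫ s in Set.Icc I.1.1 I.1.2, stepFun ξ n s|) ≤ 6 * B := by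
    refine ciSup_le ?_
    rintro ⟨⟨a, b⟩, ha, hab, hb⟩
    dsimp only at ha hab hb ⊢
    obtain ⟨c, hc⟩ := stepFun_osc h n ha hab hb
    have hba : 0 < b - a := by linarith
    have hi := stepFun_intOn ξ n a b
    set J := (b - a)⁻¹ * ∫ s in Icc a b, stepFun ξ n s with hJ
    have hvr : volume.real (Icc a b) = b - a := by
      simp only [Measure.real, Real.volume_Icc]
      rw [ENNReal.toReal_ofReal hba.le]
    have hcJ : |c - J| * (b - a) ≤ 3 * B * (b - a) := by
      refine le_trans ?_ hc
      have : (c - J) * (b - a) = - ∫ t in Icc a b, (stepFun ξ n t - c) := by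
        rw [integral_sub hi (integrable_const _), integral_const, hJ]
        simp only [MeasurableSet.univ, measureReal_restrict_apply, univ_inter, smul_eq_mul, hvr]
        field_simp; ring
      have h0 : |c - J| * (b - a) = |(c - J) * (b - a)| := by rw [abs_mul, abs_of_pos hba]
      rw [h0, this, abs_neg]
      exact abs_integral_le_integral_abs
    rw [inv_mul_le_iff₀ hba]
    have hi2 : Integrable (fun t => |stepFun ξ n t - c|) (volume.restrict (Icc a b)) :=
      (hi.sub (integrable_const _)).abs
    calc ∫ t in Icc a b, |stepFun ξ n t - J| ≤ ∫ t in Icc a b, (|stepFun ξ n t - c| + |c - J|) := by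
          apply integral_mono
          · exact (hi.sub (integrable_const _)).abs
          · exact ((hi.sub (integrable_const _)).abs).add (integrable_const _)
          · intro t; exact abs_sub_le _ _ _
      _ = (∫ t in Icc a b, |stepFun ξ n t - c|) + |c - J| * (b - a) := by
          rw [integral_add hi2 (integrable_const _), integral_const]
          simp only [MeasurableSet.univ, measureReal_restrict_apply, univ_inter, smul_eq_mul, hvr]
          ring
      _ ≤ _ := by linarith
  linarith

end

noncomputable section

/-- dyadic index of a point -/
def idx (m : ℕ) (t : ℝ) : ℕ := ⌊2 ^ m * ((t + Real.pi) / (2 * Real.pi))⌋₊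
/-- dyadic cells of the circle -/
def cell (m j : ℕ) : Set ℝ := {t | t ∈ T1 ∧ idx m t = j}
/-- dyadic scale -/
def dd (m : ℕ) : ℝ := (1 / 2) ^ m
/-- left endpoint of a cell -/
def lep (m j : ℕ) : ℝ := -Real.pi + 2 * Real.pi * (j * dd m)
/-- mass of a cell -/
def bb (F : ℝ → ℝ) (m j : ℕ) : ℝ := ∫ t in cell m j, F t
/-- the square function -/
def Gam (F : ℝ → ℝ) (m : ℕ) (x : ℝ) : ℝ :=
  ∑ j ∈ Finset.range (2 ^ m), bb F m j ^ 2 / (dd m ^ 2 + Real.sin ((lep m j - x) / 2) ^ 2)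

lemma dd_pos (m : ℕ) : 0 < dd m := by unfold dd; positivity
lemma dd_mul (m : ℕ) : 2 ^ m * dd m = 1 := by
  unfold dd; rw [← mul_pow]; norm_num
lemma dd_le_one (m : ℕ) : dd m ≤ 1 := by
  unfold dd; exact pow_le_one₀ (by norm_num) (by norm_num)

lemma idx_measurable (m : ℕ) : Measurable (idx m) := by
  unfold idx
  exact Nat.measurable_floor.comp (by fun_prop)

lemma cell_meas (m j : ℕ) : MeasurableSet (cell m j) := by
  have : cell m j = T1 ∩ idx m ⁻¹' {j} := rfl
  rw [this]
  exact T1_meas.inter (idx_measurable m (measurableSet_singleton _))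

lemma cell_sub (m j : ℕ) : cell m j ⊆ T1 := fun _ h => h.1

lemma unit_of_T1 {t : ℝ} (ht : t ∈ T1) : 0 ≤ (t + Real.pi) / (2 * Real.pi) ∧
    (t + Real.pi) / (2 * Real.pi) < 1 := by
  have := Real.pi_pos
  have h1 := ht.1
  have h2 := ht.2
  constructor
  · apply div_nonneg <;> linarith
  · rw [div_lt_one (by linarith)]; linarith

lemma idx_lt (m : ℕ) {t : ℝ} (ht : t ∈ T1) : idx m t < 2 ^ m := by
  obtain ⟨h1, h2⟩ := unit_of_T1 ht
  unfold idx
  rw [Nat.floor_lt (by positivity)]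
  push_cast
  have : (0 : ℝ) < 2 ^ m := by positivity
  nlinarith

lemma idx_div {m' m : ℕ} (h : m' ≤ m) (t : ℝ) : idx m' t = idx m t / 2 ^ (m - m') := by
  unfold idx
  have := Nat.floor_div_natCast (2 ^ m * ((t + Real.pi) / (2 * Real.pi))) (2 ^ (m - m'))
  rw [← this]
  congr 1
  have e : (2 : ℝ) ^ m = 2 ^ m' * 2 ^ (m - m') := by rw [← pow_add]; congr 1; omega
  push_cast
  rw [e]
  field_simp

lemma cell_near {m j : ℕ} {t : ℝ} (ht : t ∈ cell m j) :
    lep m j ≤ t ∧ t < lep m j + 2 * Real.pi * dd m := by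
  obtain ⟨h1, h2⟩ := ht
  have hpi := two_pi_pos
  obtain ⟨u0, u1⟩ := unit_of_T1 h1
  set w := (t + Real.pi) / (2 * Real.pi) with hw
  have ht' : t = -Real.pi + 2 * Real.pi * w := by rw [hw]; field_simp; ring
  have hd := dd_pos m
  have hm := dd_mul m
  have f1 : (j : ℝ) ≤ 2 ^ m * w := by rw [← h2]; exact Nat.floor_le (by positivity)
  have f2 : 2 ^ m * w < (j : ℝ) + 1 := by rw [← h2]; exact Nat.lt_floor_add_one _
  have g1 : j * dd m ≤ w := by nlinarith
  have g2 : w < j * dd m + dd m := by nlinarith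
  unfold lep
  rw [ht']
  constructor <;> nlinarith

lemma cell_vol_ge {m j : ℕ} (hj : j < 2 ^ m) :
    cell m j = Ico (lep m j) (lep m j + 2 * Real.pi * dd m) := by
  apply subset_antisymm
  · intro t ht; exact cell_near ht
  · intro t ht
    have hpi := two_pi_pos
    have hd := dd_pos m
    have hm := dd_mul m
    have hp2 : (0 : ℝ) < 2 ^ m := by positivity
    have hj' : (j : ℝ) + 1 ≤ 2 ^ m := by exact_mod_cast hj
    have hj0 : (0 : ℝ) ≤ j := by positivity
    obtain ⟨h1, h2⟩ := ht
    set w := (t + Real.pi) / (2 * Real.pi) with hw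
    have ht' : t = -Real.pi + 2 * Real.pi * w := by rw [hw]; field_simp; ring
    unfold lep at h1 h2
    rw [ht'] at h1 h2
    have g1 : j * dd m ≤ w := by nlinarith
    have g2 : w < j * dd m + dd m := by nlinarith
    have w0 : 0 ≤ w := le_trans (by positivity) g1
    have w1 : w < 1 := by nlinarith
    refine ⟨⟨?_, ?_⟩, ?_⟩
    · rw [ht']; nlinarith
    · rw [ht']; nlinarith
    · unfold idx
      rw [← hw, Nat.floor_eq_iff (by positivity)]
      constructor <;> nlinarith

lemma cell_vol {m j : ℕ} (hj : j < 2 ^ m) : volume (cell m j) = ENNReal.ofReal (2 * Real.pi * dd m) := by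
  rw [cell_vol_ge hj, Real.volume_Ico]; congr 1; ring

lemma cell_abs {m j : ℕ} {t : ℝ} (ht : t ∈ cell m j) : |t - lep m j| ≤ 2 * Real.pi * dd m := by
  have := cell_near ht
  rw [abs_le]; constructor <;> linarith

lemma cell_disj (m : ℕ) : Pairwise (fun i j => Disjoint (cell m i) (cell m j)) := by
  intro i j hij
  rw [Set.disjoint_left]
  intro t h1 h2
  exact hij (h1.2.symm.trans h2.2)

lemma T1_eq_cells (m : ℕ) : T1 = ⋃ j ∈ Finset.range (2 ^ m), cell m j := by
  ext t
  simp only [mem_iUnion, Finset.mem_range]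
  constructor
  · intro h; exact ⟨idx m t, idx_lt m h, h, rfl⟩
  · rintro ⟨j, _, h⟩; exact h.1

lemma cell_eq_cells {m' m : ℕ} (h : m' ≤ m) (j' : ℕ) :
    cell m' j' = ⋃ j ∈ (Finset.range (2 ^ m)).filter (fun j => j / 2 ^ (m - m') = j'), cell m j := by
  ext t
  simp only [mem_iUnion, Finset.mem_range, Finset.mem_filter]
  constructor
  · rintro ⟨h1, h2⟩
    exact ⟨idx m t, ⟨idx_lt m h1, by rw [← idx_div h, h2]⟩, h1, rfl⟩
  · rintro ⟨j, ⟨h1, h2⟩, h3, h4⟩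
    exact ⟨h3, by rw [idx_div h, h4, h2]⟩

lemma int_cells {g : ℝ → ℝ} (hg : IntegrableOn g T1) (m : ℕ) :
    ∫ t in T1, g t = ∑ j ∈ Finset.range (2 ^ m), ∫ t in cell m j, g t := by
  conv_lhs => rw [T1_eq_cells m]
  exact integral_biUnion_finset _ (fun j _ => cell_meas m j) (fun i _ j _ hij => cell_disj m hij)
    (fun j _ => hg.mono_set (cell_sub m j))

lemma bb_sum {F : ℝ → ℝ} (hF : IntegrableOn F T1) {m' m : ℕ} (h : m' ≤ m) (j' : ℕ) :
    ∑ j ∈ (Finset.range (2 ^ m)).filter (fun j => j / 2 ^ (m - m') = j'), bb F m j = bb F m' j' := by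
  unfold bb
  rw [cell_eq_cells h]
  exact (integral_biUnion_finset _ (fun j _ => cell_meas m j) (fun i _ j _ hij => cell_disj m hij)
    (fun j _ => hF.mono_set (cell_sub m j))).symm

lemma bb_nonneg {F : ℝ → ℝ} (h0 : ∀ t, 0 ≤ F t) (m j : ℕ) : 0 ≤ bb F m j :=
  integral_nonneg fun t => h0 t

lemma bb_anc_le {F : ℝ → ℝ} (h0 : ∀ t, 0 ≤ F t) (hF : IntegrableOn F T1) {m' m : ℕ} (h : m' ≤ m) (j : ℕ) :
    bb F m j ≤ bb F m' (j / 2 ^ (m - m')) := by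
  unfold bb
  apply setIntegral_mono_set (hF.mono_set (cell_sub _ _)) (Eventually.of_forall fun t => h0 t)
  apply HasSubset.Subset.eventuallyLE
  rintro t ⟨h1, h2⟩
  exact ⟨h1, by rw [idx_div h, h2]⟩

/-- kernel weight -/
def wt (m j : ℕ) (x : ℝ) : ℝ := dd m ^ 2 + Real.sin ((lep m j - x) / 2) ^ 2

lemma wt_pos (m j : ℕ) (x : ℝ) : 0 < wt m j x := by
  have := dd_pos m
  unfold wt; positivity

lemma wt_near {m j : ℕ} {t : ℝ} (ht : t ∈ cell m j) (x : ℝ) :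
    dd m ^ 2 + Real.sin ((t - x) / 2) ^ 2 ≤ 21 * wt m j x ∧
    wt m j x ≤ 21 * (dd m ^ 2 + Real.sin ((t - x) / 2) ^ 2) :=
  ⟨harnack (cell_abs ht), harnack (by rw [abs_sub_comm]; exact cell_abs ht)⟩

lemma sumP (m : ℕ) (x : ℝ) : ∑ j ∈ Finset.range (2 ^ m), dd m ^ 2 / wt m j x ≤ 35 := by
  have hd := dd_pos m
  have hpi := Real.pi_gt_three
  have h1 : ∀ j ∈ Finset.range (2 ^ m), 2 * Real.pi * (dd m ^ 2 / wt m j x) ≤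
      21 * ∫ t in cell m j, pk (dd m) (t - x) := by
    intro j hj
    have hj' := Finset.mem_range.1 hj
    have hw := wt_pos m j x
    have hv : (volume (cell m j)).toReal = 2 * Real.pi * dd m := by
      rw [cell_vol hj', ENNReal.toReal_ofReal (by positivity)]
    have : (volume.real (cell m j)) * (dd m / (21 * wt m j x)) ≤ ∫ t in cell m j, pk (dd m) (t - x) := by
      have h3 : ∫ t in cell m j, (dd m / (21 * wt m j x)) ≤ ∫ t in cell m j, pk (dd m) (t - x) := by
        apply setIntegral_mono_on
        · refine integrableOn_const ?_
          rw [cell_vol hj']; exact ENNReal.ofReal_ne_top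
        · exact (pk_intOn hd x).mono_set (cell_sub _ _)
        · exact cell_meas _ _
        · intro t ht
          unfold pk
          have := wt_near ht x
          have := den_pos hd (t - x)
          gcongr
          exact (wt_near ht x).1
      rw [setIntegral_const, smul_eq_mul] at h3
      exact h3
    rw [Measure.real, hv] at this
    calc _ = 21 * (2 * Real.pi * dd m * (dd m / (21 * wt m j x))) := by field_simp
      _ ≤ _ := by linarith
  have h2 := Finset.sum_le_sum h1
  rw [← Finset.mul_sum, ← Finset.mul_sum, ← int_cells (pk_intOn hd x) m] at h2
  have h3 := pk_integral_real hd x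
  nlinarith

lemma pk_conv_le {F : ℝ → ℝ} (h0 : ∀ t, 0 ≤ F t) (hF : IntegrableOn F T1) (m : ℕ) (x : ℝ) :
    (∫ t in T1, pk (dd m) (t - x) * F t) ^ 2 ≤ 15435 * Gam F m x := by
  have hd := dd_pos m
  have hIntg : IntegrableOn (fun t => pk (dd m) (t - x) * F t) T1 := by
    apply Integrable.bdd_mul (c := 1 / dd m) hF
    · exact ((pk_continuous hd).comp (by fun_prop)).aestronglyMeasurable
    · exact Eventually.of_forall fun t => by
        rw [Real.norm_of_nonneg (pk_nonneg hd _)]; exact pk_le hd _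
  have h1 : ∀ j ∈ Finset.range (2 ^ m), ∫ t in cell m j, pk (dd m) (t - x) * F t ≤
      21 * ((dd m / Real.sqrt (wt m j x)) * (bb F m j / Real.sqrt (wt m j x))) := by
    intro j hj
    have hw := wt_pos m j x
    have : 21 * ((dd m / Real.sqrt (wt m j x)) * (bb F m j / Real.sqrt (wt m j x))) =
        ∫ t in cell m j, 21 * dd m / wt m j x * F t := by
      rw [integral_const_mul, div_mul_div_comm, Real.mul_self_sqrt hw.le]
      unfold bb; ring
    rw [this]
    apply setIntegral_mono_on (hIntg.mono_set (cell_sub _ _))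
      ((hF.mono_set (cell_sub _ _)).const_mul _) (cell_meas _ _)
    intro t ht
    apply mul_le_mul_of_nonneg_right _ (h0 t)
    unfold pk
    rw [div_le_div_iff₀ (den_pos hd _) hw]
    have := (wt_near ht x).2
    nlinarith
  rw [int_cells hIntg m]
  have h2 := Finset.sum_le_sum h1
  rw [← Finset.mul_sum] at h2
  have h3 := Finset.sum_mul_sq_le_sq_mul_sq (Finset.range (2 ^ m))
    (fun j => dd m / Real.sqrt (wt m j x)) (fun j => bb F m j / Real.sqrt (wt m j x))
  have e1 : ∀ j, (dd m / Real.sqrt (wt m j x)) ^ 2 = dd m ^ 2 / wt m j x := fun j => by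
    rw [div_pow, Real.sq_sqrt (wt_pos m j x).le]
  have e2 : ∀ j, (bb F m j / Real.sqrt (wt m j x)) ^ 2 = bb F m j ^ 2 / wt m j x := fun j => by
    rw [div_pow, Real.sq_sqrt (wt_pos m j x).le]
  simp only [e1, e2] at h3
  have h4 := sumP m x
  have h5 : (0 : ℝ) ≤ ∑ j ∈ Finset.range (2 ^ m), ∫ t in cell m j, pk (dd m) (t - x) * F t :=
    Finset.sum_nonneg fun j _ => integral_nonneg fun t => mul_nonneg (pk_nonneg hd _) (h0 t)
  have h6 : 0 ≤ Gam F m x := Finset.sum_nonneg fun j _ => div_nonneg (sq_nonneg _) (wt_pos m j x).le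
  calc _ ≤ (21 * ∑ j ∈ Finset.range (2 ^ m), (dd m / Real.sqrt (wt m j x)) * (bb F m j / Real.sqrt (wt m j x))) ^ 2 := by
        gcongr
    _ ≤ 441 * ((∑ j ∈ Finset.range (2 ^ m), dd m ^ 2 / wt m j x) * Gam F m x) := by
        rw [mul_pow]; norm_num
        exact h3
    _ ≤ 441 * (35 * Gam F m x) := by gcongr
    _ = _ := by ring

end

noncomputable section

/-- stopping cells -/
def Sel (F : ℝ → ℝ) (lam : ℝ) (m j : ℕ) : Prop :=
  lam * dd m < bb F m j ∧ ∀ m' < m, bb F m' (j / 2 ^ (m - m')) ≤ lam * dd m'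

open Classical in
/-- a Marcinkiewicz type function -/
def Marc (F : ℝ → ℝ) (lam : ℝ) (x : ℝ) : ENNReal :=
  ∑' m : ℕ, ∑ j ∈ Finset.range (2 ^ m), if Sel F lam m j then ENNReal.ofReal (dd m ^ 2 / wt m j x) else 0

open Classical in
lemma sel_le_one (F : ℝ → ℝ) (lam : ℝ) (t : ℝ) :
    ∑' m : ℕ, (if Sel F lam m (idx m t) then (1 : ENNReal) else 0) ≤ 1 := by
  by_cases h : ∃ m, Sel F lam m (idx m t)
  · obtain ⟨m, hm⟩ := h
    rw [tsum_eq_single m]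
    · simp [hm]
    · intro m' hne
      rw [if_neg]
      intro hm'
      rcases lt_or_gt_of_ne hne with h | h
      · have := hm.2 m' h
        rw [← idx_div h.le] at this
        exact absurd hm'.1 (not_lt.2 this)
      · have := hm'.2 m h
        rw [← idx_div h.le] at this
        exact absurd hm.1 (not_lt.2 this)
  · push Not at h
    simp [h]

lemma bb_ofReal {F : ℝ → ℝ} (h0 : ∀ t, 0 ≤ F t) (hF : IntegrableOn F T1) (m j : ℕ) :
    ENNReal.ofReal (bb F m j) = ∫⁻ t in cell m j, ENNReal.ofReal (F t) :=
  ofReal_integral_eq_lintegral_ofReal (hF.mono_set (cell_sub _ _)) (Eventually.of_forall h0)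

lemma wt_eq_pk (m j : ℕ) (x : ℝ) : dd m ^ 2 / wt m j x = dd m * pk (dd m) (x - lep m j) := by
  unfold wt pk
  rw [show (lep m j - x) / 2 = - ((x - lep m j) / 2) by ring, Real.sin_neg, neg_sq]
  ring

open Classical in
lemma sel_sum_le {F : ℝ → ℝ} (hm : Measurable F) (h0 : ∀ t, 0 ≤ F t) (hF : IntegrableOn F T1) {lam : ℝ} (hl : 0 < lam) :
    ∑' m : ℕ, ∑ j ∈ Finset.range (2 ^ m), (if Sel F lam m j then ENNReal.ofReal (dd m) else 0) ≤
      ENNReal.ofReal (1 / lam) * ∫⁻ t in T1, ENNReal.ofReal (F t) := by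
  calc _ ≤ ∑' m : ℕ, ∑ j ∈ Finset.range (2 ^ m), ENNReal.ofReal (1 / lam) *
        ∫⁻ t in T1, (cell m j).indicator (fun t => if Sel F lam m (idx m t) then ENNReal.ofReal (F t) else 0) t := by
        refine ENNReal.tsum_le_tsum fun m => Finset.sum_le_sum fun j _ => ?_
        split_ifs with h
        · rw [lintegral_indicator (cell_meas _ _), Measure.restrict_restrict (cell_meas _ _),
            inter_eq_left.2 (cell_sub _ _)]
          have : ∫⁻ t in cell m j, (if Sel F lam m (idx m t) then ENNReal.ofReal (F t) else 0) =
              ∫⁻ t in cell m j, ENNReal.ofReal (F t) := by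
            refine setLIntegral_congr_fun (cell_meas _ _) fun t ht => ?_
            have : idx m t = j := ht.2
            simp only [this, h, if_true]
          rw [this, ← bb_ofReal h0 hF, ← ENNReal.ofReal_mul (by positivity)]
          apply ENNReal.ofReal_le_ofReal
          rw [one_div, le_inv_mul_iff₀ hl]
          exact h.1.le
        · exact zero_le
    _ = ENNReal.ofReal (1 / lam) * ∫⁻ t in T1, ∑' m : ℕ, ∑ j ∈ Finset.range (2 ^ m),
        (cell m j).indicator (fun t => if Sel F lam m (idx m t) then ENNReal.ofReal (F t) else 0) t := by
        have hmeas : ∀ m j, Measurable ((cell m j).indicator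
            (fun t => if Sel F lam m (idx m t) then ENNReal.ofReal (F t) else 0)) := by
          intro m j
          apply Measurable.indicator _ (cell_meas _ _)
          refine Measurable.ite ?_ (by fun_prop) measurable_const
          exact (idx_measurable m) (MeasurableSet.of_discrete (s := {j | Sel F lam m j}))
        rw [lintegral_tsum]
        · rw [← ENNReal.tsum_mul_left]
          congr 1; ext m
          rw [lintegral_finsetSum _ fun j _ => hmeas m j, Finset.mul_sum]
        · intro m
          exact (Finset.measurable_fun_sum _ fun j _ => hmeas m j).aemeasurable
    _ ≤ _ := by
        refine mul_le_mul_right ?_ _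
        refine setLIntegral_mono' T1_meas fun t ht => ?_
        calc _ = ∑' m : ℕ, (if Sel F lam m (idx m t) then (1 : ENNReal) else 0) * ENNReal.ofReal (F t) := by
              congr 1; ext m
              rw [Finset.sum_eq_single_of_mem (idx m t) (Finset.mem_range.2 (idx_lt m ht))]
              · rw [indicator_of_mem (show t ∈ cell m (idx m t) from ⟨ht, rfl⟩)]
                split_ifs <;> simp
              · intro j _ hj
                rw [indicator_of_notMem]
                rintro ⟨_, h⟩; exact hj h.symm
          _ ≤ 1 * ENNReal.ofReal (F t) := by
              rw [ENNReal.tsum_mul_right]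
              gcongr
              exact sel_le_one F lam t
          _ = _ := one_mul _

lemma Marc_meas (F : ℝ → ℝ) (lam : ℝ) : Measurable (Marc F lam) := by
  unfold Marc
  refine Measurable.ennreal_tsum fun m => Finset.measurable_fun_sum _ fun j _ => ?_
  split_ifs
  · apply Measurable.ennreal_ofReal
    simp only [wt_eq_pk]
    exact ((pk_continuous (dd_pos m)).measurable.comp (by fun_prop)).const_mul _
  · exact measurable_const

open Classical in
lemma Marc_int {F : ℝ → ℝ} (hm : Measurable F) (h0 : ∀ t, 0 ≤ F t) (hF : IntegrableOn F T1) {lam : ℝ} (hl : 0 < lam) :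
    ∫⁻ x in T1, Marc F lam x ≤ ENNReal.ofReal (10 / lam) * ∫⁻ t in T1, ENNReal.ofReal (F t) := by
  have hmeas : ∀ m j, Measurable (fun x => if Sel F lam m j then ENNReal.ofReal (dd m ^ 2 / wt m j x) else 0) := by
    intro m j
    split_ifs
    · apply Measurable.ennreal_ofReal
      simp only [wt_eq_pk]
      exact ((pk_continuous (dd_pos m)).measurable.comp (by fun_prop)).const_mul _
    · exact measurable_const
  unfold Marc
  rw [lintegral_tsum fun m => (Finset.measurable_fun_sum _ fun j _ => hmeas m j).aemeasurable]
  calc _ ≤ ∑' m : ℕ, ENNReal.ofReal 10 * ∑ j ∈ Finset.range (2 ^ m), (if Sel F lam m j then ENNReal.ofReal (dd m) else 0) := by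
        refine ENNReal.tsum_le_tsum fun m => ?_
        rw [lintegral_finsetSum _ fun j _ => hmeas m j, Finset.mul_sum]
        refine Finset.sum_le_sum fun j _ => ?_
        split_ifs
        · simp only [wt_eq_pk]
          simp only [ENNReal.ofReal_mul (dd_pos m).le]
          have hpm : Measurable (fun a => ENNReal.ofReal (pk (dd m) (a - lep m j))) :=
            ((pk_continuous (dd_pos m)).measurable.comp (measurable_id.sub_const _)).ennreal_ofReal
          rw [lintegral_const_mul _ hpm, mul_comm]
          gcongr
          exact pk_integral_shift (dd_pos m) _
        · simp
    _ ≤ ENNReal.ofReal 10 * (ENNReal.ofReal (1 / lam) * ∫⁻ t in T1, ENNReal.ofReal (F t)) := by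
        rw [ENNReal.tsum_mul_left]
        gcongr
        exact sel_sum_le hm h0 hF hl
    _ = _ := by
        rw [← mul_assoc, ← ENNReal.ofReal_mul (by norm_num)]
        congr 2; ring

lemma sel_far {m j : ℕ} {x : ℝ} (h : dd m ^ 2 / wt m j x ≤ 1 / 41) :
    2 * Real.pi * dd m ≤ |Real.sin ((lep m j - x) / 2)| := by
  have hd := dd_pos m
  have hpi := Real.pi_lt_d2
  have hp := Real.pi_pos
  rw [div_le_div_iff₀ (wt_pos _ _ _) (by norm_num)] at h
  unfold wt at h
  rw [← abs_of_pos (show 0 < 2 * Real.pi * dd m by positivity)]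
  apply sq_le_sq.1
  have : (2 * Real.pi) ^ 2 ≤ 40 := by nlinarith
  nlinarith [sq_nonneg (dd m)]

open Classical in
lemma Gam_le_of_Marc {F : ℝ → ℝ} (h0 : ∀ t, 0 ≤ F t) (hF : IntegrableOn F T1) {lam : ℝ} (hl : 0 < lam)
    (hb : bb F 0 0 ≤ lam) {x : ℝ} (hM : Marc F lam x ≤ ENNReal.ofReal (1 / 41)) (m : ℕ) :
    Gam F m x ≤ 67 * lam ^ 2 := by
  -- finite real sum bound
  have hS : ∑ m' ∈ Finset.range (m + 1), ∑ j ∈ Finset.range (2 ^ m'),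
      (if Sel F lam m' j then dd m' ^ 2 / wt m' j x else 0) ≤ 1 / 41 := by
    have : ENNReal.ofReal (∑ m' ∈ Finset.range (m + 1), ∑ j ∈ Finset.range (2 ^ m'),
      (if Sel F lam m' j then dd m' ^ 2 / wt m' j x else 0)) ≤ ENNReal.ofReal (1 / 41) := by
      refine le_trans ?_ hM
      unfold Marc
      refine le_trans ?_ (ENNReal.sum_le_tsum (Finset.range (m + 1)))
      rw [ENNReal.ofReal_sum_of_nonneg]
      · refine Finset.sum_le_sum fun m' _ => ?_
        rw [ENNReal.ofReal_sum_of_nonneg]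
        · refine Finset.sum_le_sum fun j _ => ?_
          split_ifs <;> simp
        · intro j _
          split_ifs
          · exact div_nonneg (sq_nonneg _) (wt_pos _ _ _).le
          · exact le_rfl
      · intro m' _
        refine Finset.sum_nonneg fun j _ => ?_
        split_ifs
        · exact div_nonneg (sq_nonneg _) (wt_pos _ _ _).le
        · exact le_rfl
    exact (ENNReal.ofReal_le_ofReal_iff (by norm_num)).1 this
  have hnn : ∀ m' j, 0 ≤ (if Sel F lam m' j then dd m' ^ 2 / wt m' j x else 0) := by
    intro m' j
    split_ifs
    · exact div_nonneg (sq_nonneg _) (wt_pos _ _ _).le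
    · exact le_rfl
  have hterm : ∀ m' ≤ m, ∀ j < 2 ^ m', Sel F lam m' j → dd m' ^ 2 / wt m' j x ≤ 1 / 41 := by
    intro m' hm' j hj hs
    refine le_trans ?_ hS
    calc _ = (if Sel F lam m' j then dd m' ^ 2 / wt m' j x else 0) := by rw [if_pos hs]
      _ ≤ ∑ j ∈ Finset.range (2 ^ m'), (if Sel F lam m' j then dd m' ^ 2 / wt m' j x else 0) :=
        Finset.single_le_sum (f := fun j => if Sel F lam m' j then dd m' ^ 2 / wt m' j x else 0)
          (fun j _ => hnn m' j) (Finset.mem_range.2 hj)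
      _ ≤ _ := Finset.single_le_sum (f := fun m' => ∑ j ∈ Finset.range (2 ^ m'), if Sel F lam m' j then dd m' ^ 2 / wt m' j x else 0)
          (fun m' _ => Finset.sum_nonneg fun j _ => hnn m' j) (Finset.mem_range.2 (by omega))
  -- pointwise bound of each cell
  have hcell : ∀ j ∈ Finset.range (2 ^ m), bb F m j ^ 2 / wt m j x ≤ lam ^ 2 * (dd m ^ 2 / wt m j x) +
      ∑ m' ∈ Finset.range (m + 1), bb F m j *
        (if Sel F lam m' (j / 2 ^ (m - m')) then 16 * lam * dd m' / wt m' (j / 2 ^ (m - m')) x else 0) := by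
    intro j hj
    have hj' := Finset.mem_range.1 hj
    have hbj := bb_nonneg h0 m j
    have hw := wt_pos m j x
    have hnn2 : ∀ m', 0 ≤ bb F m j *
        (if Sel F lam m' (j / 2 ^ (m - m')) then 16 * lam * dd m' / wt m' (j / 2 ^ (m - m')) x else 0) := by
      intro m'
      have := wt_pos m' (j / 2 ^ (m - m')) x
      have := dd_pos m'
      split_ifs <;> positivity
    by_cases hc : bb F m j ≤ lam * dd m
    · have : bb F m j ^ 2 / wt m j x ≤ lam ^ 2 * (dd m ^ 2 / wt m j x) := by
        rw [← mul_div_assoc, ← mul_pow]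
        gcongr
      have := Finset.sum_nonneg fun m' (_ : m' ∈ Finset.range (m + 1)) => hnn2 m'
      linarith
    · push Not at hc
      have hex : ∃ m', lam * dd m' < bb F m' (j / 2 ^ (m - m')) := ⟨m, by simpa using hc⟩
      set q := Nat.find hex with hq
      have q1 := Nat.find_spec hex
      rw [← hq] at q1
      have qm : q ≤ m := Nat.find_min' hex (by simpa using hc)
      set J := j / 2 ^ (m - q) with hJ
      have hlt : J < 2 ^ q := by
        rw [hJ, Nat.div_lt_iff_lt_mul (by positivity), ← pow_add]
        rwa [show q + (m - q) = m by omega]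
      have qmin : ∀ m' < q, bb F m' (J / 2 ^ (q - m')) ≤ lam * dd m' := by
        intro m' h
        have := Nat.find_min hex h
        push Not at this
        rw [hJ, Nat.div_div_eq_div_mul, ← pow_add]
        rwa [show m - q + (q - m') = m - m' by omega]
      have hsel : Sel F lam q J := ⟨q1, qmin⟩
      have hq0 : q ≠ 0 := by
        intro h
        rw [h] at q1 hlt
        have : J = 0 := by simpa using hlt
        rw [this] at q1
        simp [dd] at q1
        linarith
      have hbQ : bb F q J ≤ 2 * lam * dd q := by
        have a1 := qmin (q - 1) (by omega)
        have a2 := bb_anc_le h0 hF (show q - 1 ≤ q by omega) J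
        have a3 : dd (q - 1) = 2 * dd q := by
          unfold dd
          obtain ⟨r, hr⟩ := Nat.exists_eq_succ_of_ne_zero hq0
          rw [hr]; simp [pow_succ]; ring
        rw [a3] at a1
        linarith
      have hbJ : bb F m j ≤ bb F q J := bb_anc_le h0 hF qm j
      have hfar := sel_far (hterm q qm J hlt hsel)
      have hdq := dd_pos q
      have hpi := Real.pi_gt_three
      have hnear : |lep m j - lep q J| ≤ 2 * Real.pi * dd q := by
        have hmem : lep m j ∈ cell m j := by
          rw [cell_vol_ge hj']
          exact ⟨le_rfl, by have := dd_pos m; nlinarith [mul_pos Real.pi_pos this]⟩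
        apply cell_abs
        exact ⟨hmem.1, by rw [idx_div qm, hmem.2]⟩
      have hs : |Real.sin ((lep q J - x) / 2)| / 2 ≤ |Real.sin ((lep m j - x) / 2)| := by
        have a1 : |Real.sin ((lep q J - x) / 2) - Real.sin ((lep m j - x) / 2)| ≤ |(lep q J - x) / 2 - (lep m j - x) / 2| :=
          Real.abs_sin_sub_sin_le _ _
        have a2 : |(lep q J - x) / 2 - (lep m j - x) / 2| = |lep m j - lep q J| / 2 := by
          rw [show (lep q J - x) / 2 - (lep m j - x) / 2 = -((lep m j - lep q J) / 2) by ring, abs_neg, abs_div]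
          norm_num
        have a3 := abs_sub_abs_le_abs_sub (Real.sin ((lep q J - x) / 2)) (Real.sin ((lep m j - x) / 2))
        rw [a2] at a1
        linarith
      have hwq : wt q J x ≤ 8 * wt m j x := by
        have b1 : dd q ^ 2 ≤ Real.sin ((lep q J - x) / 2) ^ 2 := by
          apply sq_le_sq.2
          rw [abs_of_pos hdq]; nlinarith
        have b2 : (|Real.sin ((lep q J - x) / 2)| / 2) ^ 2 ≤ |Real.sin ((lep m j - x) / 2)| ^ 2 := by
          gcongr
        rw [div_pow, sq_abs, sq_abs] at b2
        unfold wt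
        nlinarith [sq_nonneg (dd m)]
      have hfin : bb F m j ^ 2 / wt m j x ≤ bb F m j * (16 * lam * dd q / wt q J x) := by
        rw [← mul_div_assoc, div_le_div_iff₀ hw (wt_pos q J x)]
        have : bb F m j * wt q J x ≤ (16 * lam * dd q) * wt m j x := by
          calc _ ≤ (2 * lam * dd q) * (8 * wt m j x) := by
                apply mul_le_mul (by linarith) hwq (wt_pos _ _ _).le (by positivity)
            _ = _ := by ring
        nlinarith
      have hsing := Finset.single_le_sum (f := fun m' => bb F m j *
        (if Sel F lam m' (j / 2 ^ (m - m')) then 16 * lam * dd m' / wt m' (j / 2 ^ (m - m')) x else 0))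
        (fun m' _ => hnn2 m') (Finset.mem_range.2 (show q < m + 1 by omega))
      simp only [← hJ, if_pos hsel] at hsing
      have : 0 ≤ lam ^ 2 * (dd m ^ 2 / wt m j x) := by positivity
      linarith
  have hsum := Finset.sum_le_sum hcell
  rw [Finset.sum_add_distrib, ← Finset.mul_sum, Finset.sum_comm] at hsum
  have h2 : ∀ m' ∈ Finset.range (m + 1), ∑ j ∈ Finset.range (2 ^ m), bb F m j *
        (if Sel F lam m' (j / 2 ^ (m - m')) then 16 * lam * dd m' / wt m' (j / 2 ^ (m - m')) x else 0) ≤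
      32 * lam ^ 2 * ∑ J ∈ Finset.range (2 ^ m'), (if Sel F lam m' J then dd m' ^ 2 / wt m' J x else 0) := by
    intro m' hm'
    have hm'm : m' ≤ m := by have := Finset.mem_range.1 hm'; omega
    rw [← Finset.sum_fiberwise_of_maps_to (t := Finset.range (2 ^ m')) (g := fun j => j / 2 ^ (m - m')), Finset.mul_sum]
    · refine Finset.sum_le_sum fun J hJ => ?_
      have hJ' := Finset.mem_range.1 hJ
      calc _ = ∑ j ∈ (Finset.range (2 ^ m)).filter (fun j => j / 2 ^ (m - m') = J), bb F m j *
            (if Sel F lam m' J then 16 * lam * dd m' / wt m' J x else 0) := by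
            refine Finset.sum_congr rfl fun j hj => ?_
            rw [(Finset.mem_filter.1 hj).2]
        _ = bb F m' J * (if Sel F lam m' J then 16 * lam * dd m' / wt m' J x else 0) := by
            rw [← Finset.sum_mul, bb_sum hF hm'm]
        _ ≤ _ := by
            split_ifs with hs
            · have hd' := dd_pos m'
              have hw' := wt_pos m' J x
              have hbQ : bb F m' J ≤ 2 * lam * dd m' := by
                have hq0 : m' ≠ 0 := by
                  intro h
                  subst h
                  have hs1 := hs.1
                  have : J = 0 := by simpa using hJ'
                  rw [this] at hs1
                  simp [dd] at hs1
                  linarith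
                have a1 := hs.2 (m' - 1) (by omega)
                have a2 := bb_anc_le h0 hF (show m' - 1 ≤ m' by omega) J
                have a3 : dd (m' - 1) = 2 * dd m' := by
                  unfold dd
                  obtain ⟨r, hr⟩ := Nat.exists_eq_succ_of_ne_zero hq0
                  rw [hr]; simp [pow_succ]; ring
                rw [a3] at a1
                linarith
              calc _ ≤ (2 * lam * dd m') * (16 * lam * dd m' / wt m' J x) := by gcongr
                _ = _ := by ring
            · simp
    · intro j hj
      have hj' := Finset.mem_range.1 hj
      apply Finset.mem_range.2
      rw [Nat.div_lt_iff_lt_mul (by positivity), ← pow_add]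
      rwa [show m' + (m - m') = m by omega]
  have h3 := Finset.sum_le_sum h2
  rw [← Finset.mul_sum] at h3
  have h4 := sumP m x
  have h5 : Gam F m x = ∑ j ∈ Finset.range (2 ^ m), bb F m j ^ 2 / wt m j x := rfl
  rw [h5]
  have hl2 : 0 < lam ^ 2 := by positivity
  nlinarith

/-- weak type estimate for the maximal square function -/
lemma Gam_weak {F : ℝ → ℝ} (hm : Measurable F) (h0 : ∀ t, 0 ≤ F t) (hF : IntegrableOn F T1) {lam : ℝ} (hl : 0 < lam) :
    volume {x | x ∈ T1 ∧ ∃ m, 67 * lam ^ 2 < Gam F m x} ≤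
      ENNReal.ofReal (410 / lam * ∫ t in T1, F t) := by
  have hI : 0 ≤ ∫ t in T1, F t := integral_nonneg fun t => h0 t
  have hbI : bb F 0 0 ≤ ∫ t in T1, F t := by
    unfold bb
    apply setIntegral_mono_set hF (Eventually.of_forall fun t => h0 t)
    exact (cell_sub 0 0).eventuallyLE
  by_cases hb : bb F 0 0 ≤ lam
  · have hsub : {x | x ∈ T1 ∧ ∃ m, 67 * lam ^ 2 < Gam F m x} ⊆
        {x | ENNReal.ofReal (1 / 41) ≤ Marc F lam x} ∩ T1 := by
      rintro x ⟨hx, m, hmx⟩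
      refine ⟨?_, hx⟩
      by_contra hcon
      simp only [mem_setOf_eq, not_le] at hcon
      exact absurd (Gam_le_of_Marc h0 hF hl hb hcon.le m) (not_le.2 hmx)
    refine (measure_mono hsub).trans ?_
    have hpos : ENNReal.ofReal (1 / 41) ≠ 0 := by simp
    have h1 := meas_ge_le_lintegral_div (μ := volume.restrict T1) (Marc_meas F lam).aemeasurable hpos ENNReal.ofReal_ne_top
    rw [Measure.restrict_apply (measurableSet_le measurable_const (Marc_meas F lam))] at h1
    refine h1.trans ?_
    have h2 := Marc_int hm h0 hF hl
    rw [← ofReal_integral_eq_lintegral_ofReal hF (Eventually.of_forall h0), ← ENNReal.ofReal_mul (by positivity)] at h2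
    rw [ENNReal.div_le_iff hpos ENNReal.ofReal_ne_top, ← ENNReal.ofReal_mul (by positivity)]
    refine h2.trans (ENNReal.ofReal_le_ofReal (le_of_eq ?_))
    ring
  · push Not at hb
    refine (measure_mono (fun x hx => hx.1)).trans ?_
    rw [vol_T1]
    apply ENNReal.ofReal_le_ofReal
    have : 1 ≤ (∫ t in T1, F t) / lam := by rw [le_div_iff₀ hl]; linarith
    have hpi := Real.pi_lt_four
    calc _ ≤ 410 * ((∫ t in T1, F t) / lam) := by linarith
      _ = _ := by ring

end

noncomputable section

lemma sq_int_le {g : ℝ → ℝ} (hg : Continuous g) {p l : ℝ} (hl : 0 < l) :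
    (∫ t in Icc p (p + l), |g t|) ^ 2 ≤ l * ∫ t in Icc p (p + l), g t ^ 2 := by
  set I := ∫ t in Icc p (p + l), |g t| with hI
  have hv : volume.real (Icc p (p + l)) = l := by
    rw [Measure.real, Real.volume_Icc, add_sub_cancel_left, ENNReal.toReal_ofReal hl.le]
  have h1 : 0 ≤ ∫ t in Icc p (p + l), (|g t| - I / l) ^ 2 := integral_nonneg fun t => sq_nonneg _
  have i1 : IntegrableOn (fun t => g t ^ 2) (Icc p (p + l)) := (hg.pow 2).integrableOn_Icc
  have i2 : IntegrableOn (fun t => 2 * (I / l) * |g t|) (Icc p (p + l)) :=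
    (hg.abs.const_smul (2 * (I / l))).integrableOn_Icc
  have i3 : IntegrableOn (fun _ : ℝ => (I / l) ^ 2) (Icc p (p + l)) := continuous_const.integrableOn_Icc
  have h2 : ∫ t in Icc p (p + l), (|g t| - I / l) ^ 2 =
      (∫ t in Icc p (p + l), g t ^ 2) - 2 * (I / l) * I + l * (I / l) ^ 2 := by
    have : ∀ t, (|g t| - I / l) ^ 2 = g t ^ 2 - 2 * (I / l) * |g t| + (I / l) ^ 2 := by
      intro t; rw [← sq_abs (g t)]; ring
    simp only [this]
    have i12 : IntegrableOn (fun t => g t ^ 2 - 2 * (I / l) * |g t|) (Icc p (p + l)) := i1.sub i2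
    rw [integral_add i12 i3, integral_sub i1 i2, integral_const_mul, setIntegral_const, hv, smul_eq_mul]
  rw [h2] at h1
  have h3 : l * (I / l) ^ 2 = I * (I / l) := by field_simp
  have h4 : I ^ 2 / l ≤ ∫ t in Icc p (p + l), g t ^ 2 := by
    have : I ^ 2 / l = I * (I / l) := by ring
    rw [this]; linarith
  rw [div_le_iff₀ hl] at h4
  linarith

lemma sup_sq_le {g g' : ℝ → ℝ} (hd : ∀ t, HasDerivAt g (g' t) t) (hc : Continuous g') {p l : ℝ} (hl : 0 < l)
    {t0 : ℝ} (ht0 : t0 ∈ Icc p (p + l)) :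
    g t0 ^ 2 ≤ 2 / l * (∫ t in Icc p (p + l), g t ^ 2) + 2 * l * ∫ t in Icc p (p + l), g' t ^ 2 := by
  have hgc : Continuous g := continuous_iff_continuousAt.2 fun t => (hd t).continuousAt
  have hv : volume.real (Icc p (p + l)) = l := by
    rw [Measure.real, Real.volume_Icc, add_sub_cancel_left, ENNReal.toReal_ofReal hl.le]
  have h1 : ∀ t ∈ Icc p (p + l), g t0 ^ 2 ≤ 2 * g t ^ 2 + 2 * l * ∫ t in Icc p (p + l), g' t ^ 2 := by
    intro t ht
    have e1 : ∫ s in t..t0, g' s = g t0 - g t :=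
      intervalIntegral.integral_eq_sub_of_hasDerivAt (fun s _ => hd s) (hc.intervalIntegrable _ _)
    have e2 : |g t0 - g t| ≤ ∫ s in Icc p (p + l), |g' s| := by
      rw [← e1]
      refine (intervalIntegral.norm_integral_le_integral_norm_uIoc (f := g')).trans ?_
      apply setIntegral_mono_set hc.abs.integrableOn_Icc (Eventually.of_forall fun s => abs_nonneg _)
      apply LE.le.eventuallyLE
      intro s hs
      have := uIoc_subset_uIcc hs
      exact (uIcc_subset_Icc ht ht0) this
    have e3 := sq_int_le hc hl (p := p)
    have e4 : (g t0 - g t) ^ 2 ≤ l * ∫ t in Icc p (p + l), g' t ^ 2 := by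
      refine le_trans ?_ e3
      rw [← sq_abs (g t0 - g t)]
      gcongr
    nlinarith [sq_nonneg (g t0 - 2 * g t)]
  have h2 : ∫ t in Icc p (p + l), g t0 ^ 2 ≤
      ∫ t in Icc p (p + l), (2 * g t ^ 2 + 2 * l * ∫ t in Icc p (p + l), g' t ^ 2) := by
    apply setIntegral_mono_on continuous_const.integrableOn_Icc _ measurableSet_Icc h1
    exact (by fun_prop : Continuous fun t => (2 * g t ^ 2 + 2 * l * ∫ t in Icc p (p + l), g' t ^ 2)).integrableOn_Icc
  have i1 : IntegrableOn (fun t => 2 * g t ^ 2) (Icc p (p + l)) := (by fun_prop : Continuous fun t => 2 * g t ^ 2).integrableOn_Icc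
  have i3 : IntegrableOn (fun _ : ℝ => 2 * l * ∫ t in Icc p (p + l), g' t ^ 2) (Icc p (p + l)) := continuous_const.integrableOn_Icc
  rw [setIntegral_const, integral_add i1 i3, integral_const_mul, setIntegral_const, hv, smul_eq_mul, smul_eq_mul] at h2
  have h3 : g t0 ^ 2 = (l * g t0 ^ 2) / l := by field_simp
  rw [h3]
  calc _ ≤ (2 * ∫ t in Icc p (p + l), g t ^ 2) / l + (l * (2 * l * ∫ t in Icc p (p + l), g' t ^ 2)) / l := by
        rw [← add_div]; gcongr
    _ = _ := by field_simp

lemma int_cos_orth (x : ℝ) (k l : ℕ) :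
    ∫ t in T1, Real.cos (((k : ℝ) - l) * (t - x)) = if k = l then 2 * Real.pi else 0 := by
  split_ifs with h
  · subst h
    simp only [sub_self, zero_mul, Real.cos_zero]
    rw [setIntegral_const, Measure.real, vol_T1, ENNReal.toReal_ofReal two_pi_pos.le]; simp
  · rw [int_T1_eq]
    have hc : ((k : ℝ) - l) ≠ 0 := by
      rw [sub_ne_zero]; exact_mod_cast h
    rw [intervalIntegral.integral_comp_sub_right (fun t => Real.cos (((k : ℝ) - l) * t)),
      intervalIntegral.integral_comp_mul_left _ hc, integral_cos]
    have : Real.sin (((k : ℝ) - l) * (-Real.pi + 2 * Real.pi - x)) = Real.sin (((k : ℝ) - l) * (-Real.pi - x)) := by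
      rw [← Real.sin_add_int_mul_two_pi (((k : ℝ) - l) * (-Real.pi - x)) ((k : ℤ) - l)]
      congr 1; push_cast; ring
    rw [this]; simp

lemma parseval (x : ℝ) (L : ℕ) (D : ℕ → ℝ) :
    ∫ t in T1, ((∑ k ∈ Finset.range L, D k * Real.cos (k * (t - x))) ^ 2 +
      (∑ k ∈ Finset.range L, D k * Real.sin (k * (t - x))) ^ 2) =
    2 * Real.pi * ∑ k ∈ Finset.range L, D k ^ 2 := by
  have h : ∀ t, ((∑ k ∈ Finset.range L, D k * Real.cos (k * (t - x))) ^ 2 +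
      (∑ k ∈ Finset.range L, D k * Real.sin (k * (t - x))) ^ 2) =
      ∑ k ∈ Finset.range L, ∑ l ∈ Finset.range L, D k * D l * Real.cos (((k : ℝ) - l) * (t - x)) := by
    intro t
    rw [sq, sq, Finset.sum_mul_sum, Finset.sum_mul_sum, ← Finset.sum_add_distrib]
    refine Finset.sum_congr rfl fun k _ => ?_
    rw [← Finset.sum_add_distrib]
    refine Finset.sum_congr rfl fun l _ => ?_
    rw [sub_mul, Real.cos_sub]; ring
  simp only [h]
  have hi : ∀ k l : ℕ, IntegrableOn (fun t => D k * D l * Real.cos (((k : ℝ) - l) * (t - x))) T1 := by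
    intro k l
    have : Continuous (fun t => D k * D l * Real.cos (((k : ℝ) - l) * (t - x))) := by fun_prop
    exact (this.integrableOn_Icc (a := -Real.pi) (b := Real.pi)).mono_set Ico_subset_Icc_self
  rw [integral_finsetSum _ fun k _ => integrable_finsetSum _ fun l _ => hi k l, Finset.mul_sum]
  refine Finset.sum_congr rfl fun k hk => ?_
  rw [integral_finsetSum _ fun l _ => hi k l, Finset.sum_eq_single_of_mem k hk]
  · rw [integral_const_mul, int_cos_orth, if_pos rfl]; ring
  · intro l _ hl
    rw [integral_const_mul, int_cos_orth, if_neg hl.symm, mul_zero]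

lemma gallagher {φ : ℝ → ℝ} (hφ : IntegrableOn φ T1) (x : ℝ) (a L m : ℕ) (hL : L ≤ 2 ^ m) :
    ∑ k ∈ Finset.range L, (∫ t in T1, Real.cos (((a + k : ℕ) : ℝ) * (t - x)) * φ t) ^ 2 ≤
      82 * 2 ^ m * ∑ j ∈ Finset.range (2 ^ m), (∫ t in cell m j, |φ t|) ^ 2 := by
  set D : ℕ → ℝ := fun k => ∫ t in T1, Real.cos (((a + k : ℕ) : ℝ) * (t - x)) * φ t with hD
  set S := ∑ k ∈ Finset.range L, D k ^ 2 with hS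
  set A : ℝ → ℝ := fun t => ∑ k ∈ Finset.range L, D k * Real.cos (k * (t - x)) with hA
  set B : ℝ → ℝ := fun t => ∑ k ∈ Finset.range L, D k * Real.sin (k * (t - x)) with hB
  set A' : ℝ → ℝ := fun t => - ∑ k ∈ Finset.range L, (k * D k) * Real.sin (k * (t - x)) with hA'
  set B' : ℝ → ℝ := fun t => ∑ k ∈ Finset.range L, (k * D k) * Real.cos (k * (t - x)) with hB'
  have cA : Continuous A := by simp only [hA]; fun_prop
  have cB : Continuous B := by simp only [hB]; fun_prop
  have cA' : Continuous A' := by simp only [hA']; fun_prop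
  have cB' : Continuous B' := by simp only [hB']; fun_prop
  have dA : ∀ t, HasDerivAt A (A' t) t := by
    intro t
    simp only [hA, hA', ← Finset.sum_neg_distrib]
    apply HasDerivAt.fun_sum
    intro k _
    have h1 : HasDerivAt (fun t : ℝ => (k : ℝ) * (t - x)) k t := by
      simpa using ((hasDerivAt_id t).sub_const x).const_mul (k : ℝ)
    have h2 := (h1.cos).const_mul (D k)
    exact h2.congr_deriv (by ring)
  have dB : ∀ t, HasDerivAt B (B' t) t := by
    intro t
    simp only [hB, hB']
    apply HasDerivAt.fun_sum
    intro k _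
    have h1 : HasDerivAt (fun t : ℝ => (k : ℝ) * (t - x)) k t := by
      simpa using ((hasDerivAt_id t).sub_const x).const_mul (k : ℝ)
    have h2 := (h1.sin).const_mul (D k)
    exact h2.congr_deriv (by ring)
  have contT : ∀ {g : ℝ → ℝ}, Continuous g → IntegrableOn g T1 := fun hg =>
    (hg.integrableOn_Icc (a := -Real.pi) (b := Real.pi)).mono_set Ico_subset_Icc_self
  have P1 : ∫ t in T1, (A t ^ 2 + B t ^ 2) = 2 * Real.pi * S := parseval x L D
  have P2 : ∫ t in T1, (A' t ^ 2 + B' t ^ 2) ≤ 2 * Real.pi * (4 ^ m * S) := by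
    have := parseval x L (fun k => k * D k)
    have e : ∀ t, A' t ^ 2 + B' t ^ 2 = (∑ k ∈ Finset.range L, (k * D k) * Real.cos (k * (t - x))) ^ 2 +
      (∑ k ∈ Finset.range L, (k * D k) * Real.sin (k * (t - x))) ^ 2 := by
      intro t; simp only [hA', hB', neg_sq]; ring
    simp only [e]
    rw [this, hS]
    have := two_pi_pos
    gcongr
    rw [Finset.mul_sum]
    refine Finset.sum_le_sum fun k hk => ?_
    rw [mul_pow]
    gcongr
    have hk' : k ≤ 2 ^ m := (Finset.mem_range.1 hk).le.trans hL
    have hk2 : (k : ℝ) ≤ 2 ^ m := by exact_mod_cast hk'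
    calc (k : ℝ) ^ 2 ≤ (2 ^ m) ^ 2 := by gcongr
      _ = 4 ^ m := by rw [← pow_mul, mul_comm, pow_mul]; norm_num
  have hd := dd_pos m
  set l := 2 * Real.pi * dd m with hl
  have hl0 : 0 < l := by have := two_pi_pos; positivity
  set W : ℕ → ℝ := fun j => 2 / l * (∫ t in cell m j, (A t ^ 2 + B t ^ 2)) +
    2 * l * ∫ t in cell m j, (A' t ^ 2 + B' t ^ 2) with hW
  have hWn : ∀ j, 0 ≤ W j := by
    intro j
    have h1 : 0 ≤ ∫ t in cell m j, (A t ^ 2 + B t ^ 2) := integral_nonneg fun t => by positivity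
    have h2 : 0 ≤ ∫ t in cell m j, (A' t ^ 2 + B' t ^ 2) := integral_nonneg fun t => by positivity
    simp only [hW]; positivity
  have hWsum : ∑ j ∈ Finset.range (2 ^ m), W j ≤ 82 * 2 ^ m * S := by
    simp only [hW]
    rw [Finset.sum_add_distrib, ← Finset.mul_sum, ← Finset.mul_sum,
      ← int_cells (contT (by fun_prop)) m, ← int_cells (contT (by fun_prop)) m, P1]
    have hS0 : 0 ≤ S := Finset.sum_nonneg fun k _ => sq_nonneg _
    have hdm := dd_mul m
    have h2m : (2 : ℝ) ^ m = 1 / dd m := by field_simp; linarith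
    have h4m : (4 : ℝ) ^ m = 2 ^ m * 2 ^ m := by rw [← mul_pow]; norm_num
    have hpi := Real.pi_pos
    have hpi2 := Real.pi_lt_d2
    calc _ ≤ 2 / l * (2 * Real.pi * S) + 2 * l * (2 * Real.pi * (4 ^ m * S)) := by gcongr
      _ = (2 + 8 * Real.pi ^ 2) * (2 ^ m * S) := by
          rw [hl, h4m, h2m]; field_simp
          ring
      _ ≤ 82 * (2 ^ m * S) := by gcongr; nlinarith
      _ = _ := by ring
  have hpt : ∀ j ∈ Finset.range (2 ^ m), ∀ t ∈ cell m j, A t ^ 2 + B t ^ 2 ≤ W j := by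
    intro j hj t ht
    have hj' := Finset.mem_range.1 hj
    have hce := cell_vol_ge hj'
    have ht' : t ∈ Icc (lep m j) (lep m j + l) := by
      rw [hce] at ht; exact Ico_subset_Icc_self ht
    have h1 := sup_sq_le dA cA' hl0 ht'
    have h2 := sup_sq_le dB cB' hl0 ht'
    simp only [integral_Icc_eq_integral_Ico] at h1 h2
    rw [← hl] at hce
    rw [← hce] at h1 h2
    have ci : ∀ {g : ℝ → ℝ}, Continuous g → IntegrableOn g (cell m j) := fun hg => (contT hg).mono_set (cell_sub _ _)
    simp only [hW]
    rw [integral_add (ci (by fun_prop)) (ci (by fun_prop)), integral_add (ci (by fun_prop)) (ci (by fun_prop))]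
    nlinarith
  -- duality
  have hci : ∀ k : ℕ, IntegrableOn (fun t => Real.cos (((a + k : ℕ) : ℝ) * (t - x)) * φ t) T1 := by
    intro k
    apply Integrable.bdd_mul (c := 1) hφ
    · exact (by fun_prop : Continuous fun t => Real.cos (((a + k : ℕ) : ℝ) * (t - x))).aestronglyMeasurable
    · exact Eventually.of_forall fun t => Real.abs_cos_le_one _
  set q : ℝ → ℝ := fun t => Real.cos (a * (t - x)) * A t - Real.sin (a * (t - x)) * B t with hq
  have hqs : ∀ t, q t * φ t = ∑ k ∈ Finset.range L, D k * (Real.cos (((a + k : ℕ) : ℝ) * (t - x)) * φ t) := by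
    intro t
    simp only [hq, hA, hB]
    rw [Finset.mul_sum, Finset.mul_sum, ← Finset.sum_sub_distrib, Finset.sum_mul]
    refine Finset.sum_congr rfl fun k _ => ?_
    push_cast
    rw [add_mul, Real.cos_add]; ring
  have hqi : IntegrableOn (fun t => q t * φ t) T1 := by
    simp only [hqs]
    exact integrable_finsetSum _ fun k _ => (hci k).const_mul _
  have hSq : S = ∫ t in T1, q t * φ t := by
    simp only [hqs]
    rw [integral_finsetSum _ fun k _ => (hci k).const_mul _, hS]
    refine Finset.sum_congr rfl fun k _ => ?_
    rw [integral_const_mul, sq]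
  have hqle : ∀ t, q t ^ 2 ≤ A t ^ 2 + B t ^ 2 := by
    intro t
    simp only [hq]
    nlinarith [sq_nonneg (Real.sin (a * (t - x)) * A t + Real.cos (a * (t - x)) * B t), Real.sin_sq_add_cos_sq (a * (t - x))]
  have hS2 : S ≤ ∑ j ∈ Finset.range (2 ^ m), Real.sqrt (W j) * ∫ t in cell m j, |φ t| := by
    rw [hSq, int_cells hqi m]
    refine Finset.sum_le_sum fun j hj => ?_
    rw [← integral_const_mul]
    apply setIntegral_mono_on (hqi.mono_set (cell_sub _ _)) ((hφ.mono_set (cell_sub _ _)).abs.const_mul _) (cell_meas _ _)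
    intro t ht
    refine (le_abs_self _).trans ?_
    rw [abs_mul]
    gcongr
    exact Real.abs_le_sqrt ((hqle t).trans (hpt j hj t ht))
  have hCS := Finset.sum_mul_sq_le_sq_mul_sq (Finset.range (2 ^ m)) (fun j => Real.sqrt (W j)) (fun j => ∫ t in cell m j, |φ t|)
  have hsq : ∀ j, Real.sqrt (W j) ^ 2 = W j := fun j => Real.sq_sqrt (hWn j)
  simp only [hsq] at hCS
  have hS0 : 0 ≤ S := Finset.sum_nonneg fun k _ => sq_nonneg _
  set β := ∑ j ∈ Finset.range (2 ^ m), (∫ t in cell m j, |φ t|) ^ 2 with hβ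
  have hβ0 : 0 ≤ β := Finset.sum_nonneg fun k _ => sq_nonneg _
  have hfin : S ^ 2 ≤ 82 * 2 ^ m * S * β := by
    calc S ^ 2 ≤ _ := by gcongr
      _ ≤ _ := hCS
      _ ≤ _ := by gcongr
  rcases hS0.eq_or_lt with h | h
  · rw [← h]; positivity
  · have : S * S ≤ S * (82 * 2 ^ m * β) := by nlinarith
    exact le_of_mul_le_mul_left this h

end

noncomputable section

/-- modulated conjugate integrals -/
def cn (e : ℝ) (F : ℝ → ℝ) (n : ℕ) (x : ℝ) : ℝ :=
  ∫ t in T1, Real.cos (n * (t - x)) * (ck e (t - x) * F t)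

/-- conjugate integrals -/
def conj1 (e : ℝ) (F : ℝ → ℝ) (x : ℝ) : ℝ := ∫ t in T1, ck e (t - x) * F t

lemma ck_mul_int {F : ℝ → ℝ} (hF : IntegrableOn F T1) {e : ℝ} (he : 0 < e) (x : ℝ) :
    IntegrableOn (fun t => ck e (t - x) * F t) T1 := by
  apply Integrable.bdd_mul (c := 1 / e) hF
  · exact ((ck_continuous he).comp (by fun_prop)).aestronglyMeasurable
  · exact Eventually.of_forall fun t => abs_ck_le he _

lemma pk_mul_int {F : ℝ → ℝ} (hF : IntegrableOn F T1) {e : ℝ} (he : 0 < e) (x : ℝ) :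
    IntegrableOn (fun t => pk e (t - x) * F t) T1 := by
  apply Integrable.bdd_mul (c := 1 / e) hF
  · exact ((pk_continuous he).comp (by fun_prop)).aestronglyMeasurable
  · exact Eventually.of_forall fun t => by
      rw [Real.norm_of_nonneg (pk_nonneg he _)]; exact pk_le he _

lemma cos_mul_int {φ : ℝ → ℝ} (hφ : IntegrableOn φ T1) (n : ℕ) (x : ℝ) :
    IntegrableOn (fun t => Real.cos (n * (t - x)) * φ t) T1 := by
  apply Integrable.bdd_mul (c := 1) hφ
  · exact (by fun_prop : Continuous fun t => Real.cos ((n : ℝ) * (t - x))).aestronglyMeasurable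
  · exact Eventually.of_forall fun t => Real.abs_cos_le_one _

lemma far_est {F : ℝ → ℝ} (hF : IntegrableOn F T1) {e : ℝ} {x : ℝ} {m L : ℕ}
    (he : dd m ≤ e) (hL0 : 0 < L) (hL : L ≤ 2 ^ m) (hL2 : 2 ^ m ≤ 2 * L) {G : ℝ} (hG0 : 0 ≤ G)
    (hG : Gam (fun t => |F t|) m x ≤ G ^ 2) (a : ℕ) :
    ∑ k ∈ Finset.range L, |cn e F (a + k) x| ≤ 59 * G * L := by
  have hd := dd_pos m
  have he0 : 0 < e := hd.trans_le he
  have hg := gallagher (ck_mul_int hF he0 x) x a L m hL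
  have h1 : ∀ j ∈ Finset.range (2 ^ m), (∫ t in cell m j, |ck e (t - x) * F t|) ^ 2 ≤
      21 * (bb (fun t => |F t|) m j ^ 2 / wt m j x) := by
    intro j _
    have hw := wt_pos m j x
    have h2 : ∫ t in cell m j, |ck e (t - x) * F t| ≤ Real.sqrt (21 / wt m j x) * bb (fun t => |F t|) m j := by
      unfold bb
      rw [← integral_const_mul]
      apply setIntegral_mono_on ((ck_mul_int hF he0 x).mono_set (cell_sub _ _)).abs
        ((hF.mono_set (cell_sub _ _)).abs.const_mul _) (cell_meas _ _)
      intro t ht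
      rw [abs_mul]
      gcongr
      apply Real.abs_le_sqrt
      refine (ck_sq_le he0 _).trans ?_
      rw [div_le_div_iff₀ (den_pos he0 _) hw]
      have := (wt_near ht x).2
      nlinarith
    have h3 : 0 ≤ ∫ t in cell m j, |ck e (t - x) * F t| := integral_nonneg fun t => abs_nonneg _
    calc _ ≤ (Real.sqrt (21 / wt m j x) * bb (fun t => |F t|) m j) ^ 2 := by gcongr
      _ = _ := by
        rw [mul_pow, Real.sq_sqrt (by positivity)]; ring
  have h2 := Finset.sum_le_sum h1
  rw [← Finset.mul_sum] at h2
  have h3 : ∑ j ∈ Finset.range (2 ^ m), bb (fun t => |F t|) m j ^ 2 / wt m j x ≤ G ^ 2 := hG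
  have hL2' : (2 : ℝ) ^ m ≤ 2 * L := by exact_mod_cast hL2
  have hLr : (0 : ℝ) < L := by exact_mod_cast hL0
  have h4 : ∑ k ∈ Finset.range L, |cn e F (a + k) x| ^ 2 ≤ 3444 * L * G ^ 2 := by
    simp only [sq_abs]
    refine (hg : _ ≤ _).trans ?_
    calc _ ≤ 82 * 2 ^ m * (21 * G ^ 2) := by
          gcongr
          linarith
      _ ≤ 82 * (2 * L) * (21 * G ^ 2) := by gcongr
      _ = _ := by ring
  have h5 := sq_sum_le_card_mul_sum_sq (s := Finset.range L) (f := fun k => |cn e F (a + k) x|)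
  rw [Finset.card_range] at h5
  apply le_of_sq_le_sq _ (by positivity)
  calc _ ≤ _ := h5
    _ ≤ L * (3444 * L * G ^ 2) := by gcongr
    _ ≤ _ := by nlinarith [sq_nonneg (L * G)]

lemma int4 {μ : Measure ℝ} {f1 f2 f3 f4 : ℝ → ℝ} (h1 : Integrable f1 μ) (h2 : Integrable f2 μ)
    (h3 : Integrable f3 μ) (h4 : Integrable f4 μ) :
    (∫ t, f1 t ∂μ) - ((∫ t, f2 t ∂μ) - ∫ t, f3 t ∂μ) - ∫ t, f4 t ∂μ = ∫ t, (f1 t - (f2 t - f3 t) - f4 t) ∂μ := by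
  have h23 : Integrable (fun t => f2 t - f3 t) μ := h2.sub h3
  have h123 : Integrable (fun t => f1 t - (f2 t - f3 t)) μ := h1.sub h23
  rw [integral_sub h123 h4, integral_sub h1 h23, integral_sub h2 h3]

lemma osc_est {F : ℝ → ℝ} (hF : IntegrableOn F T1) {e : ℝ} (he : 0 < e) {x G : ℝ} (hG0 : 0 ≤ G)
    (hG : ∀ m, Gam (fun t => |F t|) m x ≤ G ^ 2) (hC : ∀ e', 0 < e' → |conj1 e' F x| ≤ G) (a L : ℕ) (hL0 : 0 < L) :
    ∃ c, ∑ k ∈ Finset.range L, |cn e F (a + k) x - c| ≤ 309 * G * L ∧ (a = 0 → |c| ≤ 2 * G) := by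
  set m := Nat.clog 2 L with hm
  have hL : L ≤ 2 ^ m := Nat.le_pow_clog (by norm_num) L
  have hL2 : 2 ^ m ≤ 2 * L := by
    by_cases h1 : L = 1
    · have : m = 0 := by rw [hm, h1]; simp
      rw [this, h1]; norm_num
    · have h2 := Nat.pow_pred_clog_lt_self (b := 2) (by norm_num) (show 1 < L by omega)
      have h3 : 0 < m := Nat.clog_pos (by norm_num) (by omega)
      rw [← hm] at h2
      have h4 : 2 ^ m = 2 ^ m.pred * 2 := by rw [← pow_succ]; congr 1; exact (Nat.succ_pred_eq_of_pos h3).symm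
      omega
  have hd := dd_pos m
  have hLr : (0 : ℝ) < L := by exact_mod_cast hL0
  by_cases hed : dd m ≤ e
  · refine ⟨0, ?_, fun _ => by simpa using hG0⟩
    have := far_est hF hed hL0 hL hL2 hG0 (hG m) a
    simp only [sub_zero]
    nlinarith [mul_nonneg hG0 hLr.le]
  · push Not at hed
    have hfar := far_est hF le_rfl hL0 hL hL2 hG0 (hG m) a
    have i1 := ck_mul_int hF he x
    have i2 := ck_mul_int hF hd x
    have hnear : ∀ k ∈ Finset.range L, |cn e F (a + k) x - (cn e F a x - cn (dd m) F a x) - cn (dd m) F (a + k) x| ≤ 250 * G := by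
      intro k hk
      have hk' := Finset.mem_range.1 hk
      have hkd : k * dd m ≤ 1 := by
        have h1 : (k : ℝ) ≤ 2 ^ m := by
          have : k ≤ 2 ^ m := by omega
          exact_mod_cast this
        rw [← dd_mul m]; gcongr
      have heq : cn e F (a + k) x - (cn e F a x - cn (dd m) F a x) - cn (dd m) F (a + k) x =
          ∫ t in T1, (Real.cos ((a + k : ℕ) * (t - x)) - Real.cos (a * (t - x))) * (ck e (t - x) - ck (dd m) (t - x)) * F t := by
        unfold cn
        rw [int4 (cos_mul_int i1 _ x) (cos_mul_int i1 _ x) (cos_mul_int i2 _ x) (cos_mul_int i2 _ x)]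
        congr 1; ext t
        ring
      rw [heq]
      have h1 : |∫ t in T1, (Real.cos ((a + k : ℕ) * (t - x)) - Real.cos (a * (t - x))) * (ck e (t - x) - ck (dd m) (t - x)) * F t| ≤
          ∫ t in T1, 2 * (pk (dd m) (t - x) * |F t|) := by
        apply abs_integral_le_integral_abs.trans
        apply integral_mono_of_nonneg (Eventually.of_forall fun t => abs_nonneg _)
          ((pk_mul_int hF.abs hd x).const_mul 2)
        refine Eventually.of_forall fun t => ?_
        dsimp only
        rw [abs_mul, abs_mul, ← mul_assoc]
        apply mul_le_mul_of_nonneg_right _ (abs_nonneg _)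
        have c1 := cos_sub_cos_le a k (t - x)
        have c2 := ck_sub_ck he hed.le (t - x)
        have c3 := pk_nonneg hd (t - x)
        calc _ ≤ 2 * k * |Real.sin ((t - x) / 2)| * |ck e (t - x) - ck (dd m) (t - x)| := by gcongr
          _ = 2 * k * (|Real.sin ((t - x) / 2)| * |ck e (t - x) - ck (dd m) (t - x)|) := by ring
          _ ≤ 2 * k * (dd m * pk (dd m) (t - x)) := by gcongr
          _ = 2 * (k * dd m) * pk (dd m) (t - x) := by ring
          _ ≤ 2 * 1 * pk (dd m) (t - x) := by gcongr
          _ = _ := by ring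
      refine h1.trans ?_
      rw [integral_const_mul]
      have h2 := pk_conv_le (F := fun t => |F t|) (fun t => abs_nonneg _) hF.abs m x
      have h3 : ∫ t in T1, pk (dd m) (t - x) * |F t| ≤ 125 * G := by
        apply le_of_sq_le_sq _ (by positivity)
        nlinarith [hG m]
      linarith
    refine ⟨cn e F a x - cn (dd m) F a x, ?_, ?_⟩
    · calc _ ≤ ∑ k ∈ Finset.range L, (250 * G + |cn (dd m) F (a + k) x|) := by
            refine Finset.sum_le_sum fun k hk => ?_
            have := hnear k hk
            have h2 := abs_add_le (cn e F (a + k) x - (cn e F a x - cn (dd m) F a x) - cn (dd m) F (a + k) x) (cn (dd m) F (a + k) x)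
            rw [sub_add_cancel] at h2
            linarith
        _ ≤ _ := by
            rw [Finset.sum_add_distrib, Finset.sum_const, Finset.card_range, nsmul_eq_mul]
            linarith
    · rintro rfl
      have h1 := hC e he
      have h2 := hC (dd m) hd
      have e1 : ∀ e, cn e F 0 x = conj1 e F x := by
        intro e; unfold cn conj1; simp
      rw [e1, e1]
      have := abs_sub (conj1 e F x) (conj1 (dd m) F x)
      linarith

lemma good_cn {F : ℝ → ℝ} (hF : IntegrableOn F T1) {e : ℝ} (he : 0 < e) {x G : ℝ} (hG0 : 0 ≤ G)
    (hG : ∀ m, Gam (fun t => |F t|) m x ≤ G ^ 2) (hC : ∀ e', 0 < e' → |conj1 e' F x| ≤ G) :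
    Good (fun j => cn e F (j + 1) x) (622 * G) := by
  refine ⟨fun a L hL => ?_, fun N => ?_⟩
  · obtain ⟨c, hc, _⟩ := osc_est hF he hG0 hG hC (a + 1) L hL
    have := osc_le_of_const (Finset.range L) (fun k => cn e F (a + k + 1) x) c (by simpa using hL)
    simp only [Finset.card_range] at this
    refine this.trans ?_
    simp only [show ∀ k, a + k + 1 = a + 1 + k by intro k; ring]
    have : 0 ≤ G * L := by positivity
    nlinarith
  · obtain ⟨c, hc, hc0⟩ := osc_est hF he hG0 hG hC 0 (N + 2) (by omega)
    have hc0 := hc0 rfl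
    have h1 : |∑ k ∈ Finset.range (N + 1), cn e F (k + 1) x| ≤ ∑ k ∈ Finset.range (N + 2), |cn e F (0 + k) x| := by
      rw [Finset.sum_range_succ' (fun k => |cn e F (0 + k) x|) (N + 1)]
      refine (Finset.abs_sum_le_sum_abs _ _).trans ?_
      simp only [zero_add]
      linarith [abs_nonneg (cn e F 0 x)]
    have h2 : ∑ k ∈ Finset.range (N + 2), |cn e F (0 + k) x| ≤ ∑ k ∈ Finset.range (N + 2), (|cn e F (0 + k) x - c| + 2 * G) := by
      refine Finset.sum_le_sum fun k _ => ?_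
      have h2 := abs_add_le (cn e F (0 + k) x - c) c
      rw [sub_add_cancel] at h2
      linarith
    rw [Finset.sum_add_distrib, Finset.sum_const, Finset.card_range, nsmul_eq_mul] at h2
    push_cast at h2 hc ⊢
    have : 0 ≤ G * N := by positivity
    nlinarith

end

noncomputable section

/-- scale parameter of a radius -/
def ee (r : ℝ) : ℝ := (1 - r) / (2 * Real.sqrt r)

lemma ee_pos {r : ℝ} (h0 : 0 < r) (h1 : r < 1) : 0 < ee r := by
  unfold ee
  have : 0 < Real.sqrt r := Real.sqrt_pos.2 h0
  apply div_pos <;> linarith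

lemma exists_ee {e : ℝ} (he : 0 < e) : ∃ r, 0 < r ∧ r < 1 ∧ ee r = e := by
  set s := Real.sqrt (1 + e ^ 2) with hs
  have hs2 : s ^ 2 = 1 + e ^ 2 := Real.sq_sqrt (by positivity)
  have hs0 : 0 ≤ s := Real.sqrt_nonneg _
  have hse : e < s := by nlinarith
  have hse1 : s < e + 1 := by nlinarith
  refine ⟨(s - e) ^ 2, by apply pow_pos; linarith, by nlinarith, ?_⟩
  unfold ee
  rw [Real.sqrt_sq (by linarith), div_eq_iff (by linarith)]
  nlinarith

lemma sq_ee {r : ℝ} (h0 : 0 < r) : ee r ^ 2 = (1 - r) ^ 2 / (4 * r) := by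
  unfold ee
  rw [div_pow, mul_pow, Real.sq_sqrt h0.le]; norm_num

lemma sqrt_ee {r : ℝ} (h0 : 0 < r) (h1 : r < 1) :
    Real.sqrt (1 + ee r ^ 2) * ee r = (1 - r ^ 2) / (4 * r) := by
  have h : 1 + ee r ^ 2 = ((1 + r) / (2 * Real.sqrt r)) ^ 2 := by
    rw [sq_ee h0, div_pow, mul_pow, Real.sq_sqrt h0.le]
    field_simp; ring
  have hs : 0 < Real.sqrt r := Real.sqrt_pos.2 h0
  rw [h, Real.sqrt_sq (by positivity)]
  unfold ee
  rw [div_mul_div_comm]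
  have : 2 * Real.sqrt r * (2 * Real.sqrt r) = 4 * r := by
    nlinarith [Real.mul_self_sqrt h0.le]
  rw [this]; ring

lemma kernel_eq {r : ℝ} (h0 : 0 < r) (h1 : r < 1) (x t : ℝ) :
    herglotzRieszKernel 0 (circleMap 0 r x) (circleMap 0 1 t) =
      ((Real.sqrt (1 + ee r ^ 2) * pk (ee r) (t - x) : ℝ) : ℂ) - (ck (ee r) (t - x) : ℝ) * Complex.I := by
  have he := ee_pos h0 h1
  set s := Real.sin ((t - x) / 2) with hs
  set c := Real.cos ((t - x) / 2) with hc
  have hsc : s ^ 2 + c ^ 2 = 1 := Real.sin_sq_add_cos_sq _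
  have hD : 0 < (1 - r) ^ 2 / (4 * r) + s ^ 2 := by
    have : 0 < (1 - r) ^ 2 := by apply pow_pos; linarith
    positivity
  have hp : Real.sqrt (1 + ee r ^ 2) * pk (ee r) (t - x) = (1 - r ^ 2) / ((1 - r) ^ 2 + 4 * r * s ^ 2) := by
    unfold pk
    rw [← mul_div_assoc, sqrt_ee h0 h1, sq_ee h0, ← hs]
    field_simp
  have hk : ck (ee r) (t - x) = 4 * r * s * c / ((1 - r) ^ 2 + 4 * r * s ^ 2) := by
    unfold ck
    rw [sq_ee h0, ← hs, ← hc]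
    field_simp
  have hD2 : 0 < (1 - r) ^ 2 + 4 * r * s ^ 2 := by
    have : 0 < (1 - r) ^ 2 := by apply pow_pos; linarith
    positivity
  rw [hp, hk]
  have hz : circleMap 0 r x = r * circleMap 0 1 t * Complex.exp (-((t - x : ℝ) : ℂ) * Complex.I) := by
    simp only [circleMap, zero_add]
    push_cast
    rw [one_mul, mul_assoc, ← Complex.exp_add]; congr 2; ring
  have hexp : Complex.exp (-((t - x : ℝ) : ℂ) * Complex.I) = ((c ^ 2 - s ^ 2 : ℝ) : ℂ) - ((2 * s * c : ℝ) : ℂ) * Complex.I := by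
    rw [show (-((t - x : ℝ) : ℂ)) = ((-(t - x) : ℝ) : ℂ) by push_cast; ring, Complex.exp_mul_I,
      ← Complex.ofReal_cos, ← Complex.ofReal_sin, Real.cos_neg, Real.sin_neg]
    have e1 : Real.cos (t - x) = c ^ 2 - s ^ 2 := by
      rw [hs, hc, ← Real.cos_two_mul']; congr 1; ring
    have e2 : Real.sin (t - x) = 2 * s * c := by
      rw [hs, hc, ← Real.sin_two_mul]; congr 1; ring
    rw [e1, e2]; push_cast; ring
  have hne : circleMap 0 1 t ≠ 0 := by
    simp [circleMap]
  rw [herglotzRieszKernel_def, hz, hexp]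
  simp only [sub_zero]
  set W : ℂ := ((c ^ 2 - s ^ 2 : ℝ) : ℂ) - ((2 * s * c : ℝ) : ℂ) * Complex.I with hW
  have hnum : (circleMap 0 1 t + r * circleMap 0 1 t * W) / (circleMap 0 1 t - r * circleMap 0 1 t * W) =
      (1 + r * W) / (1 - r * W) := by
    rw [show circleMap 0 1 t + r * circleMap 0 1 t * W = circleMap 0 1 t * (1 + r * W) by ring,
      show circleMap 0 1 t - r * circleMap 0 1 t * W = circleMap 0 1 t * (1 - r * W) by ring,
      mul_div_mul_left _ _ hne]
  rw [hnum]
  have hN : Complex.normSq (1 - r * W) = (1 - r) ^ 2 + 4 * r * s ^ 2 := by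
    have hc2 : c ^ 2 = 1 - s ^ 2 := by linarith
    obtain ⟨P, hP⟩ : ∃ P, P = c ^ 2 - s ^ 2 := ⟨_, rfl⟩
    obtain ⟨Q, hQ⟩ : ∃ Q, Q = 2 * s * c := ⟨_, rfl⟩
    rw [hW, ← hP, ← hQ, Complex.normSq_apply]
    simp
    have hPQ : P ^ 2 + Q ^ 2 = 1 := by
      rw [hP, hQ, mul_pow, mul_pow, hc2]; ring
    have hP' : P = 1 - 2 * s ^ 2 := by rw [hP, hc2]; ring
    linear_combination r ^ 2 * hPQ - 2 * r * hP'
  have hden : (1 : ℂ) - r * W ≠ 0 := by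
    intro h
    rw [h, map_zero] at hN
    linarith
  rw [div_eq_iff hden]
  have hDc : (((1 - r) ^ 2 + 4 * r * s ^ 2 : ℝ) : ℂ) ≠ 0 := by exact_mod_cast hD2.ne'
  have hc2 : (c : ℂ) ^ 2 = 1 - (s : ℂ) ^ 2 := by
    have : c ^ 2 = 1 - s ^ 2 := by linarith
    exact_mod_cast this
  have hcast : (((1 - r ^ 2) / ((1 - r) ^ 2 + 4 * r * s ^ 2) : ℝ) : ℂ) -
      ((4 * r * s * c / ((1 - r) ^ 2 + 4 * r * s ^ 2) : ℝ) : ℂ) * Complex.I =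
      ((1 - r ^ 2) - 4 * r * s * c * Complex.I) / (((1 - r) ^ 2 + 4 * r * s ^ 2 : ℝ) : ℂ) := by
    rw [Complex.ofReal_div, Complex.ofReal_div]
    push_cast
    field_simp
  rw [hcast, div_mul_eq_mul_div, eq_div_iff hDc, hW]
  push_cast
  have hI := Complex.I_sq
  linear_combination (8 * (r:ℂ) ^ 2 * s ^ 2 * c ^ 2) * hI + (2 * (r:ℂ) - 2 * (r:ℂ) ^ 2 - 4 * (r:ℂ) ^ 2 * s ^ 2 - 4 * (r:ℂ) ^ 2 * c * s * Complex.I) * hc2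

end

noncomputable section

lemma circleAverage_T1 {E : Type*} [NormedAddCommGroup E] [NormedSpace ℝ E] (h : ℂ → E) (R : ℝ) :
    Real.circleAverage h 0 R = (2 * Real.pi)⁻¹ • ∫ t in T1, h (circleMap 0 R t) := by
  rw [Real.circleAverage_def, int_T1_eq]
  have t₀ : (fun θ ↦ h (circleMap 0 R θ)).Periodic (2 * Real.pi) :=
    fun x ↦ by simp [periodic_circleMap 0 R x]
  have := t₀.intervalIntegral_add_eq 0 (-Real.pi)
  rw [zero_add] at this
  rw [this]

lemma arg_circle : ∀ᵐ t ∂(volume.restrict T1), Complex.arg (circleMap 0 1 t) = t := by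
  have h1 : ∀ᵐ t : ℝ ∂(volume.restrict T1), t ≠ -Real.pi := by
    refine ae_restrict_of_ae ?_
    rw [ae_iff]; simp
  filter_upwards [h1, ae_restrict_mem T1_meas] with t h h2
  have : circleMap 0 1 t = Complex.cos t + Complex.sin t * Complex.I := by
    simp [circleMap, Complex.exp_mul_I]
  rw [this]
  exact Complex.arg_cos_add_sin_mul_I ⟨lt_of_le_of_ne h2.1 (Ne.symm h), h2.2.le⟩

lemma circle_int {F : ℝ → ℝ} (hF : IntegrableOn F T1) :
    CircleIntegrable (fun ζ => (F (Complex.arg ζ) : ℂ)) 0 1 := by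
  have t₀ : (fun θ ↦ (F (Complex.arg (circleMap 0 1 θ)) : ℂ)).Periodic (2 * Real.pi) :=
    fun x ↦ by simp [periodic_circleMap 0 1 x]
  have h : IntegrableOn (fun θ ↦ (F (Complex.arg (circleMap 0 1 θ)) : ℂ)) T1 := by
    refine (Integrable.congr hF.ofReal ?_ )
    filter_upwards [arg_circle] with t ht
    rw [ht]; rfl
  refine t₀.intervalIntegrable (t := -Real.pi) two_pi_pos.ne' ?_ 0 (2 * Real.pi)
  rw [intervalIntegrable_iff_integrableOn_Ioc_of_le (by linarith [Real.pi_pos])]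
  unfold IntegrableOn at h ⊢
  rwa [← restrict_T1]

/-- analytic completion of the Poisson integral -/
def Gh (F : ℝ → ℝ) (w : ℂ) : ℂ :=
  Real.circleAverage (fun ζ => herglotzRieszKernel 0 w ζ • (F (Complex.arg ζ) : ℂ)) 0 1

lemma Gh_diff {F : ℝ → ℝ} (hF : IntegrableOn F T1) : DifferentiableOn ℂ (Gh F) (Metric.ball 0 1) :=
  differentiableOn_circleAverage_herglotzRieszKernel_smul (circle_int hF)

/-- normalized Poisson kernel -/
def wk (r x t : ℝ) : ℝ := (2 * Real.pi)⁻¹ * (Real.sqrt (1 + ee r ^ 2) * pk (ee r) (t - x))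

lemma wk_nonneg {r : ℝ} (h0 : 0 < r) (h1 : r < 1) (x t : ℝ) : 0 ≤ wk r x t := by
  unfold wk
  have := pk_nonneg (ee_pos h0 h1) (t - x)
  have := Real.pi_pos
  positivity

lemma wk_int {F : ℝ → ℝ} (hF : IntegrableOn F T1) {r : ℝ} (h0 : 0 < r) (h1 : r < 1) (x : ℝ) :
    IntegrableOn (fun t => wk r x t * F t) T1 := by
  have := (pk_mul_int hF (ee_pos h0 h1) x).const_mul ((2 * Real.pi)⁻¹ * Real.sqrt (1 + ee r ^ 2))
  refine this.congr (Eventually.of_forall fun t => ?_)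
  simp only [wk]; ring

lemma poisson {f : ℂ → ℂ} (hf : DiffContOnCl ℂ f (Metric.ball 0 1)) {r : ℝ} (h0 : 0 < r) (h1 : r < 1) (x : ℝ) :
    ∫ t in T1, wk r x t • f (circleMap 0 1 t) = f (circleMap 0 r x) := by
  have hw : circleMap 0 r x ∈ Metric.ball (0 : ℂ) 1 := by
    simp [abs_of_pos h0, h1]
  rw [← hf.circleAverage_re_herglotzRieszKernel_smul hw, circleAverage_T1, ← integral_smul]
  refine integral_congr_ae (Eventually.of_forall fun t => ?_)
  simp only [Pi.smul_apply', Function.comp_apply, kernel_eq h0 h1, wk]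
  rw [smul_smul]; simp

lemma wk_one {r : ℝ} (h0 : 0 < r) (h1 : r < 1) (x : ℝ) : ∫ t in T1, wk r x t = 1 := by
  have := poisson (f := fun _ => 1) diffContOnCl_const h0 h1 x
  have h2 : ∫ t in T1, wk r x t • (1 : ℂ) = ((∫ t in T1, wk r x t : ℝ) : ℂ) := by
    rw [← integral_complex_ofReal]; simp
  rw [h2] at this
  exact_mod_cast this

lemma Gh_eq {F : ℝ → ℝ} (hF : IntegrableOn F T1) {r : ℝ} (h0 : 0 < r) (h1 : r < 1) (x : ℝ) :
    Gh F (circleMap 0 r x) = ((∫ t in T1, wk r x t * F t : ℝ) : ℂ) -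
      (((2 * Real.pi)⁻¹ * conj1 (ee r) F x : ℝ) : ℂ) * Complex.I := by
  unfold Gh conj1
  rw [circleAverage_T1, ← integral_const_mul, ← integral_complex_ofReal, ← integral_complex_ofReal,
    ← integral_mul_const, ← integral_sub, ← integral_smul]
  · refine integral_congr_ae ?_
    filter_upwards [arg_circle] with t ht
    rw [ht, kernel_eq h0 h1, Complex.real_smul]
    simp only [wk, smul_eq_mul]
    push_cast; ring
  · exact (wk_int hF h0 h1 x).ofReal
  · exact (((ck_mul_int hF (ee_pos h0 h1) x).const_mul _).ofReal).mul_const _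

lemma Gh_zero (F : ℝ → ℝ) : Gh F 0 = (((2 * Real.pi)⁻¹ * ∫ t in T1, F t : ℝ) : ℂ) := by
  unfold Gh
  rw [circleAverage_T1, Complex.ofReal_mul, ← integral_complex_ofReal, Complex.real_smul]
  congr 1
  refine integral_congr_ae ?_
  filter_upwards [arg_circle] with t ht
  rw [ht, herglotzRieszKernel_def]
  simp

lemma Gh_re {F : ℝ → ℝ} (hF : IntegrableOn F T1) {r : ℝ} (h0 : 0 < r) (h1 : r < 1) (x : ℝ) :
    (Gh F (circleMap 0 r x)).re = ∫ t in T1, wk r x t * F t := by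
  rw [Gh_eq hF h0 h1]; simp

lemma Gh_im {F : ℝ → ℝ} (hF : IntegrableOn F T1) {r : ℝ} (h0 : 0 < r) (h1 : r < 1) (x : ℝ) :
    (Gh F (circleMap 0 r x)).im = - ((2 * Real.pi)⁻¹ * conj1 (ee r) F x) := by
  rw [Gh_eq hF h0 h1]
  simp only [Complex.sub_im, Complex.ofReal_im, Complex.mul_im, Complex.I_im, Complex.I_re, Complex.ofReal_re]
  ring

lemma wk_intOn {r : ℝ} (h0 : 0 < r) (h1 : r < 1) (x : ℝ) : IntegrableOn (fun t => wk r x t) T1 := by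
  have := wk_int (F := fun _ => 1) (integrable_const _) h0 h1 x
  simpa using this

lemma Gh_re_ge {F : ℝ → ℝ} (hF : IntegrableOn F T1) {c : ℝ} (hc : ∀ t, c ≤ F t) {w : ℂ} (hw : w ∈ Metric.ball (0 : ℂ) 1) :
    c ≤ (Gh F w).re := by
  by_cases h : w = 0
  · rw [h, Gh_zero, Complex.ofReal_re]
    have : ∫ t in T1, c ≤ ∫ t in T1, F t := integral_mono (integrable_const _) hF hc
    have hv : (volume.real T1) = 2 * Real.pi := by
      rw [Measure.real, vol_T1, ENNReal.toReal_ofReal two_pi_pos.le]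
    rw [setIntegral_const, hv, smul_eq_mul] at this
    have hp := two_pi_pos
    rw [inv_mul_eq_div, le_div_iff₀ hp]; linarith
  · have h0 : 0 < ‖w‖ := norm_pos_iff.2 h
    have h1 : ‖w‖ < 1 := by simpa using hw
    have : w = circleMap 0 ‖w‖ (Complex.arg w) := by
      simp [circleMap]
    rw [this, Gh_re hF h0 h1]
    calc c = ∫ t in T1, wk ‖w‖ w.arg t * c := by rw [integral_mul_const, wk_one h0 h1, one_mul]
      _ ≤ _ := integral_mono ((wk_intOn h0 h1 _).mul_const _) (wk_int hF h0 h1 _) fun t =>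
          mul_le_mul_of_nonneg_left (hc t) (wk_nonneg h0 h1 _ _)

/-- mean value property, real part -/
lemma mean_re {f : ℂ → ℂ} {R : ℝ} (hR : 0 < R) (hf : DiffContOnCl ℂ f (Metric.ball 0 R)) :
    ∫ t in T1, (f (circleMap 0 R t)).re = 2 * Real.pi * (f 0).re := by
  have h := DiffContOnCl.circleAverage (R := R) (by rwa [abs_of_pos hR])
  rw [circleAverage_T1] at h
  have hc : Continuous fun t => f (circleMap 0 R t) := by
    refine hf.2.comp_continuous (by fun_prop) fun t => ?_
    rw [closure_ball _ hR.ne']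
    exact circleMap_mem_closedBall 0 hR.le t
  have hi : IntegrableOn (fun t => f (circleMap 0 R t)) T1 :=
    (hc.integrableOn_Icc (a := -Real.pi) (b := Real.pi)).mono_set Ico_subset_Icc_self
  have h2 : ∫ t in T1, (f (circleMap 0 R t)).re = (∫ t in T1, f (circleMap 0 R t)).re := by
    have := Complex.reCLM.integral_comp_comm hi
    simpa using this
  rw [h2, ← h, Complex.smul_re, smul_eq_mul]
  have := two_pi_pos
  field_simp

end

noncomputable section

lemma zyg_pt {z : ℂ} (hz : 1 ≤ z.re) :
    |z.im| ≤ 4 * z.re + 2 * (z.re * Real.log z.re) - 2 * (z * Complex.log z).re := by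
  have hpi := Real.pi_gt_three
  have hpi4 := Real.pi_lt_four
  have hre : (z * Complex.log z).re = z.re * Real.log ‖z‖ - z.im * z.arg := by
    simp [Complex.mul_re, Complex.log_re, Complex.log_im]
  have ha : 0 < z.re := by linarith
  have hn : ‖z‖ ≤ z.re + |z.im| := by
    have := Complex.norm_le_abs_re_add_abs_im z
    rwa [abs_of_pos ha] at this
  have hn0 : 0 < ‖z‖ := by
    rw [norm_pos_iff]; intro h; rw [h] at ha; simp at ha
  -- log estimate
  have hlog : z.re * Real.log ‖z‖ ≤ z.re * Real.log z.re + |z.im| / 4 + z.re := by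
    have h1 : Real.log (‖z‖ / (4 * z.re)) ≤ ‖z‖ / (4 * z.re) - 1 :=
      Real.log_le_sub_one_of_pos (by positivity)
    rw [Real.log_div hn0.ne' (by positivity), Real.log_mul (by norm_num) ha.ne'] at h1
    have h4 : Real.log 4 ≤ 3 / 2 := by
      rw [show (4 : ℝ) = 2 ^ 2 by norm_num, Real.log_pow]
      have := Real.log_two_lt_d9
      norm_num; linarith
    have h5 : ‖z‖ / (4 * z.re) * z.re ≤ (z.re + |z.im|) / 4 := by
      rw [show ‖z‖ / (4 * z.re) * z.re = ‖z‖ / 4 by field_simp]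
      linarith
    nlinarith
  -- arg estimate
  have hs : 0 ≤ z.im * z.arg := by
    rcases le_total 0 z.im with h | h
    · exact mul_nonneg h (Complex.arg_nonneg_iff.2 h)
    · rcases h.eq_or_lt with h | h
      · rw [h]; simp
      · exact mul_nonneg_of_nonpos_of_nonpos h.le (Complex.arg_neg_iff.2 h).le
  have harg : Real.pi * |z.im| ≤ Real.pi * z.re + 4 * (z.im * z.arg) := by
    by_cases h : |z.im| ≤ z.re
    · nlinarith
    · push Not at h
      have h1 : Real.pi / 4 ≤ |z.arg| := by
        by_contra hc
        push Not at hc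
        have hc' := abs_lt.1 hc
        have ht : Real.tan z.arg = z.im / z.re := Complex.tan_arg z
        have h2 : |Real.tan z.arg| < 1 := by
          rw [abs_lt]
          constructor
          · have := Real.tan_lt_tan_of_lt_of_lt_pi_div_two (x := -(Real.pi/4)) (y := z.arg) (by linarith) (by linarith) hc'.1
            rwa [Real.tan_neg, Real.tan_pi_div_four] at this
          · have := Real.tan_lt_tan_of_lt_of_lt_pi_div_two (x := z.arg) (y := Real.pi/4) (by linarith) (by linarith) hc'.2
            rwa [Real.tan_pi_div_four] at this
        rw [ht, abs_div, abs_of_pos ha, div_lt_one ha] at h2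
        linarith
      have h3 : z.im * z.arg = |z.im| * |z.arg| := by rw [← abs_mul, abs_of_nonneg hs]
      rw [h3]
      nlinarith [abs_nonneg z.im]
  have hl1 : 0 ≤ z.re * Real.log z.re := mul_nonneg ha.le (Real.log_nonneg hz)
  have hb := abs_nonneg z.im
  rw [hre]
  have hb2 : 2 * |z.im| ≤ (Real.pi - 1) * |z.im| := by nlinarith
  have ha2 : Real.pi * z.re ≤ 4 * z.re := by nlinarith
  nlinarith

lemma jensen {H : ℝ → ℝ} (hH : IntegrableOn H T1) (h1 : ∀ t, 1 ≤ H t)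
    (hL : IntegrableOn (fun t => H t * Real.log (H t)) T1) {r : ℝ} (hr0 : 0 < r) (hr1 : r < 1) (x : ℝ) :
    (∫ t in T1, wk r x t * H t) * Real.log (∫ t in T1, wk r x t * H t) ≤
      ∫ t in T1, wk r x t * (H t * Real.log (H t)) := by
  set a := ∫ t in T1, wk r x t * H t with ha
  have hw := wk_one hr0 hr1 x
  have ha1 : 1 ≤ a := by
    rw [ha, ← hw]
    refine integral_mono (wk_intOn hr0 hr1 x) (wk_int hH hr0 hr1 x) fun t => ?_
    have := mul_le_mul_of_nonneg_left (h1 t) (wk_nonneg hr0 hr1 x t)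
    simpa using this
  have hlow : IntegrableOn (fun t => (1 + Real.log a) * (wk r x t * H t) - a * wk r x t) T1 :=
    ((wk_int hH hr0 hr1 x).const_mul _).sub ((wk_intOn hr0 hr1 x).const_mul _)
  have := integral_mono hlow (wk_int hL hr0 hr1 x) (fun t => ?_)
  · rw [integral_sub ((wk_int hH hr0 hr1 x).const_mul _) ((wk_intOn hr0 hr1 x).const_mul _),
      integral_const_mul, integral_const_mul, hw, ← ha] at this
    linarith
  · have hs : 0 < H t := by linarith [h1 t]
    have h2 : Real.log (a / H t) ≤ a / H t - 1 := Real.log_le_sub_one_of_pos (by positivity)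
    rw [Real.log_div (by linarith) hs.ne'] at h2
    have h3 : H t * (Real.log a - Real.log (H t)) ≤ a - H t := by
      have := mul_le_mul_of_nonneg_left h2 hs.le
      rwa [show H t * (a / H t - 1) = a - H t by field_simp] at this
    have h4 := mul_le_mul_of_nonneg_left (show (1 + Real.log a) * H t - a ≤ H t * Real.log (H t) by linarith) (wk_nonneg hr0 hr1 x t)
    simp only
    linarith

lemma conj1_cont {F : ℝ → ℝ} (hF : IntegrableOn F T1) {e : ℝ} (he : 0 < e) : Continuous (conj1 e F) := by
  obtain ⟨r, h0, h1, rfl⟩ := exists_ee he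
  have hc : Continuous fun x => Gh F (circleMap 0 r x) := by
    refine (Gh_diff hF).continuousOn.comp_continuous (by fun_prop) fun t => ?_
    simp [abs_of_pos h0, h1]
  have : conj1 (ee r) F = fun x => - (2 * Real.pi) * (Gh F (circleMap 0 r x)).im := by
    funext x
    rw [Gh_im hF h0 h1]
    have := two_pi_pos
    field_simp
  rw [this]
  exact continuous_const.mul (Complex.continuous_im.comp hc)

lemma cont_intOn {g : ℝ → ℝ} (hg : Continuous g) : IntegrableOn g T1 :=
  (hg.integrableOn_Icc (a := -Real.pi) (b := Real.pi)).mono_set Ico_subset_Icc_self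

lemma zyg1 {H : ℝ → ℝ} (hH : IntegrableOn H T1) (h1 : ∀ t, 1 ≤ H t)
    (hL : IntegrableOn (fun t => H t * Real.log (H t)) T1) {e : ℝ} (he : 0 < e) :
    ∫ x in T1, |conj1 e H x| ≤ 2 * Real.pi * (4 * (∫ t in T1, H t) + 2 * ∫ t in T1, H t * Real.log (H t)) := by
  obtain ⟨r, hr0, hr1, rfl⟩ := exists_ee he
  set K : ℂ → ℂ := fun w => 4 * Gh H w + 2 * Gh (fun t => H t * Real.log (H t)) w - 2 * (Gh H w * Complex.log (Gh H w)) with hK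
  have hge : ∀ w ∈ Metric.ball (0 : ℂ) 1, 1 ≤ (Gh H w).re := fun w hw => Gh_re_ge hH h1 hw
  have hd : DifferentiableOn ℂ K (Metric.ball 0 1) := by
    have hlog : DifferentiableOn ℂ (fun w => Complex.log (Gh H w)) (Metric.ball 0 1) := by
      refine (Gh_diff hH).clog fun w hw => ?_
      left; linarith [hge w hw]
    exact (((Gh_diff hH).const_mul _).add ((Gh_diff hL).const_mul _)).sub (((Gh_diff hH).mul hlog).const_mul _)
  have hdc : DiffContOnCl ℂ K (Metric.ball 0 r) :=
    hd.diffContOnCl_ball (Metric.closedBall_subset_ball hr1)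
  have hmean := mean_re hr0 hdc
  have hball : ∀ x, circleMap 0 r x ∈ Metric.ball (0 : ℂ) 1 := fun x => by simp [abs_of_pos hr0, hr1]
  have hpt : ∀ x, |conj1 (ee r) H x| ≤ 2 * Real.pi * (K (circleMap 0 r x)).re := by
    intro x
    have h2 := zyg_pt (hge _ (hball x))
    rw [Gh_im hH hr0 hr1, abs_neg, abs_mul, abs_of_pos (by have := two_pi_pos; positivity)] at h2
    have hj := jensen hH h1 hL hr0 hr1 x
    rw [← Gh_re hH hr0 hr1, ← Gh_re hL hr0 hr1] at hj
    have hKre : (K (circleMap 0 r x)).re = 4 * (Gh H (circleMap 0 r x)).re +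
        2 * (Gh (fun t => H t * Real.log (H t)) (circleMap 0 r x)).re -
        2 * (Gh H (circleMap 0 r x) * Complex.log (Gh H (circleMap 0 r x))).re := by
      simp only [hK, Complex.sub_re, Complex.add_re]
      congr 1
      · congr 1
        · simp [Complex.mul_re]
        · simp [Complex.mul_re]
      · rw [Complex.mul_re]; simp
    have h3 : (2 * Real.pi)⁻¹ * |conj1 (ee r) H x| ≤ (K (circleMap 0 r x)).re := by
      rw [hKre]; linarith
    rwa [inv_mul_le_iff₀ two_pi_pos] at h3
  have hKc : Continuous fun x => (K (circleMap 0 r x)).re :=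
    Complex.continuous_re.comp (hd.continuousOn.comp_continuous (by fun_prop) hball)
  calc ∫ x in T1, |conj1 (ee r) H x| ≤ ∫ x in T1, 2 * Real.pi * (K (circleMap 0 r x)).re :=
        integral_mono (cont_intOn (conj1_cont hH he).abs) ((cont_intOn hKc).const_mul _) hpt
    _ = 2 * Real.pi * (2 * Real.pi * (K 0).re) := by rw [integral_const_mul, hmean]
    _ ≤ _ := by
        have h0 := hge 0 (by simp)
        rw [Gh_zero, Complex.ofReal_re] at h0
        have hK0 : (K 0).re = 4 * ((2 * Real.pi)⁻¹ * ∫ t in T1, H t) + 2 * ((2 * Real.pi)⁻¹ * ∫ t in T1, H t * Real.log (H t)) -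
          2 * (((2 * Real.pi)⁻¹ * ∫ t in T1, H t) * Real.log ((2 * Real.pi)⁻¹ * ∫ t in T1, H t)) := by
          simp only [hK, Gh_zero]
          rw [← Complex.ofReal_log (by linarith)]
          norm_cast
        have hl : 0 ≤ ((2 * Real.pi)⁻¹ * ∫ t in T1, H t) * Real.log ((2 * Real.pi)⁻¹ * ∫ t in T1, H t) :=
          mul_nonneg (by linarith) (Real.log_nonneg h0)
        have hp := two_pi_pos
        have : (K 0).re ≤ (2 * Real.pi)⁻¹ * (4 * (∫ t in T1, H t) + 2 * ∫ t in T1, H t * Real.log (H t)) := by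
          rw [hK0]; linarith
        refine mul_le_mul_of_nonneg_left ?_ hp.le
        rwa [le_inv_mul_iff₀ hp] at this


lemma logPlus_nonneg (s : ℝ) : 0 ≤ logPlus s := by
  unfold logPlus; split_ifs with h
  · exact Real.log_nonneg h.le
  · exact le_rfl

lemma le_logPlus {s : ℝ} (hs : 0 ≤ s) : s ≤ 3 + s * logPlus s := by
  by_cases h : s ≤ 3
  · have := mul_nonneg hs (logPlus_nonneg s); linarith
  · push Not at h
    have h1 : (1 : ℝ) ≤ Real.log s := by
      rw [Real.le_log_iff_exp_le (by linarith)]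
      linarith [Real.exp_one_lt_d9]
    have : logPlus s = Real.log s := by unfold logPlus; rw [if_pos (by linarith)]
    rw [this]; nlinarith

lemma logPlus_mono {s t : ℝ} (h : s ≤ t) : logPlus s ≤ logPlus t := by
  by_cases h1 : 1 < s
  · unfold logPlus
    rw [if_pos h1, if_pos (by linarith)]
    exact Real.log_le_log (by linarith) h
  · have : logPlus s = 0 := by unfold logPlus; rw [if_neg h1]
    rw [this]; exact logPlus_nonneg t

lemma succ_log {s : ℝ} (hs : 0 ≤ s) : (s + 1) * Real.log (s + 1) ≤ 5 + 4 * (s * logPlus s) := by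
  have h2 := Real.log_two_lt_d9
  have hl2 : 0 < Real.log 2 := Real.log_pos (by norm_num)
  have hle := le_logPlus hs
  have hn := mul_nonneg hs (logPlus_nonneg s)
  by_cases h : s ≤ 1
  · have h1 : Real.log (s + 1) ≤ Real.log 2 := Real.log_le_log (by linarith) (by linarith)
    have h0 : 0 ≤ Real.log (s + 1) := Real.log_nonneg (by linarith)
    nlinarith
  · push Not at h
    have h1 : Real.log (s + 1) ≤ Real.log (2 * s) := Real.log_le_log (by linarith) (by linarith)
    rw [Real.log_mul (by norm_num) (by linarith)] at h1
    have : logPlus s = Real.log s := by unfold logPlus; rw [if_pos h]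
    rw [this] at hle hn ⊢
    have h0 : 0 ≤ Real.log (s + 1) := Real.log_nonneg (by linarith)
    have h3 : (s + 1) * Real.log (s + 1) ≤ (2 * s) * (Real.log 2 + Real.log s) := by
      apply mul_le_mul (by linarith) h1 h0 (by linarith)
    nlinarith

lemma logPlus_meas : Measurable logPlus := by
  unfold logPlus
  exact Measurable.ite measurableSet_Ioi Real.measurable_log measurable_const

lemma conj1_sub {F G : ℝ → ℝ} (hF : IntegrableOn F T1) (hG : IntegrableOn G T1) {e : ℝ} (he : 0 < e) (x : ℝ) :
    conj1 e (fun t => F t - G t) x = conj1 e F x - conj1 e G x := by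
  unfold conj1
  rw [← integral_sub (ck_mul_int hF he x) (ck_mul_int hG he x)]
  simp only [mul_sub]

lemma zyg_half {s : ℝ → ℝ} (hm : Measurable s) (h0 : ∀ t, 0 ≤ s t)
    (hL : IntegrableOn (fun t => s t * logPlus (s t)) T1) {e : ℝ} (he : 0 < e) :
    IntegrableOn s T1 ∧
    ∫ x in T1, |conj1 e (fun t => s t + 1) x| ≤ 2 * Real.pi * (2 * Real.pi * 26 + 12 * ∫ t in T1, s t * logPlus (s t)) := by
  have hs : IntegrableOn s T1 := by
    refine Integrable.mono' ((integrable_const (3 : ℝ)).add hL) hm.aestronglyMeasurable (Eventually.of_forall fun t => ?_)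
    rw [Real.norm_eq_abs, abs_of_nonneg (h0 t)]
    exact le_logPlus (h0 t)
  refine ⟨hs, ?_⟩
  have h1 : IntegrableOn (fun t => s t + 1) T1 := hs.add (integrable_const _)
  have hLi : IntegrableOn (fun t => 4 * (s t * logPlus (s t))) T1 := hL.const_mul _
  have hub : IntegrableOn (fun t => 5 + 4 * (s t * logPlus (s t))) T1 := (integrable_const _).add hLi
  have h2 : IntegrableOn (fun t => (s t + 1) * Real.log (s t + 1)) T1 := by
    refine Integrable.mono' hub ?_ (Eventually.of_forall fun t => ?_)
    · exact ((hm.add_const 1).mul (Real.measurable_log.comp (hm.add_const 1))).aestronglyMeasurable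
    · rw [Real.norm_eq_abs, abs_of_nonneg]
      · exact succ_log (h0 t)
      · exact mul_nonneg (by linarith [h0 t]) (Real.log_nonneg (by linarith [h0 t]))
  have hz := zyg1 h1 (fun t => by linarith [h0 t]) h2 he
  refine hz.trans (mul_le_mul_of_nonneg_left ?_ two_pi_pos.le)
  rw [← integral_const_mul, ← integral_const_mul, ← integral_add (h1.const_mul _) (h2.const_mul _)]
  have hv : (volume.real T1) = 2 * Real.pi := by
    rw [Measure.real, vol_T1, ENNReal.toReal_ofReal two_pi_pos.le]
  have hc : 2 * Real.pi * 26 + 12 * ∫ t in T1, s t * logPlus (s t) = ∫ t in T1, (26 + 12 * (s t * logPlus (s t))) := by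
    rw [integral_add (integrable_const _) (hL.const_mul _), setIntegral_const, hv, integral_const_mul, smul_eq_mul]
  rw [hc]
  refine integral_mono ((h1.const_mul _).add (h2.const_mul _)) ((integrable_const _).add (hL.const_mul _)) fun t => ?_
  have := succ_log (h0 t)
  have := le_logPlus (h0 t)
  simp only [Pi.add_apply]
  linarith

lemma zyg {F : ℝ → ℝ} (hm : Measurable F) (hL : IntegrableOn (fun t => |F t| * logPlus |F t|) T1) {e : ℝ} (he : 0 < e) :
    ∫ x in T1, |conj1 e F x| ≤ 2100 * (1 + ∫ t in T1, |F t| * logPlus |F t|) := by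
  have key : ∀ s : ℝ → ℝ, Measurable s → (∀ t, 0 ≤ s t) → (∀ t, s t ≤ |F t|) →
      IntegrableOn (fun t => s t * logPlus (s t)) T1 ∧ ∫ t in T1, s t * logPlus (s t) ≤ ∫ t in T1, |F t| * logPlus |F t| := by
    intro s hs h0 hsF
    have hle : ∀ t, s t * logPlus (s t) ≤ |F t| * logPlus |F t| := fun t =>
      mul_le_mul (hsF t) (logPlus_mono (hsF t)) (logPlus_nonneg _) (abs_nonneg _)
    have hi : IntegrableOn (fun t => s t * logPlus (s t)) T1 := by
      refine Integrable.mono' hL (hs.mul (logPlus_meas.comp hs)).aestronglyMeasurable (Eventually.of_forall fun t => ?_)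
      rw [Real.norm_eq_abs, abs_of_nonneg (mul_nonneg (h0 t) (logPlus_nonneg _))]
      exact hle t
    exact ⟨hi, integral_mono hi hL hle⟩
  have hpm : Measurable fun t => max (F t) 0 := hm.max measurable_const
  have hnm : Measurable fun t => max (-F t) 0 := hm.neg.max measurable_const
  obtain ⟨p1, p2⟩ := key _ hpm (fun t => le_max_right _ _) (fun t => max_le (le_abs_self _) (abs_nonneg _))
  obtain ⟨n1, n2⟩ := key _ hnm (fun t => le_max_right _ _) (fun t => max_le (neg_le_abs _) (abs_nonneg _))
  obtain ⟨p3, p4⟩ := zyg_half hpm (fun t => le_max_right _ _) p1 he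
  obtain ⟨n3, n4⟩ := zyg_half hnm (fun t => le_max_right _ _) n1 he
  have p5 : IntegrableOn (fun t => max (F t) 0 + 1) T1 := p3.add (integrable_const _)
  have n5 : IntegrableOn (fun t => max (-F t) 0 + 1) T1 := n3.add (integrable_const _)
  have hF : F = fun t => (max (F t) 0 + 1) - (max (-F t) 0 + 1) := by
    funext t
    rcases le_total 0 (F t) with h | h
    · rw [max_eq_left h, max_eq_right (by linarith)]; ring
    · rw [max_eq_right h, max_eq_left (by linarith)]; ring
  have hpt : ∀ x, |conj1 e F x| ≤ |conj1 e (fun t => max (F t) 0 + 1) x| + |conj1 e (fun t => max (-F t) 0 + 1) x| := by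
    intro x
    conv_lhs => rw [hF]
    rw [conj1_sub p5 n5 he]
    exact abs_sub _ _
  have hFi : IntegrableOn F T1 := by rw [hF]; exact p5.sub n5
  have i1 := cont_intOn (conj1_cont p5 he).abs
  have i2 := cont_intOn (conj1_cont n5 he).abs
  have h := integral_mono (cont_intOn (conj1_cont hFi he).abs) (i1.add i2) hpt
  simp only [Pi.add_apply] at h
  rw [integral_add i1 i2] at h
  have hI : 0 ≤ ∫ t in T1, |F t| * logPlus |F t| := integral_nonneg fun t => mul_nonneg (abs_nonneg _) (logPlus_nonneg _)
  have hpi := Real.pi_lt_d2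
  have hpi0 := Real.pi_pos
  set J := ∫ t in T1, |F t| * logPlus |F t|
  have hA : 2 * Real.pi * (2 * Real.pi * 26 + 12 * ∫ t in T1, max (F t) 0 * logPlus (max (F t) 0)) ≤ 2 * Real.pi * (2 * Real.pi * 26 + 12 * J) :=
    mul_le_mul_of_nonneg_left (by linarith) (by linarith)
  have hB : 2 * Real.pi * (2 * Real.pi * 26 + 12 * ∫ t in T1, max (-F t) 0 * logPlus (max (-F t) 0)) ≤ 2 * Real.pi * (2 * Real.pi * 26 + 12 * J) :=
    mul_le_mul_of_nonneg_left (by linarith) (by linarith)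
  have hC : 2 * Real.pi * (2 * Real.pi * 26 + 12 * J) ≤ 1050 * (1 + J) := by
    have : Real.pi * Real.pi ≤ 3.15 * 3.15 := mul_le_mul hpi.le hpi.le hpi0.le (by norm_num)
    nlinarith
  linarith

end

noncomputable section

lemma frac_re {z : ℂ} {μ : ℝ} (hμ : 0 < μ) (hz : 0 ≤ z.re) :
    0 ≤ (z / (μ + z)).re ∧ (μ ≤ |z.im| → 1 / 2 ≤ (z / (μ + z)).re) := by
  have hD : 0 < (μ + z.re) ^ 2 + z.im ^ 2 := by
    have : 0 < μ + z.re := by linarith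
    positivity
  have h : (z / (μ + z)).re = (z.re * (μ + z.re) + z.im ^ 2) / ((μ + z.re) ^ 2 + z.im ^ 2) := by
    rw [Complex.div_re, Complex.normSq_apply]
    simp only [Complex.add_re, Complex.add_im, Complex.ofReal_re, Complex.ofReal_im, zero_add]
    rw [← add_div]
    congr 1 <;> ring
  rw [h]
  constructor
  · have : 0 ≤ μ + z.re := by linarith
    positivity
  · intro hb
    rw [div_le_div_iff₀ (by norm_num) hD]
    have : μ ^ 2 ≤ z.im ^ 2 := by rw [← sq_abs z.im]; exact pow_le_pow_left₀ hμ.le hb 2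
    nlinarith

lemma wk_le {r : ℝ} (h0 : 0 < r) (h1 : r < 1) (x : ℝ) : ∃ m, ∀ t, wk r x t ≤ 4 / 3 * pk (dd m) (t - x) := by
  have he := ee_pos h0 h1
  set e := ee r with hedef
  have hpi := Real.pi_gt_three
  have hsq : (2 * Real.pi)⁻¹ ≤ 1 / 6 := by
    rw [inv_eq_one_div]; apply one_div_le_one_div_of_le (by norm_num); linarith
  suffices hs : ∃ m, ∀ u, Real.sqrt (1 + e ^ 2) * pk e u ≤ 8 * pk (dd m) u by
    obtain ⟨m, hm⟩ := hs
    refine ⟨m, fun t => ?_⟩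
    have h3 := pk_nonneg he (t - x)
    have h2 : 0 ≤ Real.sqrt (1 + e ^ 2) * pk e (t - x) := by positivity
    calc wk r x t = (2 * Real.pi)⁻¹ * (Real.sqrt (1 + e ^ 2) * pk e (t - x)) := rfl
      _ ≤ 1 / 6 * (8 * pk (dd m) (t - x)) := by
          apply mul_le_mul hsq (hm _) h2 (by norm_num)
      _ = _ := by ring
  by_cases h : e ≤ 1
  · obtain ⟨m, hm1, hm2⟩ := exists_nat_pow_near_of_lt_one he h (y := (1/2 : ℝ)) (by norm_num) (by norm_num)
    refine ⟨m, fun u => ?_⟩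
    have hd := dd_pos m
    have hd1 : dd m / 2 ≤ e := by unfold dd; rw [pow_succ] at hm1; linarith
    have hd2 : e ≤ dd m := hm2
    have hsqrt : Real.sqrt (1 + e ^ 2) ≤ 2 := by
      rw [Real.sqrt_le_left (by norm_num)]; nlinarith
    have hp : pk e u ≤ 4 * pk (dd m) u := by
      unfold pk
      rw [← mul_div_assoc, div_le_div_iff₀ (den_pos he u) (den_pos hd u)]
      set s := Real.sin (u / 2)
      have : dd m ^ 2 ≤ 4 * e ^ 2 := by nlinarith
      have hs := sq_nonneg s
      nlinarith
    have := pk_nonneg he u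
    nlinarith
  · push Not at h
    refine ⟨0, fun u => ?_⟩
    have hsqrt : Real.sqrt (1 + e ^ 2) ≤ 2 * e := by
      rw [Real.sqrt_le_left (by linarith)]; nlinarith
    have hd : dd 0 = 1 := by simp [dd]
    rw [hd]
    have h1 : 1 / 2 ≤ pk 1 u := by
      unfold pk
      rw [div_le_div_iff₀ (by norm_num) (den_pos one_pos u)]
      nlinarith [Real.sin_sq_le_one (u/2)]
    have h2 : e * pk e u ≤ 1 := by
      unfold pk
      rw [← mul_div_assoc, div_le_one (den_pos he u)]
      nlinarith [sq_nonneg (Real.sin (u/2))]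
    have := pk_nonneg he u
    nlinarith

lemma max_conj_R {F : ℝ → ℝ} (h0 : ∀ t, 0 ≤ F t) (hF : IntegrableOn F T1) {μ : ℝ} (hμ : 0 < μ)
    {R : ℝ} (hR0 : 0 < R) (hR1 : R < 1) :
    volume {x | x ∈ T1 ∧ ∃ r, 0 < r ∧ r < R ∧ 2 * Real.pi * μ < |conj1 (ee r) F x|} ≤
      ENNReal.ofReal (1230000 / μ * ∫ t in T1, F t) := by
  set f : ℂ → ℂ := fun z => Gh F (R * z) / (μ + Gh F (R * z)) with hf
  have hre : ∀ w ∈ Metric.ball (0 : ℂ) 1, 0 ≤ (Gh F w).re := fun w hw => Gh_re_ge hF h0 hw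
  have hmaps : MapsTo (fun z : ℂ => (R : ℂ) * z) (Metric.ball 0 (1 / R)) (Metric.ball 0 1) := by
    intro z hz
    simp only [Metric.mem_ball, dist_zero_right, norm_mul, Complex.norm_real, Real.norm_eq_abs, abs_of_pos hR0] at hz ⊢
    rw [lt_div_iff₀ hR0] at hz; linarith
  have hd : DifferentiableOn ℂ f (Metric.ball 0 (1 / R)) := by
    have hG : DifferentiableOn ℂ (fun z => Gh F (R * z)) (Metric.ball 0 (1 / R)) :=
      (Gh_diff hF).comp (by fun_prop) hmaps
    refine hG.div ((differentiableOn_const _).add hG) fun z hz h => ?_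
    have h1 := hre _ (hmaps hz)
    have h2 := congrArg Complex.re h
    simp at h2
    linarith
  have hdc : DiffContOnCl ℂ f (Metric.ball 0 1) :=
    hd.diffContOnCl_ball (Metric.closedBall_subset_ball (by rw [lt_div_iff₀ hR0]; linarith))
  set w : ℝ → ℝ := fun t => (f (circleMap 0 1 t)).re with hw
  have hcm : ∀ s t : ℝ, (R : ℂ) * circleMap 0 s t = circleMap 0 (R * s) t := by
    intro s t; simp [circleMap, mul_assoc]
  have hfc : Continuous fun t => f (circleMap 0 1 t) := by
    refine hdc.2.comp_continuous (by fun_prop) fun t => ?_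
    rw [closure_ball _ one_ne_zero]
    exact circleMap_mem_closedBall 0 zero_le_one t
  have hwc : Continuous w := Complex.continuous_re.comp hfc
  have hw0 : ∀ t, 0 ≤ w t := by
    intro t
    simp only [hw, hf]
    refine (frac_re hμ (hre _ ?_)).1
    rw [hcm]; simp [abs_of_pos hR0, hR1]
  have hwi := cont_intOn hwc
  have hI : 0 ≤ ∫ t in T1, F t := integral_nonneg h0
  have hwI : ∫ t in T1, w t ≤ 1 / μ * ∫ t in T1, F t := by
    rw [hw, mean_re one_pos hdc]
    simp only [hf, mul_zero, Gh_zero]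
    rw [← Complex.ofReal_add, ← Complex.ofReal_div, Complex.ofReal_re]
    have hp := two_pi_pos
    set m := (2 * Real.pi)⁻¹ * ∫ t in T1, F t with hm
    have hm0 : 0 ≤ m := by positivity
    have : m / (μ + m) ≤ m / μ := div_le_div_of_nonneg_left hm0 hμ (by linarith)
    calc _ ≤ 2 * Real.pi * (m / μ) := mul_le_mul_of_nonneg_left this hp.le
      _ = _ := by rw [hm]; field_simp
  have hgw := Gam_weak hwc.measurable hw0 hwi (lam := 1 / 3000) (by norm_num)
  refine (measure_mono ?_).trans (hgw.trans (ENNReal.ofReal_le_ofReal ?_))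
  · rintro x ⟨hx, r, hr0, hrR, hc⟩
    refine ⟨hx, ?_⟩
    have hr' : 0 < r / R := by positivity
    have hr1 : r / R < 1 := by rw [div_lt_one hR0]; exact hrR
    have hr11 : r < 1 := by linarith
    have hb : (1 : ℝ) / 2 ≤ (f (circleMap 0 (r / R) x)).re := by
      simp only [hf]
      rw [hcm, show R * (r / R) = r by field_simp]
      refine (frac_re hμ (hre _ (by simp [abs_of_pos hr0, hr11]))).2 ?_
      rw [Gh_im hF hr0 hr11, abs_neg, abs_mul, abs_of_pos (by have := two_pi_pos; positivity), le_inv_mul_iff₀ two_pi_pos]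
      exact hc.le
    have hP := poisson hdc hr' hr1 x
    have hPre : (f (circleMap 0 (r / R) x)).re = ∫ t in T1, wk (r / R) x t * w t := by
      rw [← hP]
      have hi : IntegrableOn (fun t => wk (r / R) x t • f (circleMap 0 1 t)) T1 := by
        have hcw : Continuous fun t => wk (r / R) x t := by
          unfold wk
          exact continuous_const.mul (continuous_const.mul ((pk_continuous (ee_pos hr' hr1)).comp (by fun_prop)))
        exact ((hcw.smul hfc).integrableOn_Icc (a := -Real.pi) (b := Real.pi)).mono_set Ico_subset_Icc_self
      have := Complex.reCLM.integral_comp_comm hi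
      simp only [Complex.reCLM_apply, Complex.smul_re, smul_eq_mul] at this
      rw [← this]
    obtain ⟨m, hm⟩ := wk_le hr' hr1 x
    refine ⟨m, ?_⟩
    have h1 : ∫ t in T1, wk (r / R) x t * w t ≤ 4 / 3 * ∫ t in T1, pk (dd m) (t - x) * w t := by
      rw [← integral_const_mul]
      refine integral_mono (wk_int hwi hr' hr1 x) ((pk_mul_int hwi (dd_pos m) x).const_mul _) fun t => ?_
      have := mul_le_mul_of_nonneg_right (hm t) (hw0 t)
      simp only; linarith
    have h2 := pk_conv_le hw0 hwi m x
    have h3 : (3 : ℝ) / 8 ≤ ∫ t in T1, pk (dd m) (t - x) * w t := by linarith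
    have h4 := pow_le_pow_left₀ (by norm_num) h3 2
    norm_num at h4 ⊢
    linarith
  · have : (1230000 : ℝ) / μ * ∫ t in T1, F t = 1230000 * (1 / μ * ∫ t in T1, F t) := by ring
    rw [this]
    norm_num at hwI ⊢
    linarith

lemma max_conj_pos {F : ℝ → ℝ} (h0 : ∀ t, 0 ≤ F t) (hF : IntegrableOn F T1) {ν : ℝ} (hν : 0 < ν) :
    volume {x | x ∈ T1 ∧ ∃ e, 0 < e ∧ ν < |conj1 e F x|} ≤
      ENNReal.ofReal (8000000 / ν * ∫ t in T1, F t) := by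
  set μ := ν / (2 * Real.pi) with hμ
  have hp := two_pi_pos
  have hμ0 : 0 < μ := by positivity
  have hν2 : ν = 2 * Real.pi * μ := by rw [hμ]; field_simp
  set Rn : ℕ → ℝ := fun n => 1 - 1 / ((n : ℝ) + 2) with hRn
  have hR0 : ∀ n, 0 < Rn n := by
    intro n
    have : (1 : ℝ) / ((n : ℝ) + 2) < 1 := by rw [div_lt_one (by positivity)]; linarith [Nat.cast_nonneg (α := ℝ) n]
    simp only [hRn]; linarith
  have hR1 : ∀ n, Rn n < 1 := by
    intro n
    have : (0 : ℝ) < 1 / ((n : ℝ) + 2) := by positivity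
    simp only [hRn]; linarith
  have hmono : Monotone Rn := by
    intro a b hab
    simp only [hRn]
    have : (1 : ℝ) / ((b : ℝ) + 2) ≤ 1 / ((a : ℝ) + 2) := by
      apply one_div_le_one_div_of_le (by positivity)
      have : (a : ℝ) ≤ b := by exact_mod_cast hab
      linarith
    linarith
  set S : ℕ → Set ℝ := fun n => {x | x ∈ T1 ∧ ∃ r, 0 < r ∧ r < Rn n ∧ 2 * Real.pi * μ < |conj1 (ee r) F x|} with hS
  have hSm : Monotone S := by
    rintro a b hab x ⟨hx, r, h1, h2, h3⟩
    exact ⟨hx, r, h1, h2.trans_le (hmono hab), h3⟩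
  have hsub : {x | x ∈ T1 ∧ ∃ e, 0 < e ∧ ν < |conj1 e F x|} ⊆ ⋃ n, S n := by
    rintro x ⟨hx, e, he, h⟩
    obtain ⟨r, hr0, hr1, rfl⟩ := exists_ee he
    obtain ⟨n, hn⟩ := exists_nat_one_div_lt (show 0 < 1 - r by linarith)
    refine mem_iUnion.2 ⟨n, hx, r, hr0, ?_, by rw [← hν2]; exact h⟩
    have : (1 : ℝ) / ((n : ℝ) + 2) ≤ 1 / ((n : ℝ) + 1) := by
      apply one_div_le_one_div_of_le (by positivity); linarith
    simp only [hRn]; linarith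
  refine (measure_mono hsub).trans ?_
  rw [hSm.measure_iUnion]
  refine iSup_le fun n => (max_conj_R h0 hF hμ0 (hR0 n) (hR1 n)).trans (ENNReal.ofReal_le_ofReal ?_)
  refine mul_le_mul_of_nonneg_right ?_ (integral_nonneg h0)
  rw [hμ, div_div_eq_mul_div]
  apply div_le_div_of_nonneg_right _ hν.le
  linarith [Real.pi_lt_d2]

/-- weak type estimate for the one dimensional problem -/
lemma thmR {F : ℝ → ℝ} (hm : Measurable F) (hF : IntegrableOn F T1) {e : ℝ} (he : 0 < e) {L : ℝ} (hL : 0 < L) :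
    volume {x | x ∈ T1 ∧ ¬ Good (fun j => cn e F (j + 1) x) L} ≤
      ENNReal.ofReal (3 * 10 ^ 10 / L * ∫ t in T1, |F t|) := by
  set G := L / 622 with hG
  have hG0 : 0 < G := by positivity
  have hFa : IntegrableOn (fun t => |F t|) T1 := hF.abs
  have hpm : IntegrableOn (fun t => max (F t) 0) T1 := hF.pos_part
  have hnm : IntegrableOn (fun t => max (-F t) 0) T1 := hF.neg_part
  have e1 := Gam_weak (hm.abs) (fun t => abs_nonneg (F t)) hFa (lam := G / 9) (by positivity)
  have e2 := max_conj_pos (fun t => le_max_right (F t) 0) hpm (ν := G / 2) (by positivity)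
  have e3 := max_conj_pos (fun t => le_max_right (-F t) 0) hnm (ν := G / 2) (by positivity)
  have hI : 0 ≤ ∫ t in T1, |F t| := integral_nonneg fun t => abs_nonneg _
  have i1 : ∫ t in T1, max (F t) 0 ≤ ∫ t in T1, |F t| :=
    integral_mono hpm hFa fun t => max_le (le_abs_self _) (abs_nonneg _)
  have i2 : ∫ t in T1, max (-F t) 0 ≤ ∫ t in T1, |F t| :=
    integral_mono hnm hFa fun t => max_le (neg_le_abs _) (abs_nonneg _)
  have hsub : {x | x ∈ T1 ∧ ¬ Good (fun j => cn e F (j + 1) x) L} ⊆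
      {x | x ∈ T1 ∧ ∃ m, 67 * (G / 9) ^ 2 < Gam (fun t => |F t|) m x} ∪
      ({x | x ∈ T1 ∧ ∃ e, 0 < e ∧ G / 2 < |conj1 e (fun t => max (F t) 0) x|} ∪
      {x | x ∈ T1 ∧ ∃ e, 0 < e ∧ G / 2 < |conj1 e (fun t => max (-F t) 0) x|}) := by
    rintro x ⟨hx, hng⟩
    by_contra hcon
    simp only [mem_union, mem_setOf_eq, not_or, not_and, not_exists, not_lt, hx, true_and, forall_true_left] at hcon
    obtain ⟨c1, c2, c3⟩ := hcon
    apply hng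
    have : L = 622 * G := by rw [hG]; ring
    rw [this]
    refine good_cn hF he hG0.le (fun m => ?_) fun e' he' => ?_
    · have := c1 m
      nlinarith [sq_nonneg G]
    · have hFe : F = fun t => max (F t) 0 - max (-F t) 0 := by
        funext t
        rcases le_total 0 (F t) with h | h
        · rw [max_eq_left h, max_eq_right (by linarith)]; ring
        · rw [max_eq_right h, max_eq_left (by linarith)]; ring
      have := c2 e' he'
      have := c3 e' he'
      rw [hFe, conj1_sub hpm hnm he']
      refine (abs_sub _ _).trans (by linarith)
  refine (measure_mono hsub).trans ((measure_union_le _ _).trans ((add_le_add e1 ((measure_union_le _ _).trans (add_le_add e2 e3))).trans ?_))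
  rw [← ENNReal.ofReal_add (by positivity) (by have := integral_nonneg (μ := volume.restrict T1) (f := fun t => max (-F t) 0) fun t => le_max_right (-F t) 0; positivity),
    ← ENNReal.ofReal_add]
  · refine ENNReal.ofReal_le_ofReal ?_
    have j1 := mul_le_mul_of_nonneg_left i1 (show 0 ≤ 8000000 / (G / 2) by positivity)
    have j2 := mul_le_mul_of_nonneg_left i2 (show 0 ≤ 8000000 / (G / 2) by positivity)
    have : (410 / (G / 9) + (8000000 / (G / 2) + 8000000 / (G / 2))) ≤ 3 * 10 ^ 10 / L := by
      rw [hG]; field_simp; norm_num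
    nlinarith
  · positivity
  · have a1 := integral_nonneg (μ := volume.restrict T1) (f := fun t => max (-F t) 0) fun t => le_max_right (-F t) 0
    have a2 := integral_nonneg (μ := volume.restrict T1) (f := fun t => max (F t) 0) fun t => le_max_right (F t) 0
    positivity

end

noncomputable section

/-- error kernel -/
def Ek (e u v : ℝ) : ℝ := hk e (u + v) * hk e v - ck e u * (hk e v - hk e (u + v))

lemma Ek_alg {e s1 c1 s2 c2 : ℝ} (he : 0 < e) (h1 : s1 ^ 2 + c1 ^ 2 = 1) (h2 : s2 ^ 2 + c2 ^ 2 = 1)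
    (b1 : e < |s1|) (b2 : e < |s2|) :
    |c1 / s1 * (c2 / s2) - (s1 * c2 - c1 * s2) * (c1 * c2 + s1 * s2) / (e ^ 2 + (s1 * c2 - c1 * s2) ^ 2) * (c2 / s2 - c1 / s1)|
      ≤ 1 + 4 * (e / (e ^ 2 + (s1 * c2 - c1 * s2) ^ 2) * (e / (e ^ 2 + s1 ^ 2) + e / (e ^ 2 + s2 ^ 2))) := by
  have n1 : s1 ≠ 0 := by intro h; rw [h] at b1; simp at b1; linarith
  have n2 : s2 ≠ 0 := by intro h; rw [h] at b2; simp at b2; linarith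
  set σ := s1 * c2 - c1 * s2 with hσ
  set κ := c1 * c2 + s1 * s2 with hκ
  have hκσ : σ ^ 2 + κ ^ 2 = 1 := by
    have : σ ^ 2 + κ ^ 2 = (s1 ^ 2 + c1 ^ 2) * (s2 ^ 2 + c2 ^ 2) := by rw [hσ, hκ]; ring
    rw [this, h1, h2]; norm_num
  have hκ1 : |κ| ≤ 1 := by
    rw [abs_le]; constructor <;> nlinarith [sq_nonneg σ]
  have hD : 0 < e ^ 2 + σ ^ 2 := by positivity
  have hid : c1 / s1 * (c2 / s2) - σ * κ / (e ^ 2 + σ ^ 2) * (c2 / s2 - c1 / s1) =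
      κ * (e / (e ^ 2 + σ ^ 2)) * (e / (s1 * s2)) - 1 := by
    have h3 : c2 / s2 - c1 / s1 = σ / (s1 * s2) := by rw [hσ]; field_simp
    have h4 : c1 / s1 * (c2 / s2) = κ / (s1 * s2) - 1 := by rw [hκ]; field_simp; ring
    rw [h3, h4]; field_simp; ring
  rw [hid]
  have hq : |e / (s1 * s2)| ≤ e / (e ^ 2 + s1 ^ 2) + e / (e ^ 2 + s2 ^ 2) := by
    rw [abs_div, abs_of_pos he, abs_mul]
    have a1 : e ^ 2 + s1 ^ 2 ≤ 2 * |s1| ^ 2 := by rw [sq_abs]; nlinarith [sq_abs s1]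
    have a2 : e ^ 2 + s2 ^ 2 ≤ 2 * |s2| ^ 2 := by rw [sq_abs]; nlinarith [sq_abs s2]
    have p1 : 0 < |s1| := abs_pos.2 n1
    have p2 : 0 < |s2| := abs_pos.2 n2
    have g1 : e / (2 * |s1| ^ 2) ≤ e / (e ^ 2 + s1 ^ 2) := div_le_div_of_nonneg_left he.le (by positivity) a1
    have g2 : e / (2 * |s2| ^ 2) ≤ e / (e ^ 2 + s2 ^ 2) := div_le_div_of_nonneg_left he.le (by positivity) a2
    have g3 : e / (|s1| * |s2|) ≤ e / (2 * |s1| ^ 2) + e / (2 * |s2| ^ 2) := by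
      have : e / (2 * |s1| ^ 2) + e / (2 * |s2| ^ 2) - e / (|s1| * |s2|) = e / 2 * (1 / |s1| - 1 / |s2|) ^ 2 := by
        field_simp; ring
      have h0 : 0 ≤ e / 2 * (1 / |s1| - 1 / |s2|) ^ 2 := by positivity
      linarith
    linarith
  have hp : 0 ≤ e / (e ^ 2 + σ ^ 2) := by positivity
  have hsum : 0 ≤ e / (e ^ 2 + s1 ^ 2) + e / (e ^ 2 + s2 ^ 2) := by positivity
  calc _ ≤ |κ * (e / (e ^ 2 + σ ^ 2)) * (e / (s1 * s2))| + |(1 : ℝ)| := abs_sub _ _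
    _ = |κ| * ((e / (e ^ 2 + σ ^ 2)) * |e / (s1 * s2)|) + 1 := by
        rw [abs_mul, abs_mul, abs_of_nonneg hp, abs_one]; ring
    _ ≤ 1 * ((e / (e ^ 2 + σ ^ 2)) * (e / (e ^ 2 + s1 ^ 2) + e / (e ^ 2 + s2 ^ 2))) + 1 := by
        gcongr
    _ ≤ _ := by
        have := mul_nonneg hp hsum
        linarith

lemma Ek_alg2 {e s1 c1 s2 c2 : ℝ} (he : 0 < e) (h1 : s1 ^ 2 + c1 ^ 2 = 1) (h2 : s2 ^ 2 + c2 ^ 2 = 1)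
    (b1 : |s1| ≤ e) (b2 : e < |s2|) :
    |(s1 * c2 - c1 * s2) * (c1 * c2 + s1 * s2) / (e ^ 2 + (s1 * c2 - c1 * s2) ^ 2) * (c2 / s2)|
      ≤ 4 * (e / (e ^ 2 + (s1 * c2 - c1 * s2) ^ 2) * (e / (e ^ 2 + s1 ^ 2))) := by
  have n2 : s2 ≠ 0 := by intro h; rw [h] at b2; simp at b2; linarith
  set σ := s1 * c2 - c1 * s2 with hσ
  set κ := c1 * c2 + s1 * s2 with hκ
  have hκσ : σ ^ 2 + κ ^ 2 = 1 := by
    have : σ ^ 2 + κ ^ 2 = (s1 ^ 2 + c1 ^ 2) * (s2 ^ 2 + c2 ^ 2) := by rw [hσ, hκ]; ring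
    rw [this, h1, h2]; norm_num
  have hκ1 : |κ| ≤ 1 := by
    rw [abs_le]; constructor <;> nlinarith [sq_nonneg σ]
  have hc1 : |c1| ≤ 1 := by
    rw [abs_le]; constructor <;> nlinarith [sq_nonneg s1]
  have hc2 : |c2| ≤ 1 := by
    rw [abs_le]; constructor <;> nlinarith [sq_nonneg s2]
  have hD : 0 < e ^ 2 + σ ^ 2 := by positivity
  have p2 : 0 < |s2| := abs_pos.2 n2
  have hσ2 : |σ| ≤ 2 * |s2| := by
    have t1 : |s1 * c2| ≤ |s1| := by rw [abs_mul]; nlinarith [abs_nonneg s1]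
    have t2 : |c1 * s2| ≤ |s2| := by rw [abs_mul]; nlinarith [abs_nonneg s2]
    have := abs_sub (s1 * c2) (c1 * s2)
    rw [hσ]; linarith
  have hlow : 1 / 2 ≤ e * (e / (e ^ 2 + s1 ^ 2)) := by
    rw [← mul_div_assoc, div_le_div_iff₀ (by norm_num) (by positivity)]
    have : s1 ^ 2 ≤ e ^ 2 := by rw [← sq_abs s1]; exact pow_le_pow_left₀ (abs_nonneg _) b1 2
    nlinarith
  have hpD : 0 < 1 / (e ^ 2 + σ ^ 2) := by positivity
  calc _ = |κ| * |c2| * (|σ| / |s2|) * (1 / (e ^ 2 + σ ^ 2)) := by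
        rw [abs_mul, abs_div, abs_mul, abs_div, abs_of_pos hD]; ring
    _ ≤ 1 * 1 * 2 * (1 / (e ^ 2 + σ ^ 2)) := by
        have : |σ| / |s2| ≤ 2 := by rw [div_le_iff₀ p2]; exact hσ2
        gcongr
    _ = 4 * (1 / (e ^ 2 + σ ^ 2) * (1 / 2)) := by ring
    _ ≤ 4 * (1 / (e ^ 2 + σ ^ 2) * (e * (e / (e ^ 2 + s1 ^ 2)))) := by gcongr
    _ = _ := by ring

lemma Ek_bound {e : ℝ} (he : 0 < e) (u v : ℝ) :
    |Ek e u v| ≤ 1 + 4 * (pk e u * (pk e (u + v) + pk e v)) := by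
  have hs : Real.sin (u / 2) = Real.sin ((u + v) / 2) * Real.cos (v / 2) - Real.cos ((u + v) / 2) * Real.sin (v / 2) := by
    rw [← Real.sin_sub]; congr 1; ring
  have hc : Real.cos (u / 2) = Real.cos ((u + v) / 2) * Real.cos (v / 2) + Real.sin ((u + v) / 2) * Real.sin (v / 2) := by
    rw [← Real.cos_sub]; congr 1; ring
  have h1 := Real.sin_sq_add_cos_sq ((u + v) / 2)
  have h2 := Real.sin_sq_add_cos_sq (v / 2)
  have q0 := pk_nonneg he u
  have q1 := pk_nonneg he (u + v)
  have q2 := pk_nonneg he v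
  have q3 := mul_nonneg q0 q1
  have q4 := mul_nonneg q0 q2
  unfold Ek
  by_cases b1 : e < |Real.sin ((u + v) / 2)| <;> by_cases b2 : e < |Real.sin (v / 2)|
  · have := Ek_alg he h1 h2 b1 b2
    rw [← hs, ← hc] at this
    simp only [hk, if_pos b1, if_pos b2, pk, ck]
    exact this
  · push Not at b2
    have := Ek_alg2 he h2 h1 b2 b1
    have hs' : Real.sin (v / 2) * Real.cos ((u + v) / 2) - Real.cos (v / 2) * Real.sin ((u + v) / 2) = - Real.sin (u / 2) := by
      rw [hs]; ring
    have hc' : Real.cos (v / 2) * Real.cos ((u + v) / 2) + Real.sin (v / 2) * Real.sin ((u + v) / 2) = Real.cos (u / 2) := by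
      rw [hc]; ring
    rw [hs', hc', neg_sq] at this
    have h5 : |hk e (u + v) * hk e v - ck e u * (hk e v - hk e (u + v))| ≤ 4 * (pk e u * pk e v) := by
      simp only [hk, if_pos b1, if_neg (not_lt.2 b2), pk, ck]
      refine le_trans (le_of_eq ?_) this
      rw [← abs_neg]
      congr 1; ring
    linarith
  · push Not at b1
    have := Ek_alg2 he h1 h2 b1 b2
    rw [← hs, ← hc] at this
    have h5 : |hk e (u + v) * hk e v - ck e u * (hk e v - hk e (u + v))| ≤ 4 * (pk e u * pk e (u + v)) := by
      simp only [hk, if_pos b2, if_neg (not_lt.2 b1), pk, ck]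
      refine le_trans (le_of_eq ?_) this
      rw [← abs_neg]
      congr 1; ring
    linarith
  · simp only [hk, if_neg b1, if_neg b2]
    simp
    nlinarith

lemma restrict_T2 : (volume : Measure (ℝ × ℝ)).restrict T2 = (volume.restrict T1).prod (volume.restrict T1) := by
  rw [Measure.prod_restrict, ← Measure.volume_eq_prod]; rfl

lemma pk_add {e : ℝ} (he : 0 < e) (x : ℝ) : ∫⁻ u in T1, ENNReal.ofReal (pk e (x + u)) ≤ ENNReal.ofReal 10 := by
  have := pk_integral_shift he (-x)
  simpa [sub_neg_eq_add, add_comm] using this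

lemma pk_meas {e : ℝ} (he : 0 < e) : Measurable (pk e) := (pk_continuous he).measurable

lemma Ek_meas {e : ℝ} (he : 0 < e) : Measurable (fun q : ℝ × ℝ => Ek e q.1 q.2) := by
  have h1 := hk_measurable e
  have h2 := (ck_continuous he).measurable
  unfold Ek
  fun_prop

lemma Ek_norm {e : ℝ} (he : 0 < e) : ∫⁻ q in T2, ENNReal.ofReal |Ek e q.1 q.2| ≤ ENNReal.ofReal 900 := by
  have hp := pk_meas he
  have hm : Measurable (fun q : ℝ × ℝ => ENNReal.ofReal |Ek e q.1 q.2|) := (Ek_meas he).abs.ennreal_ofReal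
  rw [restrict_T2, lintegral_prod _ hm.aemeasurable]
  have hinner : ∀ u, ∫⁻ v in T1, ENNReal.ofReal |Ek e u v| ≤ ENNReal.ofReal 7 + ENNReal.ofReal (4 * pk e u) * ENNReal.ofReal 20 := by
    intro u
    calc _ ≤ ∫⁻ v in T1, (ENNReal.ofReal 1 + ENNReal.ofReal (4 * pk e u) * (ENNReal.ofReal (pk e (u + v)) + ENNReal.ofReal (pk e v))) := by
          refine lintegral_mono fun v => ?_
          have q0 := pk_nonneg he u
          have q1 := pk_nonneg he (u + v)
          have q2 := pk_nonneg he v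
          rw [← ENNReal.ofReal_add q1 q2, ← ENNReal.ofReal_mul (by positivity), ← ENNReal.ofReal_add zero_le_one (by positivity)]
          refine ENNReal.ofReal_le_ofReal ((Ek_bound he u v).trans (le_of_eq (by ring)))
      _ = ENNReal.ofReal 1 * volume T1 + ENNReal.ofReal (4 * pk e u) * ((∫⁻ v in T1, ENNReal.ofReal (pk e (u + v))) + ∫⁻ v in T1, ENNReal.ofReal (pk e v)) := by
          rw [lintegral_add_left measurable_const, lintegral_const, Measure.restrict_apply_univ,
            lintegral_const_mul _ (by fun_prop), lintegral_add_left (by fun_prop)]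
      _ ≤ _ := by
          gcongr
          · rw [vol_T1, ← ENNReal.ofReal_mul zero_le_one]
            refine ENNReal.ofReal_le_ofReal ?_
            linarith [Real.pi_lt_d2]
          · rw [show (20 : ℝ) = 10 + 10 by norm_num, ENNReal.ofReal_add (by norm_num) (by norm_num)]
            exact add_le_add (pk_add he u) (pk_integral he)
  calc _ ≤ ∫⁻ u in T1, (ENNReal.ofReal 7 + ENNReal.ofReal (4 * pk e u) * ENNReal.ofReal 20) := lintegral_mono fun u => hinner u
    _ = ENNReal.ofReal 7 * volume T1 + ENNReal.ofReal 4 * (∫⁻ u in T1, ENNReal.ofReal (pk e u)) * ENNReal.ofReal 20 := by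
        rw [lintegral_add_left measurable_const, lintegral_const, Measure.restrict_apply_univ,
          lintegral_mul_const _ (by fun_prop)]
        congr 2
        rw [← lintegral_const_mul _ (by fun_prop)]
        refine lintegral_congr fun u => ?_
        rw [ENNReal.ofReal_mul (by norm_num)]
    _ ≤ ENNReal.ofReal 7 * ENNReal.ofReal (2 * Real.pi) + ENNReal.ofReal 4 * ENNReal.ofReal 10 * ENNReal.ofReal 20 := by
        rw [vol_T1]; gcongr; exact pk_integral he
    _ ≤ _ := by
        rw [← ENNReal.ofReal_mul (by norm_num), ← ENNReal.ofReal_mul (by norm_num), ← ENNReal.ofReal_mul (by norm_num),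
          ← ENNReal.ofReal_add (by positivity) (by norm_num)]
        refine ENNReal.ofReal_le_ofReal ?_
        linarith [Real.pi_lt_d2]

/-- L log L bound for the sharply truncated conjugate function -/
lemma zygZ {g : ℝ → ℝ} (hm : Measurable g) {e : ℝ} (he : 0 < e) :
    ∫⁻ y in T1, ENNReal.ofReal |∫ t in T1, hk e (t - y) * g t| ≤
      ENNReal.ofReal 2300 * (1 + ∫⁻ t in T1, ENNReal.ofReal (|g t| * logPlus |g t|)) := by
  have hpm := pk_meas he
  set J := ∫⁻ t in T1, ENNReal.ofReal (|g t| * logPlus |g t|) with hJ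
  by_cases hfin : J = ⊤
  · rw [hfin]; simp
  have hgm : Measurable fun t => |g t| * logPlus |g t| := hm.abs.mul (logPlus_meas.comp hm.abs)
  have hnn : ∀ t, 0 ≤ |g t| * logPlus |g t| := fun t => mul_nonneg (abs_nonneg _) (logPlus_nonneg _)
  have hLi : IntegrableOn (fun t => |g t| * logPlus |g t|) T1 := by
    refine (lintegral_ofReal_ne_top_iff_integrable hgm.aestronglyMeasurable (Eventually.of_forall hnn)).1 hfin
  have hgi : IntegrableOn g T1 := by
    refine Integrable.mono' ((integrable_const (3 : ℝ)).add hLi) hm.aestronglyMeasurable (Eventually.of_forall fun t => ?_)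
    exact le_logPlus (abs_nonneg _)
  have hJr : J = ENNReal.ofReal (∫ t in T1, |g t| * logPlus |g t|) :=
    (ofReal_integral_eq_lintegral_ofReal hLi (Eventually.of_forall hnn)).symm
  have hz := zyg hm hLi he
  have hI0 : 0 ≤ ∫ t in T1, |g t| * logPlus |g t| := integral_nonneg hnn
  have hpt : ∀ y, ENNReal.ofReal |∫ t in T1, hk e (t - y) * g t| ≤
      ENNReal.ofReal |conj1 e g y| + ∫⁻ t in T1, ENNReal.ofReal (pk e (t - y) * |g t|) := by
    intro y
    have hki : IntegrableOn (fun t => hk e (t - y) * g t) T1 := by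
      apply Integrable.bdd_mul (c := 1 / e) hgi
      · exact ((hk_measurable e).comp (by fun_prop)).aestronglyMeasurable
      · exact Eventually.of_forall fun t => abs_hk_le he _
    have hci := ck_mul_int hgi he y
    have hpi := pk_mul_int hgi.abs he y
    have h1 : |(∫ t in T1, hk e (t - y) * g t) - conj1 e g y| ≤ ∫ t in T1, pk e (t - y) * |g t| := by
      unfold conj1
      rw [← integral_sub hki hci]
      refine (abs_integral_le_integral_abs).trans ?_
      refine integral_mono (hki.sub hci).abs hpi fun t => ?_
      simp only
      rw [← sub_mul, abs_mul]
      exact mul_le_mul_of_nonneg_right (hk_sub_ck he _) (abs_nonneg _)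
    rw [← ofReal_integral_eq_lintegral_ofReal hpi (Eventually.of_forall fun t => mul_nonneg (pk_nonneg he _) (abs_nonneg _)),
      ← ENNReal.ofReal_add (abs_nonneg _) (integral_nonneg fun t => mul_nonneg (pk_nonneg he _) (abs_nonneg _))]
    refine ENNReal.ofReal_le_ofReal ?_
    have := abs_sub_abs_le_abs_sub (∫ t in T1, hk e (t - y) * g t) (conj1 e g y)
    linarith
  have hcc := conj1_cont hgi he
  calc _ ≤ ∫⁻ y in T1, (ENNReal.ofReal |conj1 e g y| + ∫⁻ t in T1, ENNReal.ofReal (pk e (t - y) * |g t|)) :=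
        lintegral_mono fun y => hpt y
    _ = (∫⁻ y in T1, ENNReal.ofReal |conj1 e g y|) + ∫⁻ t in T1, ∫⁻ y in T1, ENNReal.ofReal (pk e (t - y) * |g t|) := by
        rw [lintegral_add_left hcc.abs.measurable.ennreal_ofReal]
        congr 1
        refine lintegral_lintegral_swap (Measurable.aemeasurable ?_)
        exact Measurable.ennreal_ofReal (by fun_prop)
    _ ≤ ENNReal.ofReal (∫ y in T1, |conj1 e g y|) + ∫⁻ t in T1, ENNReal.ofReal 10 * ENNReal.ofReal |g t| := by
        rw [ofReal_integral_eq_lintegral_ofReal (cont_intOn hcc.abs) (Eventually.of_forall fun y => abs_nonneg _)]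
        gcongr with t
        have : ∀ y, ENNReal.ofReal (pk e (t - y) * |g t|) = ENNReal.ofReal (pk e (y - t)) * ENNReal.ofReal |g t| := fun y => by
          rw [← ENNReal.ofReal_mul (pk_nonneg he _), ← pk_neg e (t - y), neg_sub]
        simp only [this]
        rw [lintegral_mul_const _ (by fun_prop)]
        gcongr
        exact pk_integral_shift he t
    _ ≤ ENNReal.ofReal (2100 * (1 + ∫ t in T1, |g t| * logPlus |g t|)) + ENNReal.ofReal 10 * ENNReal.ofReal (3 * (2 * Real.pi) + ∫ t in T1, |g t| * logPlus |g t|) := by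
        gcongr
        rw [lintegral_const_mul _ (by fun_prop)]
        gcongr
        rw [← ofReal_integral_eq_lintegral_ofReal hgi.abs (Eventually.of_forall fun y => abs_nonneg _)]
        refine ENNReal.ofReal_le_ofReal ?_
        have hv : (volume.real T1) = 2 * Real.pi := by
          rw [Measure.real, vol_T1, ENNReal.toReal_ofReal two_pi_pos.le]
        have : ∫ t in T1, (3 + |g t| * logPlus |g t|) = 3 * (2 * Real.pi) + ∫ t in T1, |g t| * logPlus |g t| := by
          rw [integral_add (integrable_const _) hLi, setIntegral_const, hv, smul_eq_mul]; ring
        rw [← this]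
        exact integral_mono hgi.abs ((integrable_const _).add hLi) fun t => le_logPlus (abs_nonneg _)
    _ ≤ _ := by
        rw [hJr, ← ENNReal.ofReal_one, ← ENNReal.ofReal_add zero_le_one hI0, ← ENNReal.ofReal_mul (by norm_num),
          ← ENNReal.ofReal_mul (by norm_num), ← ENNReal.ofReal_add (by positivity) (by have := Real.pi_pos; positivity)]
        refine ENNReal.ofReal_le_ofReal ?_
        linarith [Real.pi_lt_d2]

lemma thmR' {F : ℝ → ℝ} (hm : Measurable F) {e : ℝ} (he : 0 < e) {L : ℝ} (hL : 0 < L) :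
    (volume.restrict T1) {x | ¬ Good (fun j => cn e F (j + 1) x) L} ≤
      ENNReal.ofReal (3 * 10 ^ 10 / L) * ∫⁻ t in T1, ENNReal.ofReal |F t| := by
  by_cases hfin : ∫⁻ t in T1, ENNReal.ofReal |F t| = ⊤
  · rw [hfin, ENNReal.mul_top]
    · exact le_top
    · rw [ne_eq, ENNReal.ofReal_eq_zero, not_le]; positivity
  · have hFa : IntegrableOn (fun t => |F t|) T1 :=
      (lintegral_ofReal_ne_top_iff_integrable hm.abs.aestronglyMeasurable (Eventually.of_forall fun t => abs_nonneg _)).1 hfin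
    have hF : IntegrableOn F T1 := (integrable_norm_iff hm.aestronglyMeasurable).1 hFa
    have := thmR hm hF he hL
    rw [Measure.restrict_apply' T1_meas, ← ofReal_integral_eq_lintegral_ofReal hFa (Eventually.of_forall fun t => abs_nonneg _),
      ← ENNReal.ofReal_mul (by positivity)]
    refine (measure_mono ?_).trans this
    rintro x ⟨h1, h2⟩; exact ⟨h2, h1⟩

end

noncomputable section

/-- diagonal truncated conjugate function -/
def Ad (e : ℝ) (f : ℝ × ℝ → ℝ) (x y : ℝ) : ℝ := ∫ v in T1, hk e v * f (x + v, y + v)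

/-- truncated integral -/
def Xn (e : ℝ) (f : ℝ × ℝ → ℝ) (n : ℕ) (p : ℝ × ℝ) : ℝ :=
  ∫ q in T2, Real.cos (n * q.1) * (hk e (q.1 + q.2) * hk e q.2) * f (p.1 + q.1 + q.2, p.2 + q.2)

/-- error integral -/
def Bl (e : ℝ) (f : ℝ × ℝ → ℝ) (p : ℝ × ℝ) : ENNReal :=
  ∫⁻ q in T2, ENNReal.ofReal (|Ek e q.1 q.2| * |f (p.1 + q.1 + q.2, p.2 + q.2)|)

lemma T2_meas : MeasurableSet T2 := T1_meas.prod T1_meas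

lemma trunc_eq {e : ℝ} (he : 0 < e) (f : ℝ × ℝ → ℝ) (n : ℕ) (p : ℝ × ℝ) :
    (∫ q in {q : ℝ × ℝ | q ∈ T2 ∧ e < |Real.sin ((q.1 + q.2) / 2)| ∧
        e < |Real.sin (q.2 / 2)|}, (1 / (2 * Real.pi ^ 2)) *
              (Real.cos ((n : ℝ) * q.1) /
                (4 * Real.tan ((q.1 + q.2) / 2) * Real.tan (q.2 / 2))) *
              f (p.1 + q.1 + q.2, p.2 + q.2)) = (1 / (8 * Real.pi ^ 2)) * Xn e f n p := by
  set S := {q : ℝ × ℝ | e < |Real.sin ((q.1 + q.2) / 2)| ∧ e < |Real.sin (q.2 / 2)|} with hS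
  have hSm : MeasurableSet S := by
    have m1 : Measurable fun q : ℝ × ℝ => |Real.sin ((q.1 + q.2) / 2)| := by fun_prop
    have m2 : Measurable fun q : ℝ × ℝ => |Real.sin (q.2 / 2)| := by fun_prop
    exact (measurableSet_lt measurable_const m1).inter (measurableSet_lt measurable_const m2)
  have hset : {q : ℝ × ℝ | q ∈ T2 ∧ e < |Real.sin ((q.1 + q.2) / 2)| ∧
        e < |Real.sin (q.2 / 2)|} = T2 ∩ S := rfl
  rw [hset, ← setIntegral_indicator hSm, Xn, ← integral_const_mul]
  refine setIntegral_congr_fun T2_meas fun q _ => ?_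
  by_cases hq : q ∈ S
  · rw [indicator_of_mem hq]
    have h1 : e < |Real.sin ((q.1 + q.2) / 2)| := hq.1
    have h2 : e < |Real.sin (q.2 / 2)| := hq.2
    have n1 : Real.sin ((q.1 + q.2) / 2) ≠ 0 := by intro h; rw [h] at h1; simp at h1; linarith
    have n2 : Real.sin (q.2 / 2) ≠ 0 := by intro h; rw [h] at h2; simp at h2; linarith
    simp only [hk, if_pos h1, if_pos h2, Real.tan_eq_sin_div_cos]
    simp only [div_eq_mul_inv, mul_inv, inv_inv]
    ring
  · rw [indicator_of_notMem hq]
    have : hk e (q.1 + q.2) * hk e q.2 = 0 := by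
      by_cases h1 : e < |Real.sin ((q.1 + q.2) / 2)|
      · have h2 : ¬ e < |Real.sin (q.2 / 2)| := fun h => hq ⟨h1, h⟩
        simp [hk, if_neg h2]
      · simp [hk, if_neg h1]
    rw [this]; ring

lemma lint2_shift {g : ℝ × ℝ → ENNReal} (hm : Measurable g)
    (h1 : ∀ x y, g (x + 2 * Real.pi, y) = g (x, y)) (h2 : ∀ x y, g (x, y + 2 * Real.pi) = g (x, y)) (x y : ℝ) :
    ∫⁻ q in T2, g (x + q.1 + q.2, y + q.2) = ∫⁻ q in T2, g q := by
  rw [restrict_T2, lintegral_prod_symm' _ (by fun_prop), lintegral_prod_symm' _ hm]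
  have : ∀ v, ∫⁻ u in T1, g (x + u + v, y + v) = ∫⁻ u in T1, g (u, v + y) := by
    intro v
    rw [← lint_shift (F := fun u => g (u, v + y)) (fun u => h1 u _) (x + v)]
    refine lintegral_congr fun u => ?_
    congr 2 <;> ring
  simp only [this]
  exact lint_shift (F := fun v => ∫⁻ u in T1, g (u, v)) (fun v => by simp only [h2]) y

lemma lint2_diag {g : ℝ × ℝ → ENNReal} (hm : Measurable g)
    (h1 : ∀ x y, g (x + 2 * Real.pi, y) = g (x, y)) :
    ∫⁻ a in T1, ∫⁻ y in T1, g (a + y, y) = ∫⁻ q in T2, g q := by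
  rw [restrict_T2, lintegral_prod_symm' _ hm, lintegral_lintegral_swap (by fun_prop)]
  refine lintegral_congr fun y => ?_
  exact lint_shift (F := fun u => g (u, y)) (fun u => h1 u y) y

variable {f : ℝ × ℝ → ℝ} {e : ℝ}

lemma f_shift_int (hm : Measurable f) (hb : Biperiodic f) (hi : IntegrableOn f T2) (x y : ℝ) :
    IntegrableOn (fun q : ℝ × ℝ => f (x + q.1 + q.2, y + q.2)) T2 := by
  refine ⟨(hm.comp (by fun_prop)).aestronglyMeasurable, ?_⟩
  have h := hi.2
  rw [hasFiniteIntegral_iff_enorm] at h ⊢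
  rwa [lint2_shift (g := fun q => ‖f q‖ₑ) (by fun_prop) (fun x y => by simp only [(hb x y).1]) (fun x y => by simp only [(hb x y).2])]

lemma ker_int (hm : Measurable f) (hb : Biperiodic f) (hi : IntegrableOn f T2) (x y : ℝ)
    {K : ℝ × ℝ → ℝ} (hK : Measurable K) {C : ℝ} (hC : ∀ q, |K q| ≤ C) :
    IntegrableOn (fun q : ℝ × ℝ => K q * f (x + q.1 + q.2, y + q.2)) T2 :=
  Integrable.bdd_mul (c := C) (f_shift_int hm hb hi x y) hK.aestronglyMeasurable (Eventually.of_forall hC)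

lemma Ad_per1 (hb : Biperiodic f) (x y : ℝ) : Ad e f (x + 2 * Real.pi) y = Ad e f x y := by
  unfold Ad
  congr 1; ext v
  rw [show x + 2 * Real.pi + v = x + v + 2 * Real.pi by ring, (hb _ _).1]

lemma Ad_per2 (hb : Biperiodic f) (x y : ℝ) : Ad e f x (y + 2 * Real.pi) = Ad e f x y := by
  unfold Ad
  congr 1; ext v
  rw [show y + 2 * Real.pi + v = y + v + 2 * Real.pi by ring, (hb _ _).2]

lemma cos_per (n : ℕ) (t : ℝ) : Real.cos (n * (t + 2 * Real.pi)) = Real.cos (n * t) := by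
  rw [mul_add, Real.cos_add_nat_mul_two_pi]

lemma cn_shift {F : ℝ → ℝ} (hF : Function.Periodic F (2 * Real.pi)) (n : ℕ) (x : ℝ) :
    cn e F n x = ∫ u in T1, Real.cos (n * u) * (ck e u * F (u + x)) := by
  have := int_shift (F := fun t => Real.cos (n * (t - x)) * (ck e (t - x) * F t)) (fun t => by
    simp only []
    rw [hF t, show t + 2 * Real.pi - x = (t - x) + 2 * Real.pi by ring, cos_per, ck_periodic]) x
  rw [cn, ← this]
  simp only [add_sub_cancel_right]

lemma cn_shift' {F : ℝ → ℝ} (hF : Function.Periodic F (2 * Real.pi)) (n : ℕ) (x : ℝ) :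
    cn e F n x = - ∫ u in T1, Real.cos (n * u) * (ck e u * F (x - u)) := by
  rw [cn_shift hF, ← int_neg, ← integral_neg]
  congr 1; ext u
  rw [mul_neg, Real.cos_neg, ck_neg, show -u + x = x - u by ring]; ring

lemma Xn_eq (he : 0 < e) (hm : Measurable f) (hb : Biperiodic f) (hi : IntegrableOn f T2) (n : ℕ) (x y : ℝ) :
    Xn e f n (x, y) = cn e (fun t => Ad e f t y) n x + cn e (fun t => Ad e f x t) n y +
      ∫ q in T2, Real.cos (n * q.1) * Ek e q.1 q.2 * f (x + q.1 + q.2, y + q.2) := by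
  have hh := hk_measurable e
  have hc := (ck_continuous he).measurable
  have hE := Ek_meas he
  have b1 : ∀ a b c : ℝ, |a| ≤ 1 → |b| ≤ 1 / e → |c| ≤ 1 / e → |a * (b * c)| ≤ 1 * (1 / e * (1 / e)) := by
    intro a b c h1 h2 h3
    rw [abs_mul, abs_mul]
    gcongr
  have i1 := ker_int hm hb hi x y (K := fun q => Real.cos (n * q.1) * (ck e q.1 * hk e q.2)) (by fun_prop)
    (fun q => b1 _ _ _ (Real.abs_cos_le_one _) (abs_ck_le he _) (abs_hk_le he _))
  have i2 := ker_int hm hb hi x y (K := fun q => Real.cos (n * q.1) * (ck e q.1 * hk e (q.1 + q.2))) (by fun_prop)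
    (fun q => b1 _ _ _ (Real.abs_cos_le_one _) (abs_ck_le he _) (abs_hk_le he _))
  have i3 := ker_int hm hb hi x y (K := fun q => Real.cos (n * q.1) * (hk e (q.1 + q.2) * hk e q.2)) (by fun_prop)
    (fun q => b1 _ _ _ (Real.abs_cos_le_one _) (abs_hk_le he _) (abs_hk_le he _))
  have i4 : IntegrableOn (fun q : ℝ × ℝ => Real.cos (n * q.1) * Ek e q.1 q.2 * f (x + q.1 + q.2, y + q.2)) T2 := by
    refine ((i3.sub i1).add i2).congr (Eventually.of_forall fun q => ?_)
    simp only [Pi.add_apply, Pi.sub_apply, Ek]; ring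
  have t1 : cn e (fun t => Ad e f t y) n x = ∫ q in T2, Real.cos (n * q.1) * (ck e q.1 * hk e q.2) * f (x + q.1 + q.2, y + q.2) := by
    have i1' := i1
    rw [IntegrableOn, restrict_T2] at i1'
    rw [restrict_T2, integral_prod _ i1', cn_shift (fun t => Ad_per1 hb t y)]
    congr 1; ext u
    unfold Ad
    rw [← integral_const_mul, ← integral_const_mul]
    congr 1; ext v
    rw [show u + x + v = x + u + v by ring]; ring
  have t2 : cn e (fun t => Ad e f x t) n y = - ∫ q in T2, Real.cos (n * q.1) * (ck e q.1 * hk e (q.1 + q.2)) * f (x + q.1 + q.2, y + q.2) := by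
    have i2' := i2
    rw [IntegrableOn, restrict_T2] at i2'
    rw [restrict_T2, integral_prod _ i2', cn_shift' (fun t => Ad_per2 hb x t)]
    congr 2; ext u
    have : Ad e f x (y - u) = ∫ v in T1, hk e (u + v) * f (x + u + v, y + v) := by
      unfold Ad
      rw [← int_shift (F := fun v => hk e v * f (x + v, y - u + v)) (fun v => by
        simp only []
        rw [hk_periodic, ← add_assoc, ← add_assoc, (hb _ _).1, (hb _ _).2]) u]
      congr 1; ext v
      rw [show v + u = u + v by ring, show x + (u + v) = x + u + v by ring, show y - u + (u + v) = y + v by ring]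
    rw [this, ← integral_const_mul, ← integral_const_mul]
    congr 1; ext v
    ring
  have i12 : IntegrableOn (fun q : ℝ × ℝ => Real.cos (n * q.1) * (ck e q.1 * hk e q.2) * f (x + q.1 + q.2, y + q.2) -
      Real.cos (n * q.1) * (ck e q.1 * hk e (q.1 + q.2)) * f (x + q.1 + q.2, y + q.2)) T2 := i1.sub i2
  rw [t1, t2, Xn, ← sub_eq_add_neg, ← integral_sub i1 i2, ← integral_add i12 i4]
  congr 1; ext q
  simp only [Ek]; ring

lemma err_le (n : ℕ) (x y : ℝ) (hfin : Bl e f (x, y) ≠ ⊤) :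
    |∫ q in T2, Real.cos (n * q.1) * Ek e q.1 q.2 * f (x + q.1 + q.2, y + q.2)| ≤ (Bl e f (x, y)).toReal := by
  rw [← Real.norm_eq_abs]
  refine (norm_integral_le_lintegral_norm _).trans ?_
  refine ENNReal.toReal_mono hfin ?_
  refine lintegral_mono fun q => ENNReal.ofReal_le_ofReal ?_
  rw [Real.norm_eq_abs, abs_mul, abs_mul]
  have := Real.abs_cos_le_one (n * q.1)
  gcongr
  exact mul_le_of_le_one_left (abs_nonneg _) this

end

noncomputable section

variable {f : ℝ × ℝ → ℝ} {e : ℝ}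

lemma Ad_meas (hm : Measurable f) : Measurable (fun p : ℝ × ℝ => Ad e f p.1 p.2) := by
  have hh := hk_measurable e
  have h : Measurable (fun z : (ℝ × ℝ) × ℝ => hk e z.2 * f (z.1.1 + z.2, z.1.2 + z.2)) := by fun_prop
  exact (h.stronglyMeasurable.integral_prod_right' (ν := volume.restrict T1)).measurable

lemma cn1_meas (he : 0 < e) (hm : Measurable f) (n : ℕ) :
    Measurable (fun p : ℝ × ℝ => cn e (fun t => Ad e f t p.2) n p.1) := by
  have hc := (ck_continuous he).measurable
  have hA := Ad_meas (e := e) hm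
  have hA' : Measurable (fun z : (ℝ × ℝ) × ℝ => Ad e f z.2 z.1.2) :=
    hA.comp (g := fun p : ℝ × ℝ => Ad e f p.1 p.2) (f := fun z : (ℝ × ℝ) × ℝ => (z.2, z.1.2)) (by fun_prop)
  have h : Measurable (fun z : (ℝ × ℝ) × ℝ => Real.cos (n * (z.2 - z.1.1)) * (ck e (z.2 - z.1.1) * Ad e f z.2 z.1.2)) := by fun_prop
  exact (h.stronglyMeasurable.integral_prod_right' (ν := volume.restrict T1)).measurable

lemma cn2_meas (he : 0 < e) (hm : Measurable f) (n : ℕ) :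
    Measurable (fun p : ℝ × ℝ => cn e (fun t => Ad e f p.1 t) n p.2) := by
  have hc := (ck_continuous he).measurable
  have hA := Ad_meas (e := e) hm
  have hA' : Measurable (fun z : (ℝ × ℝ) × ℝ => Ad e f z.1.1 z.2) :=
    hA.comp (g := fun p : ℝ × ℝ => Ad e f p.1 p.2) (f := fun z : (ℝ × ℝ) × ℝ => (z.1.1, z.2)) (by fun_prop)
  have h : Measurable (fun z : (ℝ × ℝ) × ℝ => Real.cos (n * (z.2 - z.1.2)) * (ck e (z.2 - z.1.2) * Ad e f z.1.1 z.2)) := by fun_prop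
  exact (h.stronglyMeasurable.integral_prod_right' (ν := volume.restrict T1)).measurable

lemma good_meas {ξ : ℕ → ℝ × ℝ → ℝ} (h : ∀ j, Measurable (ξ j)) (B : ℝ) :
    MeasurableSet {p | ¬ Good (fun j => ξ j p) B} := by
  refine MeasurableSet.compl (s := {p | Good (fun j => ξ j p) B}) ?_
  have : {p | Good (fun j => ξ j p) B} = (⋂ a : ℕ, ⋂ L : ℕ, ⋂ _ : 0 < L, {p | ∑ k ∈ Finset.range L,
      |ξ (a + k) p - (∑ i ∈ Finset.range L, ξ (a + i) p) / L| ≤ B * L}) ∩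
      ⋂ N : ℕ, {p | |∑ k ∈ Finset.range (N + 1), ξ k p| ≤ B * (N + 1)} := by
    ext p
    simp only [Good, mem_inter_iff, mem_iInter, mem_setOf_eq]
  rw [this]
  refine MeasurableSet.inter ?_ ?_
  · refine MeasurableSet.iInter fun a => MeasurableSet.iInter fun L => MeasurableSet.iInter fun _ => ?_
    exact measurableSet_le (by fun_prop) measurable_const
  · refine MeasurableSet.iInter fun N => ?_
    exact measurableSet_le (by fun_prop) measurable_const

lemma Ad_norm (he : 0 < e) (hm : Measurable f) (hb : Biperiodic f) :
    ∫⁻ p in T2, ENNReal.ofReal |Ad e f p.1 p.2| ≤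
      ENNReal.ofReal 2300 * (ENNReal.ofReal (2 * Real.pi) + ∫⁻ p in T2, ENNReal.ofReal (|f p| * logPlus |f p|)) := by
  have hA := Ad_meas (e := e) hm
  have hJm : Measurable (fun p => ENNReal.ofReal (|f p| * logPlus |f p|)) :=
    (hm.abs.mul (logPlus_meas.comp hm.abs)).ennreal_ofReal
  rw [← lint2_diag (g := fun p : ℝ × ℝ => ENNReal.ofReal |Ad e f p.1 p.2|) (by fun_prop) (fun x y => by
    simp only [Ad_per1 hb])]
  rw [← lint2_diag hJm (fun x y => by simp only [(hb x y).1])]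
  have hAd : ∀ a y, Ad e f (a + y) y = ∫ t in T1, hk e (t - y) * f (a + t, t) := by
    intro a y
    rw [← int_shift (F := fun t => hk e (t - y) * f (a + t, t)) (fun t => by
      simp only []
      rw [show t + 2 * Real.pi - y = t - y + 2 * Real.pi by ring, hk_periodic, ← add_assoc, (hb _ _).1, (hb _ _).2]) y]
    unfold Ad
    congr 1; ext v
    rw [add_sub_cancel_right, add_comm v y, add_assoc]
  calc _ ≤ ∫⁻ a in T1, ENNReal.ofReal 2300 * (1 + ∫⁻ t in T1, ENNReal.ofReal (|f (a + t, t)| * logPlus |f (a + t, t)|)) := by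
        refine lintegral_mono fun a => ?_
        simp only [hAd]
        exact zygZ (g := fun t => f (a + t, t)) (by fun_prop) he
    _ = _ := by
        have hmm : Measurable fun a => ∫⁻ t in T1, ENNReal.ofReal (|f (a + t, t)| * logPlus |f (a + t, t)|) :=
          Measurable.lintegral_prod_right' (f := fun z : ℝ × ℝ => ENNReal.ofReal (|f (z.1 + z.2, z.2)| * logPlus |f (z.1 + z.2, z.2)|))
            (hJm.comp (g := fun p => ENNReal.ofReal (|f p| * logPlus |f p|)) (f := fun z : ℝ × ℝ => (z.1 + z.2, z.2)) (by fun_prop))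
        rw [lintegral_const_mul _ (by fun_prop), lintegral_add_left measurable_const, lintegral_const,
          Measure.restrict_apply_univ, vol_T1, one_mul]

lemma lint2_trans {g : ℝ × ℝ → ENNReal} (hm : Measurable g)
    (h1 : ∀ x y, g (x + 2 * Real.pi, y) = g (x, y)) (h2 : ∀ x y, g (x, y + 2 * Real.pi) = g (x, y)) (a b : ℝ) :
    ∫⁻ q in T2, g (q.1 + a, q.2 + b) = ∫⁻ q in T2, g q := by
  rw [restrict_T2, lintegral_prod_symm' _ (by fun_prop), lintegral_prod_symm' _ hm]
  have : ∀ v, ∫⁻ u in T1, g (u + a, v + b) = ∫⁻ u in T1, g (u, v + b) := by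
    intro v
    exact lint_shift (F := fun u => g (u, v + b)) (fun u => h1 u _) a
  simp only [this]
  exact lint_shift (F := fun v => ∫⁻ u in T1, g (u, v)) (fun v => by simp only [h2]) b

lemma Bl_norm (he : 0 < e) (hm : Measurable f) (hb : Biperiodic f) :
    ∫⁻ p in T2, Bl e f p ≤ ENNReal.ofReal 900 * ∫⁻ p in T2, ENNReal.ofReal |f p| := by
  have hE := Ek_meas he
  unfold Bl
  have hsf : SFinite ((volume : Measure (ℝ × ℝ)).restrict T2) := inferInstance
  rw [lintegral_lintegral_swap]
  · have : ∀ q : ℝ × ℝ, ∫⁻ p in T2, ENNReal.ofReal (|Ek e q.1 q.2| * |f (p.1 + q.1 + q.2, p.2 + q.2)|) =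
        ENNReal.ofReal |Ek e q.1 q.2| * ∫⁻ p in T2, ENNReal.ofReal |f p| := by
      intro q
      rw [← lint2_trans (g := fun p => ENNReal.ofReal |f p|) (by fun_prop) (fun x y => by simp only [(hb x y).1])
        (fun x y => by simp only [(hb x y).2]) (q.1 + q.2) q.2, ← lintegral_const_mul _ (by fun_prop)]
      refine lintegral_congr fun p => ?_
      rw [ENNReal.ofReal_mul (abs_nonneg _), add_assoc]
    simp only [this]
    rw [lintegral_mul_const _ (by fun_prop)]
    gcongr
    exact Ek_norm he
  · have : Measurable (fun z : (ℝ × ℝ) × (ℝ × ℝ) => Ek e z.2.1 z.2.2) :=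
      hE.comp (g := fun q : ℝ × ℝ => Ek e q.1 q.2) (f := fun z : (ℝ × ℝ) × (ℝ × ℝ) => z.2) (by fun_prop)
    refine Measurable.aemeasurable ?_
    simp only [Function.uncurry_def]
    fun_prop

lemma Bl_meas (he : 0 < e) (hm : Measurable f) : Measurable (Bl e f) := by
  have hE := Ek_meas he
  have : Measurable (fun z : (ℝ × ℝ) × (ℝ × ℝ) => Ek e z.2.1 z.2.2) :=
      hE.comp (g := fun q : ℝ × ℝ => Ek e q.1 q.2) (f := fun z : (ℝ × ℝ) × (ℝ × ℝ) => z.2) (by fun_prop)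
  unfold Bl
  exact Measurable.lintegral_prod_right' (f := fun z : (ℝ × ℝ) × (ℝ × ℝ) =>
    ENNReal.ofReal (|Ek e z.2.1 z.2.2| * |f (z.1.1 + z.2.1 + z.2.2, z.1.2 + z.2.2)|)) (by fun_prop)

lemma part1 (he : 0 < e) (hm : Measurable f) {L : ℝ} (hL : 0 < L) :
    (volume.restrict T2) {p : ℝ × ℝ | ¬ Good (fun j => cn e (fun t => Ad e f t p.2) (j + 1) p.1) L} ≤
      ENNReal.ofReal (3 * 10 ^ 10 / L) * ∫⁻ p in T2, ENNReal.ofReal |Ad e f p.1 p.2| := by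
  have hA := Ad_meas (e := e) hm
  have hS := good_meas (ξ := fun j p => cn e (fun t => Ad e f t p.2) (j + 1) p.1) (fun j => cn1_meas he hm (j + 1)) L
  rw [restrict_T2, Measure.prod_apply_symm hS, lintegral_prod_symm' _ (by fun_prop), ← lintegral_const_mul']
  · refine lintegral_mono fun y => ?_
    exact thmR' (F := fun t => Ad e f t y) (hA.comp (g := fun p : ℝ × ℝ => Ad e f p.1 p.2) (f := fun t => (t, y)) (by fun_prop)) he hL
  · exact ENNReal.ofReal_ne_top

lemma part2 (he : 0 < e) (hm : Measurable f) {L : ℝ} (hL : 0 < L) :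
    (volume.restrict T2) {p : ℝ × ℝ | ¬ Good (fun j => cn e (fun t => Ad e f p.1 t) (j + 1) p.2) L} ≤
      ENNReal.ofReal (3 * 10 ^ 10 / L) * ∫⁻ p in T2, ENNReal.ofReal |Ad e f p.1 p.2| := by
  have hA := Ad_meas (e := e) hm
  have hS := good_meas (ξ := fun j p => cn e (fun t => Ad e f p.1 t) (j + 1) p.2) (fun j => cn2_meas he hm (j + 1)) L
  rw [restrict_T2, Measure.prod_apply hS, lintegral_prod _ (by fun_prop), ← lintegral_const_mul']
  · refine lintegral_mono fun x => ?_
    exact thmR' (F := fun t => Ad e f x t) (hA.comp (g := fun p : ℝ × ℝ => Ad e f p.1 p.2) (f := fun t => (x, t)) (by fun_prop)) he hL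
  · exact ENNReal.ofReal_ne_top

lemma part3 (he : 0 < e) (hm : Measurable f) (hb : Biperiodic f) {L : ℝ} (hL : 0 < L) :
    (volume.restrict T2) {p : ℝ × ℝ | ENNReal.ofReal (L / 2) ≤ Bl e f p} ≤
      ENNReal.ofReal (1800 / L) * ∫⁻ p in T2, ENNReal.ofReal |f p| := by
  have h := meas_ge_le_lintegral_div (μ := volume.restrict T2) (Bl_meas he hm).aemeasurable
    (ε := ENNReal.ofReal (L / 2)) (by rw [ne_eq, ENNReal.ofReal_eq_zero, not_le]; positivity) ENNReal.ofReal_ne_top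
  refine h.trans ?_
  calc _ ≤ (ENNReal.ofReal 900 * ∫⁻ p in T2, ENNReal.ofReal |f p|) / ENNReal.ofReal (L / 2) := by
        gcongr; exact Bl_norm he hm hb
    _ = _ := by
        rw [show 1800 / L = 900 * (L / 2)⁻¹ by field_simp; norm_num, ENNReal.ofReal_mul (by norm_num),
          ENNReal.ofReal_inv_of_pos (by positivity), div_eq_mul_inv]
        ring

lemma vol_T2 : volume T2 = ENNReal.ofReal (2 * Real.pi) * ENNReal.ofReal (2 * Real.pi) := by
  have := congrArg (fun μ => μ univ) restrict_T2
  simp only [Measure.restrict_apply_univ] at this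
  rw [this, ← univ_prod_univ, Measure.prod_prod, Measure.restrict_apply_univ, vol_T1]

lemma f_norm (hm : Measurable f) :
    ∫⁻ p in T2, ENNReal.ofReal |f p| ≤ ENNReal.ofReal 120 * (1 + ∫⁻ p in T2, ENNReal.ofReal (|f p| * logPlus |f p|)) := by
  calc _ ≤ ∫⁻ p in T2, (ENNReal.ofReal 3 + ENNReal.ofReal (|f p| * logPlus |f p|)) := by
        refine lintegral_mono fun p => ?_
        rw [← ENNReal.ofReal_add (by norm_num) (mul_nonneg (abs_nonneg _) (logPlus_nonneg _))]
        exact ENNReal.ofReal_le_ofReal (le_logPlus (abs_nonneg _))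
    _ = ENNReal.ofReal 3 * (ENNReal.ofReal (2 * Real.pi) * ENNReal.ofReal (2 * Real.pi)) + ∫⁻ p in T2, ENNReal.ofReal (|f p| * logPlus |f p|) := by
        rw [lintegral_add_left measurable_const, lintegral_const, Measure.restrict_apply_univ, vol_T2]
    _ ≤ ENNReal.ofReal 120 * 1 + ENNReal.ofReal 120 * ∫⁻ p in T2, ENNReal.ofReal (|f p| * logPlus |f p|) := by
        refine add_le_add ?_ ?_
        · rw [← ENNReal.ofReal_mul (by positivity), ← ENNReal.ofReal_mul (by norm_num), mul_one]
          refine ENNReal.ofReal_le_ofReal ?_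
          nlinarith [Real.pi_lt_d2, Real.pi_pos]
        · refine le_mul_of_one_le_left (zero_le) ?_
          rw [← ENNReal.ofReal_one]; exact ENNReal.ofReal_le_ofReal (by norm_num)
    _ = _ := by rw [mul_add]

lemma per_e (he : 0 < e) (hm : Measurable f) (hb : Biperiodic f) (hi : IntegrableOn f T2) {L : ℝ} (hL : 0 < L) :
    (volume.restrict T2) {p : ℝ × ℝ | ¬ Good (fun j => (1 / (8 * Real.pi ^ 2)) * Xn e f (j + 1) p) L} ≤
      ENNReal.ofReal (10 ^ 15 / L) * (1 + ∫⁻ p in T2, ENNReal.ofReal (|f p| * logPlus |f p|)) := by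
  set J := ∫⁻ p in T2, ENNReal.ofReal (|f p| * logPlus |f p|) with hJ
  have hsub : {p : ℝ × ℝ | ¬ Good (fun j => (1 / (8 * Real.pi ^ 2)) * Xn e f (j + 1) p) L} ⊆
      {p : ℝ × ℝ | ¬ Good (fun j => cn e (fun t => Ad e f t p.2) (j + 1) p.1) L} ∪
      {p : ℝ × ℝ | ¬ Good (fun j => cn e (fun t => Ad e f p.1 t) (j + 1) p.2) L} ∪
      {p : ℝ × ℝ | ENNReal.ofReal (L / 2) ≤ Bl e f p} := by
    rintro ⟨x, y⟩ hp
    by_contra hcon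
    simp only [mem_union, mem_setOf_eq, not_or, not_not, not_le] at hcon
    obtain ⟨⟨g1, g2⟩, g3⟩ := hcon
    apply hp
    have hfin : Bl e f (x, y) ≠ ⊤ := (g3.trans_le le_top).ne
    have h3 : (Bl e f (x, y)).toReal ≤ L / 2 := by
      refine ENNReal.toReal_le_of_le_ofReal (by positivity) g3.le
    have g4 : Good (fun j => ∫ q in T2, Real.cos ((j + 1 : ℕ) * q.1) * Ek e q.1 q.2 * f (x + q.1 + q.2, y + q.2)) (2 * (L / 2)) :=
      good_of_bdd fun j => (err_le (j + 1) x y hfin).trans h3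
    have g5 := ((g1.add g2).add g4).smul (1 / (8 * Real.pi ^ 2))
    have hpi : 9 < Real.pi ^ 2 := by nlinarith [Real.pi_gt_three]
    have hc : |1 / (8 * Real.pi ^ 2)| * (L + L + 2 * (L / 2)) ≤ L := by
      rw [abs_of_pos (by positivity), one_div, inv_mul_le_iff₀ (by positivity)]
      nlinarith
    have g6 := g5.mono hc
    refine (iff_of_eq ?_).1 g6
    congr 1; ext j
    rw [Xn_eq he hm hb hi]
  have hN : ∫⁻ p in T2, ENNReal.ofReal |Ad e f p.1 p.2| ≤ ENNReal.ofReal 14500 * (1 + J) := by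
    refine (Ad_norm he hm hb).trans ?_
    rw [mul_add, mul_add]
    refine add_le_add ?_ ?_
    · rw [← ENNReal.ofReal_mul (by norm_num), mul_one]
      refine ENNReal.ofReal_le_ofReal ?_
      linarith [Real.pi_lt_d2]
    · gcongr; norm_num
  have p1 := part1 he hm hL (e := e) (f := f)
  have p2 := part2 he hm hL (e := e) (f := f)
  have p3 := part3 he hm hb hL (e := e) (f := f)
  calc _ ≤ _ := measure_mono hsub
    _ ≤ _ := measure_union_le _ _
    _ ≤ _ := add_le_add (measure_union_le _ _) le_rfl
    _ ≤ ENNReal.ofReal (3 * 10 ^ 10 / L) * (ENNReal.ofReal 14500 * (1 + J)) + ENNReal.ofReal (3 * 10 ^ 10 / L) * (ENNReal.ofReal 14500 * (1 + J)) +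
        ENNReal.ofReal (1800 / L) * (ENNReal.ofReal 120 * (1 + J)) := by
      refine add_le_add (add_le_add (p1.trans ?_) (p2.trans ?_)) (p3.trans ?_)
      · gcongr
      · gcongr
      · gcongr; exact f_norm hm
    _ = ENNReal.ofReal (3 * 10 ^ 10 / L * 14500 + 3 * 10 ^ 10 / L * 14500 + 1800 / L * 120) * (1 + J) := by
      rw [ENNReal.ofReal_add (by positivity) (by positivity), ENNReal.ofReal_add (by positivity) (by positivity),
        ENNReal.ofReal_mul (by positivity), ENNReal.ofReal_mul (by positivity)]
      ring
    _ ≤ _ := by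
      gcongr
      rw [show 3 * 10 ^ 10 / L * 14500 + 3 * 10 ^ 10 / L * 14500 + 1800 / L * 120 = (3 * 10 ^ 10 * 14500 + 3 * 10 ^ 10 * 14500 + 1800 * 120) / L by ring]
      gcongr
      norm_num

end

/-- for `f ∈ L log L(𝕋²)` and the principal values
`I_n(x,y,f) = (1/2π²) p.v. ∬_{𝕋²} [cos(nu) / (4 tan((u+v)/2) tan(v/2))] f(x+u+v, y+v) du dv`
(`n ≥ 1`, a.e. `(x,y)`), one has the weak type estimate
`|{(x,y) ∈ 𝕋² : bmo[I_n(x,y,f)] > λ}| ≤ (c/λ)(1 + ∬ |f| log⁺|f|)`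
for an absolute constant `c > 0`. -/
theorem bmo_weak_type_In :
    ∃ c : ℝ, 0 < c ∧ ∀ f : ℝ × ℝ → ℝ, Measurable f → Biperiodic f →
      IntegrableOn f T2 → IntegrableOn (fun p => |f p| * logPlus |f p|) T2 →
      ∀ I : ℕ → ℝ × ℝ → ℝ,
        (∀ n : ℕ, 1 ≤ n → ∀ᵐ p : ℝ × ℝ,
          pvI (fun q => (1 / (2 * Real.pi ^ 2)) *
              (Real.cos ((n : ℝ) * q.1) /
                (4 * Real.tan ((q.1 + q.2) / 2) * Real.tan (q.2 / 2))) *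
              f (p.1 + q.1 + q.2, p.2 + q.2)) (I n p)) →
        ∀ lam : ℝ, 0 < lam →
          volume {p : ℝ × ℝ | p ∈ T2 ∧ lam < bmoSeq (fun k => I (k + 1) p)} ≤
            ENNReal.ofReal ((c / lam) * (1 + ∫ p in T2, |f p| * logPlus |f p|)) := by
  refine ⟨7 * 10 ^ 15, by norm_num, ?_⟩
  intro f hm hb hi hL I hI lam hlam
  set J := ∫ p in T2, |f p| * logPlus |f p| with hJ
  have hnn : ∀ p, 0 ≤ |f p| * logPlus |f p| := fun p => mul_nonneg (abs_nonneg _) (logPlus_nonneg _)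
  have hJ0 : 0 ≤ J := integral_nonneg hnn
  have hJe : ∫⁻ p in T2, ENNReal.ofReal (|f p| * logPlus |f p|) = ENNReal.ofReal J :=
    (ofReal_integral_eq_lintegral_ofReal hL (Eventually.of_forall hnn)).symm
  set ee : ℕ → ℝ := fun i => 1 / ((i : ℝ) + 1) with hee
  have hee0 : ∀ i, 0 < ee i := fun i => by simp only [hee]; positivity
  have heet : Tendsto ee atTop (nhdsWithin 0 (Ioi 0)) :=
    tendsto_nhdsWithin_iff.2 ⟨tendsto_one_div_add_atTop_nhds_zero_nat, Eventually.of_forall hee0⟩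
  set S : ℕ → Set (ℝ × ℝ) := fun i =>
    {p | ¬ Good (fun j => (1 / (8 * Real.pi ^ 2)) * Xn (ee i) f (j + 1) p) (lam / 7)} with hS
  have hSb : ∀ i, (volume.restrict T2) (S i) ≤ ENNReal.ofReal ((7 * 10 ^ 15 / lam) * (1 + J)) := by
    intro i
    have := per_e (hee0 i) hm hb hi (L := lam / 7) (by positivity)
    refine this.trans (le_of_eq ?_)
    rw [hJe, ← ENNReal.ofReal_one, ← ENNReal.ofReal_add zero_le_one hJ0, ← ENNReal.ofReal_mul (by positivity)]
    congr 2
    field_simp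
  have hae : ∀ᵐ p : ℝ × ℝ, ∀ n : ℕ, Tendsto (fun i => (1 / (8 * Real.pi ^ 2)) * Xn (ee i) f (n + 1) p) atTop (nhds (I (n + 1) p)) := by
    rw [ae_all_iff]
    intro n
    filter_upwards [hI (n + 1) (by omega)] with p hp
    have := hp.comp heet
    refine this.congr fun i => ?_
    exact trunc_eq (hee0 i) f (n + 1) p
  set U : ℕ → Set (ℝ × ℝ) := fun i => ⋂ k, S (i + k) with hU
  have hUmono : Monotone U := by
    intro i j hij p hp
    simp only [hU, mem_iInter] at hp ⊢
    intro k
    have := hp (j - i + k)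
    rwa [show i + (j - i + k) = j + k by omega] at this
  have hbound : (volume.restrict T2) (⋃ i, U i) ≤ ENNReal.ofReal ((7 * 10 ^ 15 / lam) * (1 + J)) := by
    rw [hUmono.measure_iUnion]
    refine iSup_le fun i => (measure_mono ?_).trans (hSb i)
    intro p hp
    simp only [hU, mem_iInter] at hp
    exact hp 0
  have hsub : ∀ᵐ p ∂((volume : Measure (ℝ × ℝ)).restrict T2), lam < bmoSeq (fun k => I (k + 1) p) → p ∈ ⋃ i, U i := by
    filter_upwards [ae_restrict_of_ae hae] with p hp hlt
    by_contra hcon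
    have hfr : ∃ᶠ i in atTop, Good (fun j => (1 / (8 * Real.pi ^ 2)) * Xn (ee i) f (j + 1) p) (lam / 7) := by
      rw [frequently_atTop]
      intro a
      by_contra hno
      push Not at hno
      apply hcon
      rw [mem_iUnion]
      refine ⟨a, ?_⟩
      simp only [hU, mem_iInter]
      intro k
      exact hno (a + k) (by omega)
    have hg := good_of_tendsto (ξ := fun i j => (1 / (8 * Real.pi ^ 2)) * Xn (ee i) f (j + 1) p)
      (η := fun k => I (k + 1) p) hp hfr
    have := bmoSeq_le hg
    linarith
  have hset : {p : ℝ × ℝ | p ∈ T2 ∧ lam < bmoSeq (fun k => I (k + 1) p)} =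
      {p : ℝ × ℝ | lam < bmoSeq (fun k => I (k + 1) p)} ∩ T2 := by
    ext p; exact and_comm
  rw [hset, ← Measure.restrict_apply' T2_meas]
  exact (measure_mono_ae hsub).trans hbound
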